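/- Let n ≥ 2 and let ℒ_q be the B_{n+1}-module ℚ[q^{±1}] on which every standard generator σ_i acts by multiplication by −q. For every integer i ≥ 1 with 0 ≤ n−2i+1, the group cohomology in odd complementary degree satisfies: H^{n−2i+1}(B_{n+1}; ℒ_q) ≅ ℚ[q]/(φ_h) as ℚ[q^{±1}]-modules if n = i·h for an integer h ≥ 2, and H^{n−2i+1}(B_{n+1}; ℒ_q) = 0 otherwise. -/

import Mathlib

/-!
STATEMENT 14: For n ≥ 2 and i ≥ 1 with 0 ≤ n−2i+1, the cohomology of the braid group
B_{n+1} (the Artin group of type Aₙ) with coefficients in ℒ_q = ℚ[q^{±1}] (each standard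
generator acting by multiplication by −q) satisfies:
H^{n−2i+1}(B_{n+1}; ℒ_q) ≅ ℚ[q]/(φ_h) if n = i·h with h ≥ 2 an integer, and
H^{n−2i+1}(B_{n+1}; ℒ_q) = 0 otherwise.
-/

open Polynomial

/-- The alternating word `s t s t ⋯` with `m` factors, as an element of the free group. -/
def braidWord {B : Type*} (s t : B) (m : ℕ) : FreeGroup B :=
  ((List.range m).map (fun i => if i % 2 = 0 then FreeGroup.of s else FreeGroup.of t)).prod

/-- The Artin relations associated to a Coxeter matrix `M`. -/
def artinRels {B : Type*} (M : CoxeterMatrix B) : Set (FreeGroup B) :=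
  {r | ∃ s t : B, s ≠ t ∧ M s t ≠ 0 ∧ r = braidWord s t (M s t) * (braidWord t s (M s t))⁻¹}

/-- The Artin group associated to a Coxeter matrix `M`. -/
def ArtinGroup {B : Type*} (M : CoxeterMatrix B) : Type _ := PresentedGroup (artinRels M)

instance {B : Type*} (M : CoxeterMatrix B) : Group (ArtinGroup M) :=
  QuotientGroup.Quotient.group _

/-- The standard generator `g_s` of the Artin group. -/
def artinGen {B : Type*} (M : CoxeterMatrix B) (s : B) : ArtinGroup M :=
  PresentedGroup.of s

/-- The braid group on `n` strands: the Artin group of type A_{n−1}. -/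
def BraidGroup (n : ℕ) : Type := ArtinGroup (CoxeterMatrix.Aₙ (n - 1))

instance (n : ℕ) : Group (BraidGroup n) :=
  inferInstanceAs (Group (ArtinGroup (CoxeterMatrix.Aₙ (n - 1))))

/-- The standard generator `σ_i` of the braid group. -/
def braidGen (n : ℕ) (i : Fin (n - 1)) : BraidGroup n := artinGen (CoxeterMatrix.Aₙ (n - 1)) i

/-- Indices at distance at least two: the corresponding braid generators commute. -/
def FarIndex {n : ℕ} (i j : Fin n) : Prop := i.1 + 2 ≤ j.1 ∨ j.1 + 2 ≤ i.1

/-- Consecutive indices: the corresponding braid generators satisfy the braid relation. -/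
def AdjIndex {n : ℕ} (i j : Fin n) : Prop := i.1 + 1 = j.1 ∨ j.1 + 1 = i.1

/-- An elementary transformation between positive braid words. -/
inductive BraidStep (n : ℕ) : List (Fin n) → List (Fin n) → Prop
  | far (u v : List (Fin n)) (i j : Fin n) (h : FarIndex i j) :
      BraidStep n (u ++ ([i, j] ++ v)) (u ++ ([j, i] ++ v))
  | adj (u v : List (Fin n)) (i j : Fin n) (h : AdjIndex i j) :
      BraidStep n (u ++ ([i, j, i] ++ v)) (u ++ ([j, i, j] ++ v))

/-- The monoid of positive braids with `n` standard generators. -/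
def PosBraid (n : ℕ) : Type := Quot (BraidStep n)

namespace PosBraid

variable {n : ℕ}

theorem step_append_left (w : List (Fin n)) {u v : List (Fin n)} (h : BraidStep n u v) :
    BraidStep n (w ++ u) (w ++ v) := by
  cases h with
  | far u v i j h => simpa using BraidStep.far (w ++ u) v i j h
  | adj u v i j h => simpa using BraidStep.adj (w ++ u) v i j h

theorem step_append_right (w : List (Fin n)) {u v : List (Fin n)} (h : BraidStep n u v) :
    BraidStep n (u ++ w) (v ++ w) := by
  cases h with
  | far u v i j h => simpa using BraidStep.far u (v ++ w) i j h
  | adj u v i j h => simpa using BraidStep.adj u (v ++ w) i j h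

theorem step_symm {u v : List (Fin n)} (h : BraidStep n u v) : BraidStep n v u := by
  cases h with
  | far u v i j h => exact BraidStep.far u v j i h.symm
  | adj u v i j h => exact BraidStep.adj u v j i h.symm

theorem step_length {u v : List (Fin n)} (h : BraidStep n u v) : u.length = v.length := by
  cases h <;> simp

instance : Monoid (PosBraid n) where
  mul := Quot.map₂ (· ++ ·) (fun w _ _ h => step_append_left w h)
    (fun _ _ w h => step_append_right w h)
  one := Quot.mk _ []
  mul_assoc := by
    rintro ⟨a⟩ ⟨b⟩ ⟨c⟩
    exact congrArg (Quot.mk _) (List.append_assoc a b c)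
  one_mul := by
    rintro ⟨a⟩
    rfl
  mul_one := by
    rintro ⟨a⟩
    exact congrArg (Quot.mk _) (List.append_nil a)

/-- The positive braid represented by a word. -/
def ofWord (w : List (Fin n)) : PosBraid n := Quot.mk _ w

/-- The standard generators. -/
def gen (i : Fin n) : PosBraid n := ofWord [i]

theorem ofWord_surjective : Function.Surjective (ofWord (n := n)) := Quot.mk_surjective

theorem ofWord_append (u v : List (Fin n)) : ofWord (u ++ v) = ofWord u * ofWord v := rfl

theorem ofWord_nil : ofWord ([] : List (Fin n)) = 1 := rfl

theorem ofWord_cons (i : Fin n) (v : List (Fin n)) : ofWord (i :: v) = gen i * ofWord v := rfl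

theorem gen_far {i j : Fin n} (h : FarIndex i j) : gen i * gen j = gen j * gen i :=
  Quot.sound (BraidStep.far [] [] i j h)

theorem gen_adj {i j : Fin n} (h : AdjIndex i j) :
    gen i * gen j * gen i = gen j * gen i * gen j :=
  Quot.sound (BraidStep.adj [] [] i j h)

/-- The universal property of the monoid of positive braids. -/
def lift {H : Type*} [Monoid H] (f : Fin n → H)
    (hfar : ∀ i j, FarIndex i j → f i * f j = f j * f i)
    (hadj : ∀ i j, AdjIndex i j → f i * f j * f i = f j * f i * f j) : PosBraid n →* H where
  toFun := Quot.lift (fun w => (w.map f).prod) (by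
    intro u v h
    cases h with
    | far u v i j h =>
      simp only [List.map_append, List.prod_append, List.map_cons, List.map_nil, List.prod_cons,
        List.prod_nil, mul_one, hfar i j h]
    | adj u v i j h =>
      have := hadj i j h
      simp only [mul_assoc] at this
      simp only [List.map_append, List.prod_append, List.map_cons, List.map_nil, List.prod_cons,
        List.prod_nil, mul_one, this])
  map_one' := rfl
  map_mul' := by
    rintro ⟨u⟩ ⟨v⟩
    exact (congrArg List.prod (List.map_append)).trans List.prod_append

theorem lift_gen {H : Type*} [Monoid H] (f : Fin n → H) (hfar hadj) (i : Fin n) :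
    lift f hfar hadj (gen i) = f i := by
  change ([i].map f).prod = f i
  simp

/-- The length of a positive braid. -/
def len : PosBraid n → ℕ := Quot.lift List.length fun _ _ h => step_length h

theorem len_ofWord (w : List (Fin n)) : len (ofWord w) = w.length := rfl

theorem len_mul (x y : PosBraid n) : len (x * y) = len x + len y := by
  obtain ⟨u, rfl⟩ := ofWord_surjective x
  obtain ⟨v, rfl⟩ := ofWord_surjective y
  rw [← ofWord_append, len_ofWord, len_ofWord, len_ofWord, List.length_append]

@[simp] theorem len_one : len (1 : PosBraid n) = 0 := rfl

@[simp] theorem len_gen (i : Fin n) : len (gen i) = 1 := rfl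

theorem exists_eq_mul_gen {x : PosBraid n} (hx : x ≠ 1) : ∃ y i, x = y * gen i := by
  obtain ⟨w, rfl⟩ := ofWord_surjective x
  rcases List.eq_nil_or_concat w with rfl | ⟨u, i, rfl⟩
  · exact absurd ofWord_nil hx
  · exact ⟨ofWord u, i, by simp [ofWord_append, gen]⟩

/-- The conclusion of the reduction lemma: how an equality `x * gen a = y * gen b` arises from
the least common left multiple of `gen a` and `gen b`. -/
def Reduces (a b : Fin n) (x y : PosBraid n) : Prop :=
  (a = b ∧ x = y) ∨ (FarIndex a b ∧ ∃ z, x = z * gen b ∧ y = z * gen a) ∨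
    (AdjIndex a b ∧ ∃ z, x = z * gen a * gen b ∧ y = z * gen b * gen a)

theorem Reduces.symm {a b : Fin n} {x y : PosBraid n} (h : Reduces a b x y) :
    Reduces b a y x := by
  rcases h with ⟨rfl, rfl⟩ | ⟨h, z, hx, hy⟩ | ⟨h, z, hx, hy⟩
  · exact Or.inl ⟨rfl, rfl⟩
  · exact Or.inr (Or.inl ⟨h.symm, z, hy, hx⟩)
  · exact Or.inr (Or.inr ⟨h.symm, z, hy, hx⟩)

theorem Reduces.eq {a : Fin n} {x y : PosBraid n} (h : Reduces a a x y) : x = y := by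
  rcases h with ⟨_, h⟩ | ⟨h, _⟩ | ⟨h, _⟩
  · exact h
  · unfold FarIndex at h; omega
  · unfold AdjIndex at h; omega

theorem Reduces.of_far {a b : Fin n} {x y : PosBraid n} (h : Reduces a b x y)
    (hab : FarIndex a b) : ∃ z, x = z * gen b ∧ y = z * gen a := by
  rcases h with ⟨rfl, _⟩ | ⟨_, h⟩ | ⟨h, _⟩
  · unfold FarIndex at hab; omega
  · exact h
  · unfold FarIndex at hab; unfold AdjIndex at h; omega

theorem Reduces.of_adj {a b : Fin n} {x y : PosBraid n} (h : Reduces a b x y)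
    (hab : AdjIndex a b) : ∃ z, x = z * gen a * gen b ∧ y = z * gen b * gen a := by
  rcases h with ⟨rfl, _⟩ | ⟨h, _⟩ | ⟨_, h⟩
  · unfold AdjIndex at hab; omega
  · unfold FarIndex at h; unfold AdjIndex at hab; omega
  · exact h

theorem index_cases (a b : Fin n) : a = b ∨ FarIndex a b ∨ AdjIndex a b := by
  unfold FarIndex AdjIndex
  rw [Fin.ext_iff]
  omega

theorem mul_gen_far {i j : Fin n} (h : FarIndex i j) (x : PosBraid n) :
    x * gen i * gen j = x * gen j * gen i := by
  rw [mul_assoc, gen_far h, ← mul_assoc]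

theorem mul_gen_adj {i j : Fin n} (h : AdjIndex i j) (x : PosBraid n) :
    x * gen i * gen j * gen i = x * gen j * gen i * gen j := by
  have := congrArg (x * ·) (gen_adj h)
  simpa only [← mul_assoc] using this

/-- The case of `Reduces.trans_of_lt` in which the intermediate letter is far from the first and
adjacent to the last one. -/
theorem reduces_of_far_of_adj {L : ℕ}
    (ih : ∀ (x y : PosBraid n) (a b : Fin n), len x < L → x * gen a = y * gen b → Reduces a b x y)
    {a b c : Fin n} {p q : PosBraid n} (hac : FarIndex a c) (hcb : AdjIndex c b)
    (hL : len (p * gen a) = L) (e : p * gen a = q * gen c * gen b) :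
    Reduces a b (p * gen c) (q * gen b * gen c) := by
  simp only [len_mul, len_gen] at hL
  have hL' : len q + 2 = L := by
    have := congrArg len e
    simp only [len_mul, len_gen] at this
    omega
  have h := ih p (q * gen c) a b (by omega) e
  rcases index_cases a b with rfl | hab | hab
  · unfold FarIndex at hac; unfold AdjIndex at hcb; omega
  · obtain ⟨z, hp, hq⟩ := h.of_far hab
    have hz : len z + 2 = L := by
      have := congrArg len hp
      simp only [len_mul, len_gen] at this
      omega
    obtain ⟨r, hr, hr'⟩ := (ih q z c a (by omega) hq).of_far hac.symm
    refine Or.inr (Or.inl ⟨hab, r * gen b * gen c, ?_, ?_⟩)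
    · rw [hp, hr', mul_gen_adj hcb]
    · rw [hr, mul_gen_far hab, mul_gen_far hac]
  · obtain ⟨z, hp, hq⟩ := h.of_adj hab
    have hz : len z + 3 = L := by
      have := congrArg len hp
      simp only [len_mul, len_gen] at this
      omega
    obtain ⟨r, hr, hr'⟩ := (ih q (z * gen b) c a (by omega) hq).of_far hac.symm
    obtain ⟨t, ht, ht'⟩ := (ih z r b c (by omega) hr').of_adj hcb.symm
    refine Or.inr (Or.inr ⟨hab, t * gen a * gen b * gen c, ?_, ?_⟩)
    · rw [hp, ht, mul_gen_far hac.symm, mul_gen_adj hcb,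
        mul_gen_adj hab.symm, mul_gen_far hac]
    · rw [hr, ht', mul_gen_adj hab.symm, mul_gen_far hac.symm, mul_gen_adj hcb.symm,
        mul_gen_far hac]

theorem Reduces.trans_of_lt {L : ℕ}
    (ih : ∀ (x y : PosBraid n) (a b : Fin n), len x < L → x * gen a = y * gen b → Reduces a b x y)
    {a b c : Fin n} {x y w : PosBraid n} (hL : len w = L) (h : Reduces a c x w)
    (h' : Reduces c b w y) : Reduces a b x y := by
  rcases h with ⟨rfl, rfl⟩ | ⟨hac, p, rfl, hp⟩ | ⟨hac, p, rfl, hp⟩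
  · exact h'
  · rcases h' with ⟨rfl, rfl⟩ | ⟨hcb, q, hq, rfl⟩ | ⟨hcb, q, hq, rfl⟩
    · exact Or.inr (Or.inl ⟨hac, p, rfl, hp⟩)
    · have e : p * gen a = q * gen b := hp.symm.trans hq
      have hlen : len p < L := by
        rw [hp, len_mul, len_gen] at hL
        omega
      rcases ih p q a b hlen e with ⟨rfl, rfl⟩ | ⟨hab, z, rfl, rfl⟩ | ⟨hab, z, rfl, rfl⟩
      · exact Or.inl ⟨rfl, rfl⟩
      · exact Or.inr (Or.inl ⟨hab, z * gen c, mul_gen_far hcb.symm z, mul_gen_far hac z⟩)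
      · refine Or.inr (Or.inr ⟨hab, z * gen c, ?_, ?_⟩)
        · rw [mul_gen_far hcb.symm, mul_gen_far hac]
        · rw [mul_gen_far hac, mul_gen_far hcb.symm]
    · rw [hp] at hL hq
      exact reduces_of_far_of_adj ih hac hcb hL hq
  · rcases h' with ⟨rfl, rfl⟩ | ⟨hcb, q, hq, rfl⟩ | ⟨hcb, q, hq, rfl⟩
    · exact Or.inr (Or.inr ⟨hac, p, rfl, hp⟩)
    · refine (reduces_of_far_of_adj ih hcb.symm hac.symm ?_ ?_).symm
      · rw [← hq, hL]
      · rw [← hq, hp]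
    · have e : p * gen c * gen a = q * gen c * gen b := hp.symm.trans hq
      have hlen : len p + 2 = L := by
        rw [hp, len_mul, len_mul, len_gen, len_gen] at hL
        omega
      have hlenq : len q + 2 = L := by
        have := congrArg len e
        simp only [len_mul, len_gen] at this
        omega
      have h := ih (p * gen c) (q * gen c) a b (by rw [len_mul, len_gen]; omega) e
      rcases index_cases a b with rfl | hab | hab
      · have := (ih p q c c (by omega) h.eq).eq
        exact Or.inl ⟨rfl, by rw [this]⟩
      · obtain ⟨z, hz, hz'⟩ := h.of_far hab
        have hlenz : len z + 2 = L := by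
          have := congrArg len hz
          simp only [len_mul, len_gen] at this
          omega
        obtain ⟨r, hr, hr'⟩ := (ih p z c b (by omega) hz).of_adj hcb
        obtain ⟨t, ht, ht'⟩ := (ih q z c a (by omega) hz').of_adj hac.symm
        have hrt : r * gen b = t * gen a := by
          refine (ih _ _ c c ?_ (hr'.symm.trans ht')).eq
          have := congrArg len hr'
          simp only [len_mul, len_gen] at this ⊢
          omega
        have hlenr : len r + 4 = L := by
          have := congrArg len hr'
          simp only [len_mul, len_gen] at this
          omega
        obtain ⟨v, hv, hv'⟩ := (ih r t b a (by omega) hrt).of_far hab.symm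
        refine Or.inr (Or.inl ⟨hab, v * gen c * gen a * gen b * gen c, ?_, ?_⟩)
        · rw [hr, hv, mul_gen_far hab.symm, mul_gen_adj hac, mul_gen_adj hcb]
        · rw [ht, hv', mul_gen_far hab, mul_gen_adj hcb.symm, mul_gen_adj hac.symm,
            mul_gen_far hab]
      · unfold AdjIndex at hac hcb hab; omega

theorem reduces_of_step {u v : List (Fin n)} {a b : Fin n}
    (h : BraidStep n (u ++ [a]) (v ++ [b])) : Reduces a b (ofWord u) (ofWord v) := by
  generalize hw : u ++ [a] = w at h
  generalize hw' : v ++ [b] = w' at h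
  cases h with
  | far s t i j h =>
    rcases List.eq_nil_or_concat t with rfl | ⟨t, k, rfl⟩
    · have e1 : u ++ [a] = (s ++ [i]) ++ [j] := by simpa using hw
      have e2 : v ++ [b] = (s ++ [j]) ++ [i] := by simpa using hw'
      obtain ⟨rfl, e1⟩ := List.append_inj' e1 rfl
      obtain ⟨rfl, e2⟩ := List.append_inj' e2 rfl
      obtain rfl : a = j := by simpa using e1
      obtain rfl : b = i := by simpa using e2
      exact Or.inr (Or.inl ⟨h.symm, ofWord s, rfl, rfl⟩)
    · have e1 : u ++ [a] = (s ++ ([i, j] ++ t)) ++ [k] := by simpa using hw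
      have e2 : v ++ [b] = (s ++ ([j, i] ++ t)) ++ [k] := by simpa using hw'
      obtain ⟨rfl, e1⟩ := List.append_inj' e1 rfl
      obtain ⟨rfl, e2⟩ := List.append_inj' e2 rfl
      obtain rfl : a = k := by simpa using e1
      obtain rfl : b = a := by simpa using e2
      exact Or.inl ⟨rfl, Quot.sound (BraidStep.far s t i j h)⟩
  | adj s t i j h =>
    rcases List.eq_nil_or_concat t with rfl | ⟨t, k, rfl⟩
    · have e1 : u ++ [a] = (s ++ [i, j]) ++ [i] := by simpa using hw
      have e2 : v ++ [b] = (s ++ [j, i]) ++ [j] := by simpa using hw'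
      obtain ⟨rfl, e1⟩ := List.append_inj' e1 rfl
      obtain ⟨rfl, e2⟩ := List.append_inj' e2 rfl
      obtain rfl : a = i := by simpa using e1
      obtain rfl : b = j := by simpa using e2
      exact Or.inr (Or.inr ⟨h, ofWord s, by simp [mul_assoc]; rfl, by simp [mul_assoc]; rfl⟩)
    · have e1 : u ++ [a] = (s ++ ([i, j, i] ++ t)) ++ [k] := by simpa using hw
      have e2 : v ++ [b] = (s ++ ([j, i, j] ++ t)) ++ [k] := by simpa using hw'
      obtain ⟨rfl, e1⟩ := List.append_inj' e1 rfl
      obtain ⟨rfl, e2⟩ := List.append_inj' e2 rfl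
      obtain rfl : a = k := by simpa using e1
      obtain rfl : b = a := by simpa using e2
      exact Or.inl ⟨rfl, Quot.sound (BraidStep.adj s t i j h)⟩

/-- Garside's reduction lemma for positive braids. -/
theorem reduces_of_mul_gen_eq (x y : PosBraid n) (a b : Fin n) (h : x * gen a = y * gen b) :
    Reduces a b x y := by
  induction hL : len x using Nat.strong_induction_on generalizing x y a b with
  | _ L ihL =>
  obtain ⟨u, rfl⟩ := ofWord_surjective x
  obtain ⟨v, rfl⟩ := ofWord_surjective y
  have hchain : Relation.ReflTransGen (BraidStep n) (u ++ [a]) (v ++ [b]) := by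
    have := Quot.eqvGen_exact (r := BraidStep n) (a := u ++ [a]) (b := v ++ [b]) h
    generalize u ++ [a] = w at this
    generalize v ++ [b] = w' at this
    clear ihL hL h
    induction this with
    | rel _ _ h => exact Relation.ReflTransGen.single h
    | refl _ => exact Relation.ReflTransGen.refl
    | symm _ _ _ ih => 
      have : Std.Symm (BraidStep n) := ⟨fun _ _ => step_symm⟩
      exact Std.Symm.symm _ _ ih
    | trans _ _ _ _ _ ih ih' => exact ih.trans ih'
  clear h
  generalize hw : v ++ [b] = w at hchain
  induction hchain generalizing v b with
  | refl =>
    obtain ⟨rfl, e⟩ := List.append_inj' hw rfl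
    obtain rfl : b = a := by simpa using e
    exact Or.inl ⟨rfl, rfl⟩
  | @tail w₁ w₂ hc hs ih =>
    subst hw
    have hlen : w₁.length = v.length + 1 := by simpa using step_length hs
    rcases List.eq_nil_or_concat w₁ with rfl | ⟨t, c, rfl⟩
    · simp at hlen
    · have h1 := ih c t (by simp)
      have h2 : Reduces c b (ofWord t) (ofWord v) := reduces_of_step (by simpa using hs)
      refine h1.trans_of_lt (fun x y a b hx e => ihL _ hx x y a b e rfl) ?_ h2
      have : ∀ w, Relation.ReflTransGen (BraidStep n) (u ++ [a]) w →
          w.length = u.length + 1 := by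
        intro w hw
        induction hw with
        | refl => simp
        | tail _ hs ih => rw [← step_length hs, ih]
      have := this _ hc
      rw [← hL, len_ofWord, len_ofWord]
      simpa using this

theorem mul_gen_right_cancel {x y : PosBraid n} {a : Fin n} (h : x * gen a = y * gen a) :
    x = y :=
  (reduces_of_mul_gen_eq x y a a h).eq

instance : IsRightCancelMul (PosBraid n) where
  mul_right_cancel := by
    intro z x y h
    obtain ⟨w, rfl⟩ := ofWord_surjective z
    change x * ofWord w = y * ofWord w at h
    induction w generalizing x y with
    | nil => simpa [ofWord_nil] using h
    | cons i w ih =>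
      rw [ofWord_cons, ← mul_assoc, ← mul_assoc] at h
      exact mul_gen_right_cancel (ih h)

end PosBraid

/-- A sequence of elements satisfying the braid relations of `n` generators, the remaining
elements being only required to commute with all distant ones. -/
structure IsBraidSeq {H : Type*} [Monoid H] (n : ℕ) (τ : ℕ → H) : Prop where
  far : ∀ i j, i + 2 ≤ j → τ i * τ j = τ j * τ i
  adj : ∀ i, i + 1 < n → τ i * τ (i + 1) * τ i = τ (i + 1) * τ i * τ (i + 1)

namespace BraidComplex

section Monoid

variable {H : Type*} [Monoid H] (τ : ℕ → H)

/-- The descending product `τ (s + b - 1) * ⋯ * τ s`. -/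
def chain (s : ℕ) : ℕ → H
  | 0 => 1
  | b + 1 => τ (s + b) * chain s b

/-- The positive permutation braid exchanging blocks of `a` and `b` strands at offset `o`. -/
def swap (o : ℕ) : ℕ → ℕ → H
  | 0, _ => 1
  | a + 1, b => swap o a b * chain τ (o + a) b

/-- The Garside half twist on the `c + 1` strands at offset `o`. -/
def halfTwist (o : ℕ) : ℕ → H
  | 0 => 1
  | c + 1 => swap τ o (c + 1) 1 * halfTwist o c

/-- The product of half twists on consecutive blocks; the entry `c` is a block of `c + 1`
strands. -/
def blockTwist (o : ℕ) : List ℕ → H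
  | [] => 1
  | c :: w => halfTwist τ o c * blockTwist (o + c + 1) w

variable {τ}

theorem chain_add (s b c : ℕ) : chain τ s (b + c) = chain τ (s + b) c * chain τ s b := by
  induction c with
  | zero => simp [chain]
  | succ c ih => rw [← add_assoc, chain, ih, chain, mul_assoc, add_assoc]

theorem commute_chain {y : H} {s b : ℕ} (h : ∀ i, s ≤ i → i < s + b → Commute y (τ i)) :
    Commute y (chain τ s b) := by
  induction b with
  | zero => exact Commute.one_right y
  | succ b ih =>
    exact (h _ (by omega) (by omega)).mul_right (ih fun i h1 h2 => h i h1 (by omega))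

theorem chain_mem {K : Submonoid H} {s b : ℕ} (h : ∀ i, s ≤ i → i < s + b → τ i ∈ K) :
    chain τ s b ∈ K := by
  induction b with
  | zero => exact one_mem K
  | succ b ih =>
    exact mul_mem (h _ (by omega) (by omega)) (ih fun i h1 h2 => h i h1 (by omega))

theorem swap_mem {K : Submonoid H} {o a b : ℕ} (h : ∀ i, o ≤ i → i + 1 < o + a + b → τ i ∈ K) :
    swap τ o a b ∈ K := by
  induction a with
  | zero => exact one_mem K
  | succ a ih =>
    exact mul_mem (ih fun i h1 h2 => h i h1 (by omega))
      (chain_mem fun i h1 h2 => h i (by omega) (by omega))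

theorem halfTwist_mem {K : Submonoid H} {o c : ℕ} (h : ∀ i, o ≤ i → i < o + c → τ i ∈ K) :
    halfTwist τ o c ∈ K := by
  induction c with
  | zero => exact one_mem K
  | succ c ih =>
    exact mul_mem (swap_mem fun i h1 h2 => h i h1 (by omega))
      (ih fun i h1 h2 => h i h1 (by omega))

theorem blockTwist_mem {K : Submonoid H} {o : ℕ} {w : List ℕ} (h : ∀ i, o ≤ i → τ i ∈ K) :
    blockTwist τ o w ∈ K := by
  induction w generalizing o with
  | nil => exact one_mem K
  | cons c w ih =>
    exact mul_mem (halfTwist_mem fun i h1 _ => h i h1) (ih fun i h1 => h i (by omega))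

theorem swap_zero_right (o a : ℕ) : swap τ o a 0 = 1 := by
  induction a with
  | zero => rfl
  | succ a ih => rw [swap, ih, chain, one_mul]

theorem commute_swap {y : H} {o a b : ℕ}
    (h : ∀ i, o ≤ i → i + 1 < o + a + b → Commute y (τ i)) : Commute y (swap τ o a b) := by
  induction a with
  | zero => exact Commute.one_right y
  | succ a ih =>
    exact (ih fun i h1 h2 => h i h1 (by omega)).mul_right
      (commute_chain fun i h1 h2 => h i (by omega) (by omega))

theorem commute_halfTwist {y : H} {o c : ℕ} (h : ∀ i, o ≤ i → i < o + c → Commute y (τ i)) :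
    Commute y (halfTwist τ o c) := by
  induction c with
  | zero => exact Commute.one_right y
  | succ c ih =>
    exact (commute_swap fun i h1 h2 => h i h1 (by omega)).mul_right
      (ih fun i h1 h2 => h i h1 (by omega))

theorem commute_blockTwist {y : H} {o : ℕ} {w : List ℕ}
    (h : ∀ i, o ≤ i → i + 1 < o + w.sum + w.length → Commute y (τ i)) :
    Commute y (blockTwist τ o w) := by
  induction w generalizing o with
  | nil => exact Commute.one_right y
  | cons c w ih =>
    simp only [List.sum_cons, List.length_cons] at h
    exact (commute_halfTwist fun i h1 h2 => h i h1 (by omega)).mul_right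
      (ih fun i h1 h2 => h i (by omega) (by omega))

variable {n : ℕ}

theorem _root_.IsBraidSeq.commute (hτ : IsBraidSeq n τ) {i j : ℕ} (h : i + 2 ≤ j ∨ j + 2 ≤ i) :
    Commute (τ i) (τ j) := by
  rcases h with h | h
  · exact hτ.far i j h
  · exact (hτ.far j i h).symm

theorem chain_mul_gen (hτ : IsBraidSeq n τ) {s b j : ℕ} (h1 : s ≤ j) (h2 : j + 1 < s + b) (h3 : s + b ≤ n) :
    chain τ s b * τ (j + 1) = τ j * chain τ s b := by
  obtain ⟨d, rfl⟩ : ∃ d, j = s + d := ⟨j - s, by omega⟩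
  obtain ⟨e, rfl⟩ : ∃ e, b = d + (2 + e) := ⟨b - d - 2, by omega⟩
  have c1 : Commute (τ (s + d + 1)) (chain τ s d) :=
    commute_chain fun i _ _ => hτ.commute (by omega)
  have c2 : Commute (τ (s + d)) (chain τ (s + d + 2) e) :=
    commute_chain fun i _ _ => hτ.commute (by omega)
  have e2 : chain τ (s + d) 2 = τ (s + d + 1) * τ (s + d) := by simp [chain]
  rw [chain_add, chain_add, e2, mul_assoc, ← c1.eq]
  simp only [← mul_assoc]
  rw [c2.eq]
  have := hτ.adj (s + d) (by omega)
  rw [mul_assoc (chain τ (s + d + 2) e), mul_assoc (chain τ (s + d + 2) e),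
    ← this]
  simp only [mul_assoc]

theorem chain_mul_chain (hτ : IsBraidSeq n τ) {s b t c : ℕ} (h1 : s ≤ t) (h2 : t + c + 1 ≤ s + b) (h3 : s + b ≤ n) :
    chain τ s b * chain τ (t + 1) c = chain τ t c * chain τ s b := by
  induction c with
  | zero => simp [chain]
  | succ c ih =>
    rw [chain, chain, ← mul_assoc, show t + 1 + c = t + c + 1 by omega,
      chain_mul_gen hτ (by omega) (by omega) h3, mul_assoc, ih (by omega), mul_assoc]

theorem chain_mul_swap (hτ : IsBraidSeq n τ) {s d t a b : ℕ} (h1 : s ≤ t) (h2 : t + a + b ≤ s + d) (h3 : s + d ≤ n) :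
    chain τ s d * swap τ (t + 1) a b = swap τ t a b * chain τ s d := by
  induction a with
  | zero => simp [swap]
  | succ a ih =>
    rw [swap, swap, ← mul_assoc, ih (by omega), mul_assoc, mul_assoc,
      show t + 1 + a = t + a + 1 by omega, chain_mul_chain hτ (by omega) (by omega) h3]

theorem chain_comp_chain (o a b c : ℕ) :
    chain τ (o + a + b) c * chain τ (o + a) b = chain τ (o + a) (b + c) :=
  (chain_add (o + a) b c).symm

theorem swap_assoc (hτ : IsBraidSeq n τ) {o a b c : ℕ} (h : o + a + b + c ≤ n + 1) :
    swap τ o (a + b) c * swap τ o a b = swap τ o a (b + c) * swap τ (o + a) b c := by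
  induction a with
  | zero => simp [swap]
  | succ a ih =>
    rcases b with _ | b
    · simp [swap_zero_right, swap, chain]
    · have hc : Commute (chain τ (o + (a + (b + 1))) c) (swap τ o a (b + 1)) :=
        commute_swap fun i _ _ => (commute_chain fun j _ _ => hτ.commute (by omega)).symm
      rw [show a + 1 + (b + 1) = (a + (b + 1)) + 1 by omega, swap, swap, ← mul_assoc,
        mul_assoc _ (chain τ _ c), hc.eq, ← mul_assoc, ih (by omega),
        mul_assoc, ← add_assoc o a, chain_comp_chain, swap.eq_2 τ o (b + 1 + c) a, mul_assoc,
        mul_assoc, ← add_assoc o,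
        chain_mul_swap hτ (by omega) (by omega) (by omega)]

theorem swap_mul_halfTwist (hτ : IsBraidSeq n τ) {o a b : ℕ} (h : o + a + b + 1 ≤ n) :
    swap τ o (a + 1) (b + 1) * halfTwist τ o a * halfTwist τ (o + a + 1) b =
      halfTwist τ o (a + b + 1) := by
  induction b with
  | zero => simp [halfTwist]
  | succ b ih =>
    have hc : Commute (halfTwist τ o a) (swap τ (o + (a + 1)) (b + 1) 1) :=
      commute_swap fun i _ _ => (commute_halfTwist fun j _ _ => hτ.commute (by omega)).symm
    have := swap_assoc hτ (o := o) (a := a + 1) (b := b + 1) (c := 1) (by omega)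
    rw [← add_assoc a, halfTwist.eq_2 τ o (a + b + 1), ← ih (by omega), halfTwist,
      show a + b + 1 + 1 = a + 1 + (b + 1) by omega]
    simp only [← mul_assoc]
    rw [this, mul_assoc _ (halfTwist τ o a), add_assoc o a 1, hc.eq, ← mul_assoc]

end Monoid

section Ring

variable {A : Type*} [Ring A] (τ : ℕ → A)

/-- The sum over all shuffles of blocks of `a` and `b` strands at offset `o`. -/
def shuffle (o : ℕ) : ℕ → ℕ → A
  | 0, _ => 1
  | _ + 1, 0 => 1
  | a + 1, b + 1 => shuffle o (a + 1) b + shuffle o a (b + 1) * chain τ (o + a) (b + 1)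

variable {τ}

theorem shuffle_zero_left (o b : ℕ) : shuffle τ o 0 b = 1 := by
  rw [shuffle]

theorem shuffle_zero_right (o a : ℕ) : shuffle τ o a 0 = 1 := by
  cases a <;> rw [shuffle]

theorem shuffle_succ_succ (o a b : ℕ) : shuffle τ o (a + 1) (b + 1) =
    shuffle τ o (a + 1) b + shuffle τ o a (b + 1) * chain τ (o + a) (b + 1) := by
  rw [shuffle]

theorem commute_shuffle {y : A} {o a b : ℕ}
    (h : ∀ i, o ≤ i → i + 1 < o + a + b → Commute y (τ i)) : Commute y (shuffle τ o a b) := by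
  induction hN : a + b generalizing a b with
  | zero =>
    obtain rfl : a = 0 := by omega
    rw [shuffle_zero_left]
    exact Commute.one_right y
  | succ N ih =>
    rcases a with _ | a
    · rw [shuffle_zero_left]
      exact Commute.one_right y
    rcases b with _ | b
    · rw [shuffle_zero_right]
      exact Commute.one_right y
    rw [shuffle_succ_succ]
    exact (ih (fun i h1 h2 => h i h1 (by omega)) (by omega)).add_right
      ((ih (fun i h1 h2 => h i h1 (by omega)) (by omega)).mul_right
        (commute_chain fun i h1 h2 => h i (by omega) (by omega)))

variable {n : ℕ}

theorem chain_mul_shuffle (hτ : IsBraidSeq n τ) {s d t a b : ℕ} (h1 : s ≤ t)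
    (h2 : t + a + b ≤ s + d) (h3 : s + d ≤ n) :
    chain τ s d * shuffle τ (t + 1) a b = shuffle τ t a b * chain τ s d := by
  induction hN : a + b generalizing a b with
  | zero =>
    obtain rfl : a = 0 := by omega
    simp [shuffle_zero_left]
  | succ N ih =>
    rcases a with _ | a
    · simp [shuffle_zero_left]
    rcases b with _ | b
    · simp [shuffle_zero_right]
    rw [shuffle_succ_succ, shuffle_succ_succ, mul_add, add_mul, ih (by omega) (by omega),
      ← mul_assoc, ih (by omega) (by omega), mul_assoc, mul_assoc,
      show t + 1 + a = t + a + 1 by omega, chain_mul_chain hτ (by omega) (by omega) h3]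

theorem shuffle_assoc (hτ : IsBraidSeq n τ) {o a b c : ℕ} (h : o + a + b + c ≤ n + 1) :
    shuffle τ o (a + b) c * shuffle τ o a b =
      shuffle τ o a (b + c) * shuffle τ (o + a) b c := by
  induction hN : a + b + c generalizing a b c with
  | zero =>
    obtain rfl : a = 0 := by omega
    obtain rfl : b = 0 := by omega
    simp [shuffle_zero_left]
  | succ N ih =>
    rcases a with _ | a
    · simp [shuffle_zero_left]
    rcases b with _ | b
    · simp [shuffle_zero_right, shuffle_zero_left]
    rcases c with _ | c
    · simp [shuffle_zero_right]
    have i1 := ih (a := a + 1) (b := b + 1) (c := c) (by omega) (by omega)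
    have i2 := ih (a := a + 1) (b := b) (c := c + 1) (by omega) (by omega)
    have i3 := ih (a := a) (b := b + 1) (c := c + 1) (by omega) (by omega)
    have c1 : Commute (chain τ (o + (a + b + 1)) (c + 1)) (shuffle τ o (a + 1) b) :=
      commute_shuffle fun i _ _ => (commute_chain fun j _ _ => hτ.commute (by omega)).symm
    have c2 : Commute (chain τ (o + (a + b + 1)) (c + 1)) (shuffle τ o a (b + 1)) :=
      commute_shuffle fun i _ _ => (commute_chain fun j _ _ => hτ.commute (by omega)).symm
    have e1 : shuffle τ o (a + 1 + (b + 1)) (c + 1) = shuffle τ o (a + 1 + (b + 1)) c +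
        shuffle τ o (a + b + 1) (c + 1) * chain τ (o + (a + b + 1)) (c + 1) := by
      rw [show a + 1 + (b + 1) = a + b + 1 + 1 by omega, shuffle_succ_succ]
    have e2 : shuffle τ o (a + 1) (b + 1 + (c + 1)) = shuffle τ o (a + 1) (b + 1 + c) +
        shuffle τ o a (b + 1 + (c + 1)) * chain τ (o + a) (b + 1 + (c + 1)) := by
      rw [← add_assoc (b + 1), shuffle_succ_succ]
    have e3 : shuffle τ o (a + b + 1) (c + 1) * chain τ (o + (a + b + 1)) (c + 1) *
        shuffle τ o (a + 1) (b + 1) =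
        shuffle τ o (a + 1) (b + (c + 1)) * shuffle τ (o + (a + 1)) b (c + 1) *
          chain τ (o + (a + b + 1)) (c + 1) +
        shuffle τ o a (b + 1 + (c + 1)) * shuffle τ (o + a) (b + 1) (c + 1) *
          chain τ (o + a) (b + 1 + (c + 1)) := by
      rw [shuffle_succ_succ o a b, mul_add, mul_assoc _ _ (shuffle τ o (a + 1) b), c1.eq,
        ← mul_assoc, ← mul_assoc, mul_assoc _ _ (shuffle τ o a (b + 1)), c2.eq,
        ← i2, ← i3, ← chain_comp_chain o a (b + 1) (c + 1),
        show a + 1 + b = a + b + 1 by omega, show a + (b + 1) = a + b + 1 by omega,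
        show o + a + (b + 1) = o + (a + b + 1) by omega]
      simp only [mul_assoc]
    have e4 : shuffle τ (o + (a + 1)) (b + 1) (c + 1) = shuffle τ (o + (a + 1)) (b + 1) c +
        shuffle τ (o + (a + 1)) b (c + 1) * chain τ (o + (a + b + 1)) (c + 1) := by
      rw [shuffle_succ_succ, show o + (a + 1) + b = o + (a + b + 1) by omega]
    rw [e1, add_mul, e3, i1, e2, add_mul, mul_assoc _ (chain τ (o + a) _), ← add_assoc o,
      chain_mul_shuffle hτ (by omega) (by omega) (by omega), add_assoc o, e4, mul_add,
      show b + (c + 1) = b + 1 + c by omega]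
    simp only [mul_assoc, add_assoc]

end Ring

end BraidComplex

namespace BraidComplex

/-- The ways to cut a block labelled `c` into two blocks, i.e. the pairs `(a, b)` with
`a + b + 1 = c`. -/
def cuts : ℕ → Finset (ℕ × ℕ)
  | 0 => ∅
  | c + 1 => Finset.HasAntidiagonal.antidiagonal c

theorem mem_cuts {c : ℕ} {p : ℕ × ℕ} : p ∈ cuts c ↔ p.1 + p.2 + 1 = c := by
  cases c <;> simp [cuts]

theorem sum_cuts_assoc {V : Type*} [AddCommMonoid V] (c : ℕ) (f : ℕ → ℕ → ℕ → V) :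
    ∑ p ∈ cuts c, ∑ r ∈ cuts p.1, f r.1 r.2 p.2 =
      ∑ p ∈ cuts c, ∑ r ∈ cuts p.2, f p.1 r.1 r.2 := by
  rw [Finset.sum_sigma', Finset.sum_sigma']
  refine Finset.sum_nbij' (fun x => ⟨(x.2.1, x.2.2 + x.1.2 + 1), (x.2.2, x.1.2)⟩)
    (fun x => ⟨(x.1.1 + x.2.1 + 1, x.2.2), (x.1.1, x.2.1)⟩) ?_ ?_ ?_ ?_ ?_
  · rintro ⟨⟨a, b⟩, ⟨d, e⟩⟩ h
    simp only [Finset.mem_sigma, mem_cuts, and_true] at h ⊢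
    omega
  · rintro ⟨⟨a, b⟩, ⟨d, e⟩⟩ h
    simp only [Finset.mem_sigma, mem_cuts, and_true] at h ⊢
    omega
  · rintro ⟨⟨a, b⟩, ⟨d, e⟩⟩ h
    simp only [Finset.mem_sigma, mem_cuts] at h ⊢
    obtain ⟨-, rfl⟩ := h
    rfl
  · rintro ⟨⟨a, b⟩, ⟨d, e⟩⟩ h
    simp only [Finset.mem_sigma, mem_cuts] at h ⊢
    obtain ⟨-, rfl⟩ := h
    rfl
  · rintro ⟨⟨a, b⟩, ⟨d, e⟩⟩ h
    rfl

section Ring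

variable {A : Type*} [Ring A] (τ : ℕ → A)

/-- Adding a block in front of a list of blocks. -/
noncomputable def consMap (A : Type*) [Ring A] (c : ℕ) : (List ℕ →₀ A) →ₗ[A] (List ℕ →₀ A) :=
  Finsupp.lmapDomain A A (List.cons c)

theorem consMap_single (c : ℕ) (w : List ℕ) (r : A) :
    consMap A c (Finsupp.single w r) = Finsupp.single (c :: w) r :=
  Finsupp.mapDomain_single

/-- The part of the boundary in which the first block is cut. -/
noncomputable def cutHead (o c : ℕ) (w : List ℕ) : List ℕ →₀ A :=
  ∑ p ∈ cuts c, Finsupp.single (p.1 :: p.2 :: w) (shuffle τ o (p.1 + 1) (p.2 + 1))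

/-- The boundary of a list of blocks at offset `o`. -/
noncomputable def bd : ℕ → List ℕ → (List ℕ →₀ A)
  | _, [] => 0
  | o, c :: w => cutHead τ o c w - consMap A c (bd (o + c + 1) w)

/-- The boundary map of the complex of lists of blocks at offset `o`. -/
noncomputable def boundary (o : ℕ) : (List ℕ →₀ A) →ₗ[A] (List ℕ →₀ A) :=
  Finsupp.linearCombination A (bd τ o)

theorem boundary_single (o : ℕ) (w : List ℕ) (r : A) :
    boundary τ o (Finsupp.single w r) = r • bd τ o w :=
  Finsupp.linearCombination_single A r w

theorem boundary_consMap (o c : ℕ) (v : List ℕ →₀ A) :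
    boundary τ o (consMap A c v) = Finsupp.linearCombination A (cutHead τ o c) v -
      consMap A c (boundary τ (o + c + 1) v) := by
  induction v using Finsupp.induction_linear with
  | zero => simp
  | add f g hf hg => rw [map_add, map_add, hf, hg, map_add, map_add, map_add]; abel
  | single w r =>
    rw [consMap_single, boundary_single, boundary_single, bd, smul_sub, map_smul,
      Finsupp.linearCombination_single]

variable {τ}

/-- The coefficients of a boundary commute with everything that commutes with the generators
involved. -/
theorem commute_bd {y : A} {o : ℕ} {w : List ℕ}
    (h : ∀ i, o ≤ i → i + 1 < o + w.sum + w.length → Commute y (τ i)) (v : List ℕ) :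
    Commute y (bd τ o w v) := by
  classical
  induction w generalizing o v with
  | nil => simp [bd]
  | cons c w ih =>
    simp only [List.sum_cons, List.length_cons] at h
    rw [bd, Finsupp.sub_apply]
    refine Commute.sub_right ?_ ?_
    · rw [cutHead, Finsupp.finsetSum_apply]
      refine Commute.sum_right _ _ _ fun p hp => ?_
      rw [mem_cuts] at hp
      rw [Finsupp.single_apply]
      split_ifs
      · exact commute_shuffle fun i h1 h2 => h i h1 (by omega)
      · exact Commute.zero_right y
    · by_cases hv : ∃ v', v = c :: v'
      · obtain ⟨v', rfl⟩ := hv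
        have : consMap A c (bd τ (o + c + 1) w) (c :: v') = bd τ (o + c + 1) w v' :=
          Finsupp.mapDomain_apply (List.cons_injective) _ _
        rw [this]
        exact ih (fun i h1 h2 => h i (by omega) (by omega)) v'
      · have : consMap A c (bd τ (o + c + 1) w) v = 0 := by
          refine Finsupp.mapDomain_of_notMem_range _ _ ?_
          rintro ⟨v', rfl⟩
          exact hv ⟨v', rfl⟩
        rw [this]
        exact Commute.zero_right y

theorem linearCombination_cutHead {o c : ℕ} {v : List ℕ →₀ A}
    (h : ∀ p ∈ cuts c, ∀ w, Commute (shuffle τ o (p.1 + 1) (p.2 + 1)) (v w)) :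
    Finsupp.linearCombination A (cutHead τ o c) v =
      ∑ p ∈ cuts c, shuffle τ o (p.1 + 1) (p.2 + 1) • consMap A p.1 (consMap A p.2 v) := by
  have hv : v = ∑ w ∈ v.support, Finsupp.single w (v w) := (Finsupp.sum_single v).symm
  rw [Finsupp.linearCombination_apply, Finsupp.sum]
  simp only [cutHead, Finset.smul_sum, Finsupp.smul_single, smul_eq_mul]
  rw [Finset.sum_comm]
  refine Finset.sum_congr rfl fun p hp => ?_
  conv_rhs => rw [hv]
  rw [map_sum, map_sum, Finset.smul_sum]
  refine Finset.sum_congr rfl fun w _ => ?_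
  rw [consMap_single, consMap_single, Finsupp.smul_single, smul_eq_mul, (h p hp w).eq]

theorem boundary_bd {n : ℕ} (hτ : IsBraidSeq n τ) {o : ℕ} {w : List ℕ}
    (h : o + w.sum + w.length ≤ n + 1) : boundary τ o (bd τ o w) = 0 := by
  induction w generalizing o with
  | nil => simp [bd]
  | cons c w ih =>
    simp only [List.sum_cons, List.length_cons] at h
    have hcom : ∀ p ∈ cuts c, ∀ v,
        Commute (shuffle τ o (p.1 + 1) (p.2 + 1)) (bd τ (o + c + 1) w v) := by
      intro p hp v
      rw [mem_cuts] at hp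
      exact commute_bd (fun i _ _ => (commute_shuffle fun j _ _ => hτ.commute (by omega)).symm) v
    rw [bd, map_sub, boundary_consMap, ih (by omega), map_zero, sub_zero,
      linearCombination_cutHead hcom, cutHead, map_sum, ← Finset.sum_sub_distrib]
    have key : ∑ p ∈ cuts c, ∑ r ∈ cuts p.1, Finsupp.single (r.1 :: r.2 :: p.2 :: w)
          (shuffle τ o (r.1 + 1 + (r.2 + 1)) (p.2 + 1) * shuffle τ o (r.1 + 1) (r.2 + 1)) =
        ∑ p ∈ cuts c, ∑ r ∈ cuts p.2, Finsupp.single (p.1 :: r.1 :: r.2 :: w)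
          (shuffle τ o (p.1 + 1) (r.1 + 1 + (r.2 + 1)) *
            shuffle τ (o + p.1 + 1) (r.1 + 1) (r.2 + 1)) := by
      rw [sum_cuts_assoc c fun d e b => Finsupp.single (d :: e :: b :: w)
          (shuffle τ o (d + 1 + (e + 1)) (b + 1) * shuffle τ o (d + 1) (e + 1))]
      refine Finset.sum_congr rfl fun p hp => Finset.sum_congr rfl fun r hr => ?_
      rw [mem_cuts] at hp hr
      rw [shuffle_assoc hτ (by omega), add_assoc o p.1 1]
    refine Eq.trans (Finset.sum_congr rfl fun p hp => ?_)
      (Finset.sum_sub_distrib (s := cuts c) _ _ |>.trans (sub_eq_zero.mpr key))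
    rw [mem_cuts] at hp
    rw [boundary_single, bd, bd, map_sub, cutHead, cutHead,
      show o + p.1 + 1 + p.2 + 1 = o + c + 1 by omega, smul_sub, smul_sub, sub_sub, sub_add_cancel,
      map_sum, Finset.smul_sum, Finset.smul_sum]
    congr 1
    · refine Finset.sum_congr rfl fun r hr => ?_
      rw [mem_cuts] at hr
      rw [Finsupp.smul_single, smul_eq_mul, show r.1 + 1 + (r.2 + 1) = p.1 + 1 by omega]
    · refine Finset.sum_congr rfl fun r hr => ?_
      rw [mem_cuts] at hr
      rw [consMap_single, Finsupp.smul_single, smul_eq_mul,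
        show r.1 + 1 + (r.2 + 1) = p.2 + 1 by omega]

end Ring

end BraidComplex

/-- A complex with a matching on its basis, compatible with a filtration by `ℓ`, is exact in
positive degrees: the elements outside `I` are matched with the elements of `I` by `π`. -/
theorem exists_map_eq_of_matching {k V B : Type*} [CommRing k] [AddCommGroup V] [Module k V]
    (b : Module.Basis B k V) (d : V →ₗ[k] V) (ℓ : B → ℕ) (S : ℕ → Set B) (I : Set B) (π : B → B)
    (hdd : ∀ j, ∀ x ∈ S j, d (d (b x)) = 0)
    (hmono : ∀ j, ∀ x ∈ S (j + 1), d (b x) ∈ Submodule.span k (b '' {y | ℓ y ≤ ℓ x}))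
    (hπI : ∀ j, ∀ x ∈ S (j + 1), x ∉ I → π x ∈ I ∧ ℓ (π x) = ℓ x)
    (hd : ∀ j, ∀ x ∈ S (j + 1), x ∉ I → ∃ ε : kˣ, d (b x) - ε • b (π x) ∈
      Submodule.span k (b '' {v | v ∈ S j ∧ (ℓ v < ℓ x ∨ (ℓ v = ℓ x ∧ v ∉ I))}))
    (hinj : ∀ j, ∀ x ∈ S (j + 1), ∀ y ∈ S (j + 1), x ∉ I → y ∉ I → π x = π y → x = y)
    (hsurj : ∀ j, ∀ x ∈ S (j + 1), x ∈ I → ∃ y ∈ S (j + 2), y ∉ I ∧ π y = x)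
    (j : ℕ) (z : V) (hz : z ∈ Submodule.span k (b '' S (j + 1))) (hdz : d z = 0) :
    ∃ y ∈ Submodule.span k (b '' S (j + 2)), d y = z := by
  have main : ∀ L : ℕ, ∀ z ∈ Submodule.span k (b '' {x | x ∈ S (j + 1) ∧ ℓ x < L}), d z = 0 →
      ∃ y ∈ Submodule.span k (b '' S (j + 2)), d y = z := by
    intro L
    induction L with
    | zero =>
      intro z hz _
      refine ⟨0, Submodule.zero_mem _, ?_⟩
      have hempty : {x | x ∈ S (j + 1) ∧ ℓ x < 0} = ∅ := by simp
      rw [hempty, Set.image_empty, Submodule.span_empty, Submodule.mem_bot] at hz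
      rw [hz, map_zero]
    | succ L ih =>
      intro z hz hdz
      have hdec : ∃ y ∈ Submodule.span k (b '' S (j + 2)),
          ∃ z₁ ∈ Submodule.span k (b '' {x | x ∈ S (j + 1) ∧ ℓ x = L ∧ x ∉ I}),
          ∃ z₂ ∈ Submodule.span k (b '' {x | x ∈ S (j + 1) ∧ ℓ x < L}), z = d y + z₁ + z₂ := by
        clear hdz
        induction hz using Submodule.span_induction with
        | zero => exact ⟨0, zero_mem _, 0, zero_mem _, 0, zero_mem _, by simp⟩
        | add u v _ _ hu hv =>
          obtain ⟨y, hy, z₁, h₁, z₂, h₂, rfl⟩ := hu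
          obtain ⟨y', hy', z₁', h₁', z₂', h₂', rfl⟩ := hv
          exact ⟨y + y', add_mem hy hy', z₁ + z₁', add_mem h₁ h₁', z₂ + z₂', add_mem h₂ h₂', by
            rw [map_add]; abel⟩
        | smul r u _ hu =>
          obtain ⟨y, hy, z₁, h₁, z₂, h₂, rfl⟩ := hu
          exact ⟨r • y, Submodule.smul_mem _ _ hy, r • z₁, Submodule.smul_mem _ _ h₁, r • z₂,
            Submodule.smul_mem _ _ h₂, by rw [map_smul, smul_add, smul_add]⟩
        | mem u hu =>
          obtain ⟨x, ⟨hxS, hxL⟩, rfl⟩ := hu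
          rcases lt_or_ge (ℓ x) L with hlt | hge
          · exact ⟨0, zero_mem _, 0, zero_mem _, b x,
              Submodule.subset_span ⟨x, ⟨hxS, hlt⟩, rfl⟩, by simp⟩
          have hxL' : ℓ x = L := by omega
          by_cases hxI : x ∈ I
          · obtain ⟨y, hyS, hyI, rfl⟩ := hsurj j x hxS hxI
            obtain ⟨ε, hε⟩ := hd (j + 1) y hyS hyI
            have hly := (hπI (j + 1) y hyS hyI).2
            have hsub : {v | v ∈ S (j + 1) ∧ (ℓ v < ℓ y ∨ (ℓ v = ℓ y ∧ v ∉ I))} ⊆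
                {x | x ∈ S (j + 1) ∧ ℓ x = L ∧ x ∉ I} ∪ {x | x ∈ S (j + 1) ∧ ℓ x < L} := by
              rintro v ⟨hv, h | h⟩
              · exact Or.inr ⟨hv, by rw [← hxL', hly]; exact h⟩
              · exact Or.inl ⟨hv, by rw [h.1, ← hxL', hly], h.2⟩
            have := Submodule.span_mono (R := k) (Set.image_mono (f := b) hsub) hε
            rw [Set.image_union, Submodule.span_union, Submodule.mem_sup] at this
            obtain ⟨u, hu, v, hv, huv⟩ := this
            refine ⟨ε⁻¹ • b y, Submodule.smul_mem _ _ (Submodule.subset_span ⟨y, hyS, rfl⟩),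
              -(ε⁻¹ • u), neg_mem (Submodule.smul_mem _ _ hu), -(ε⁻¹ • v),
              neg_mem (Submodule.smul_mem _ _ hv), ?_⟩
            have e : d (b y) = u + v + ε • b (π y) := by rw [huv]; abel
            rw [Units.smul_def, map_smul, ← Units.smul_def, e, smul_add, smul_add, inv_smul_smul]
            abel
          · exact ⟨0, zero_mem _, b x, Submodule.subset_span ⟨x, ⟨hxS, hxL', hxI⟩, rfl⟩, 0,
              zero_mem _, by simp⟩
      obtain ⟨y, hy, z₁, h₁, z₂, h₂, rfl⟩ := hdec
      have hddy : d (d y) = 0 := by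
        clear hz hdz
        induction hy using Submodule.span_induction with
        | zero => simp
        | add u v _ _ hu hv => rw [map_add, map_add, hu, hv, add_zero]
        | smul r u _ hu => rw [map_smul, map_smul, hu, smul_zero]
        | mem u hu =>
          obtain ⟨x, hx, rfl⟩ := hu
          exact hdd _ x hx
      have hd12 : d z₁ + d z₂ = 0 := by
        rw [map_add, map_add, hddy, zero_add] at hdz
        exact hdz
      have hz₁ : z₁ = 0 := by
        have hsupp := (b.mem_span_image).mp h₁
        refine b.repr.injective (Finsupp.ext fun x => ?_)
        rw [map_zero, Finsupp.zero_apply]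
        by_contra hx
        obtain ⟨hxS, hxL, hxI⟩ := hsupp (Finsupp.mem_support_iff.mpr hx)
        obtain ⟨hπ, hlπ⟩ := hπI j x hxS hxI
        have c₂ : ∀ v ∈ Submodule.span k (b '' {x | x ∈ S (j + 1) ∧ ℓ x < L}),
            b.repr (d v) (π x) = 0 := by
          intro v hv
          induction hv using Submodule.span_induction with
          | zero => simp
          | add u v _ _ hu hv => rw [map_add, map_add, Finsupp.add_apply, hu, hv, add_zero]
          | smul r u _ hu => rw [map_smul, map_smul, Finsupp.smul_apply, hu, smul_zero]
          | mem u hu =>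
            obtain ⟨x', hx', rfl⟩ := hu
            by_contra hne
            have := (b.mem_span_image).mp (hmono _ x' hx'.1) (Finsupp.mem_support_iff.mpr hne)
            have h1 : ℓ (π x) ≤ ℓ x' := this
            have h2 : ℓ x' < L := hx'.2
            omega
        obtain ⟨ε, hε⟩ := hd j x hxS hxI
        have hrem : ∀ x' ∈ S (j + 1), ℓ x' = L → ∀ v ∈ Submodule.span k
            (b '' {v | v ∈ S j ∧ (ℓ v < ℓ x' ∨ (ℓ v = ℓ x' ∧ v ∉ I))}),
            b.repr v (π x) = 0 := by
          intro x' hx' hl v hv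
          by_contra hne
          obtain ⟨_, h | h⟩ := (b.mem_span_image).mp hv (Finsupp.mem_support_iff.mpr hne)
          · omega
          · exact h.2 hπ
        have c₁ : ∀ v ∈ Submodule.span k (b '' {x | x ∈ S (j + 1) ∧ ℓ x = L ∧ x ∉ I}),
            b.repr (d v) (π x) = (ε : k) * b.repr v x := by
          intro v hv
          induction hv using Submodule.span_induction with
          | zero => simp
          | add u v _ _ hu hv =>
            rw [map_add, map_add, Finsupp.add_apply, hu, hv, map_add, Finsupp.add_apply, mul_add]
          | smul r u _ hu =>
            rw [map_smul, map_smul, Finsupp.smul_apply, hu, map_smul, Finsupp.smul_apply,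
              smul_eq_mul, smul_eq_mul, mul_left_comm]
          | mem u hu =>
            obtain ⟨x', ⟨hx', hl', hI'⟩, rfl⟩ := hu
            by_cases hxx : x' = x
            · subst hxx
              have := hrem x' hx' hl' _ hε
              rw [map_sub, Finsupp.sub_apply, Units.smul_def, map_smul, Finsupp.smul_apply,
                b.repr_self, Finsupp.single_eq_same, sub_eq_zero] at this
              rw [this, b.repr_self, Finsupp.single_eq_same, smul_eq_mul]
            · obtain ⟨ε', hε'⟩ := hd j x' hx' hI'
              have := hrem x' hx' hl' _ hε'
              have hne : π x ≠ π x' := fun e => hxx (hinj j x hxS x' hx' hxI hI' e).symm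
              rw [map_sub, Finsupp.sub_apply, Units.smul_def, map_smul, Finsupp.smul_apply,
                b.repr_self, Finsupp.single_eq_of_ne hne, smul_zero, sub_zero] at this
              rw [this, b.repr_self, Finsupp.single_eq_of_ne (Ne.symm hxx), mul_zero]
        have := congrArg (fun v => b.repr v (π x)) hd12
        simp only [map_add, map_zero, Finsupp.add_apply, Finsupp.zero_apply] at this
        rw [c₁ _ h₁, c₂ _ h₂, add_zero] at this
        exact hx ((Units.mul_right_eq_zero ε).mp this)
      subst hz₁
      obtain ⟨y', hy', h'⟩ := ih z₂ h₂ (by simpa using hd12)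
      exact ⟨y + y', add_mem hy hy', by rw [map_add, h', add_zero]⟩
  obtain ⟨L, hL⟩ : ∃ L, ∀ x ∈ (b.repr z).support, ℓ x < L :=
    ⟨(b.repr z).support.sup ℓ + 1, fun x hx => Nat.lt_succ_of_le (Finset.le_sup hx)⟩
  refine main L z ?_ hdz
  rw [b.mem_span_image] at hz ⊢
  exact fun x hx => ⟨hz hx, hL x hx⟩

namespace PosBraid

variable {n : ℕ}

/-- The standard generators indexed by all natural numbers, trivial beyond the range. -/
def natGen (n i : ℕ) : PosBraid n := if h : i < n then gen ⟨i, h⟩ else 1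

theorem natGen_of_lt {i : ℕ} (h : i < n) : natGen n i = gen ⟨i, h⟩ := dif_pos h

theorem isBraidSeq_natGen (n : ℕ) : IsBraidSeq n (natGen n) where
  far i j h := by
    unfold natGen
    split_ifs
    · exact gen_far (Or.inl h)
    all_goals simp
  adj i h := by
    rw [natGen_of_lt h, natGen_of_lt (show i < n by omega)]
    exact gen_adj (Or.inl rfl)

theorem len_natGen {i : ℕ} (h : i < n) : len (natGen n i) = 1 := by
  rw [natGen_of_lt h, len_gen]

open BraidComplex

theorem len_chain {s b : ℕ} (h : s + b ≤ n) : len (chain (natGen n) s b) = b := by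
  induction b with
  | zero => rfl
  | succ b ih => rw [chain, len_mul, ih (by omega), len_natGen (by omega), add_comm]

theorem len_swap {o a b : ℕ} (h : o + a + b ≤ n + 1) :
    len (swap (natGen n) o a b) = a * b := by
  induction a with
  | zero => rw [swap, len_one, zero_mul]
  | succ a ih => rw [swap, len_mul, ih (by omega), len_chain (by omega), add_mul, one_mul]

theorem halfTwist_eq_chain_mul {o c : ℕ} (h : o + c + 1 ≤ n) :
    halfTwist (natGen n) o (c + 1) =
      chain (natGen n) o (c + 1) * halfTwist (natGen n) (o + 1) c := by
  have := swap_mul_halfTwist (isBraidSeq_natGen n) (o := o) (a := 0) (b := c) (by omega)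
  rw [zero_add, zero_add, add_zero] at this
  rw [← this]
  simp [swap, halfTwist]

theorem exists_halfTwist_eq_mul (o c : ℕ) :
    ∃ y, halfTwist (natGen n) o (c + 1) = y * natGen n o := by
  induction c with
  | zero => exact ⟨1, by simp [halfTwist, swap, chain]⟩
  | succ c ih =>
    obtain ⟨y, hy⟩ := ih
    exact ⟨swap (natGen n) o (c + 1 + 1) 1 * y, by rw [halfTwist, hy, mul_assoc]⟩

/-- Divisibility by a generator passes through multiplication by distant generators. -/
theorem exists_eq_mul_of_far {s : Fin n} {u : PosBraid n}
    (hu : u ∈ Submonoid.closure {x | ∃ i, FarIndex i s ∧ x = gen i}) {x z : PosBraid n}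
    (h : x * u = z * gen s) : ∃ x', x = x' * gen s := by
  induction hu using Submonoid.closure_induction generalizing x z with
  | mem u hu =>
    obtain ⟨i, hi, rfl⟩ := hu
    obtain ⟨w, hw, _⟩ := (reduces_of_mul_gen_eq x z i s h).of_far hi
    exact ⟨w, hw⟩
  | one => exact ⟨z, by rw [← h, mul_one]⟩
  | mul u v _ _ hu hv =>
    rw [← mul_assoc] at h
    obtain ⟨x', hx'⟩ := hv h
    exact hu hx'

theorem natGen_mem_closure_far {s : Fin n} {i : ℕ} (h : s.1 + 2 ≤ i) :
    natGen n i ∈ Submonoid.closure {x | ∃ i, FarIndex i s ∧ x = gen i} := by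
  by_cases hi : i < n
  · rw [natGen_of_lt hi]
    exact Submonoid.subset_closure ⟨_, Or.inr h, rfl⟩
  · rw [natGen, dif_neg hi]
    exact one_mem _

theorem exists_eq_mul_chain {s b : ℕ} (hb : s + b < n) {y z : PosBraid n}
    (h : y * chain (natGen n) (s + 1) b = z * natGen n s) :
    ∃ y', y = y' * chain (natGen n) s (b + 1) := by
  induction b generalizing s y z with
  | zero => exact ⟨z, by simpa [chain] using h⟩
  | succ b ih =>
    have hs : s < n := by omega
    have hs' : s + 1 < n := by omega
    rw [add_comm b 1, chain_add, show chain (natGen n) (s + 1) 1 = natGen n (s + 1) by simp [chain],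
      ← mul_assoc, natGen_of_lt hs, natGen_of_lt hs'] at h
    obtain ⟨v, hv, _⟩ := (reduces_of_mul_gen_eq _ _ _ _ h).of_adj (Or.inr rfl)
    obtain ⟨y₁, rfl⟩ := exists_eq_mul_of_far
      (chain_mem fun i h1 h2 => natGen_mem_closure_far (by simp only; omega)) hv
    have hc : Commute (natGen n s) (chain (natGen n) (s + 1 + 1) b) :=
      commute_chain fun i _ _ => (isBraidSeq_natGen n).commute (by omega)
    rw [natGen_of_lt hs] at hc
    rw [mul_assoc, hc.eq, ← mul_assoc] at hv
    obtain ⟨y₂, rfl⟩ := ih (s := s + 1) (y := y₁) (z := v) (by omega)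
      (by rw [natGen_of_lt hs']; exact mul_gen_right_cancel hv)
    refine ⟨y₂, ?_⟩
    rw [add_comm (b + 1) 1, chain_add s 1 (b + 1), mul_assoc, natGen_of_lt hs |>.symm]
    simp [chain]

/-- The generators dividing a positive braid on the right. -/
def IsDescent (x : PosBraid n) (i : ℕ) : Prop := i < n ∧ ∃ y, x = y * natGen n i

/-- The smallest right descent of a positive braid. -/
noncomputable def minDescent (x : PosBraid n) : ℕ := sInf {i | IsDescent x i}

theorem isDescent_minDescent {x : PosBraid n} (hx : x ≠ 1) : IsDescent x (minDescent x) := by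
  refine Nat.sInf_mem (s := {i | IsDescent x i}) ?_
  obtain ⟨y, i, h⟩ := exists_eq_mul_gen hx
  exact ⟨i.1, i.2, y, by rw [natGen_of_lt i.2]; exact h⟩

theorem minDescent_le {x : PosBraid n} {i : ℕ} (h : IsDescent x i) : minDescent x ≤ i :=
  Nat.sInf_le h

theorem blockTwist_cons_zero (o : ℕ) (w : List ℕ) :
    blockTwist (natGen n) o (0 :: w) = blockTwist (natGen n) (o + 1) w := by
  simp [blockTwist, halfTwist]

theorem blockTwist_replicate (o s : ℕ) (w : List ℕ) :
    blockTwist (natGen n) o (List.replicate s 0 ++ w) = blockTwist (natGen n) (o + s) w := by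
  induction s generalizing o with
  | zero => rfl
  | succ s ih =>
    rw [List.replicate_succ, List.cons_append, blockTwist_cons_zero, ih,
      show o + 1 + s = o + (s + 1) by omega]

theorem blockTwist_eq_mul_natGen (o c : ℕ) (w : List ℕ) :
    ∃ y, blockTwist (natGen n) o ((c + 1) :: w) = y * natGen n o := by
  obtain ⟨y, hy⟩ := exists_halfTwist_eq_mul (n := n) o c
  have hc : Commute (natGen n o) (blockTwist (natGen n) (o + (c + 1) + 1) w) :=
    commute_blockTwist fun i _ _ => (isBraidSeq_natGen n).commute (by omega)
  exact ⟨y * blockTwist (natGen n) (o + (c + 1) + 1) w, by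
    rw [blockTwist, hy, mul_assoc, hc.eq, mul_assoc]⟩

theorem eq_replicate_append_or {o s : ℕ} {w : List ℕ} (hos : o ≤ s) (hs : s < n)
    (hw : o + w.sum + w.length = n + 1) :
    (∃ u, w = List.replicate (s - o) 0 ++ u) ∨
      ∃ p < s, ∃ y, blockTwist (natGen n) o w = y * natGen n p := by
  induction w generalizing o with
  | nil => simp at hw; omega
  | cons c w ih =>
    simp only [List.sum_cons, List.length_cons] at hw
    rcases hos.eq_or_lt with rfl | hlt
    · exact Or.inl ⟨c :: w, by simp⟩
    rcases c with _ | c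
    · rcases ih (o := o + 1) (by omega) (by omega) with ⟨u, rfl⟩ | ⟨p, hp, y, hy⟩
      · refine Or.inl ⟨u, ?_⟩
        rw [show s - o = s - (o + 1) + 1 by omega, List.replicate_succ, List.cons_append]
      · exact Or.inr ⟨p, hp, y, by rw [blockTwist_cons_zero, hy]⟩
    · exact Or.inr ⟨o, hlt, blockTwist_eq_mul_natGen o c w⟩

/-- The blocks before the smallest right descent are trivial. -/
theorem exists_eq_replicate_append {m : PosBraid n} {w : List ℕ} {s : ℕ} (hs : s < n)
    (hw : w.sum + w.length = n + 1) (hmin : minDescent (m * blockTwist (natGen n) 0 w) = s) :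
    ∃ u, w = List.replicate s 0 ++ u := by
  rcases eq_replicate_append_or (o := 0) (w := w) (Nat.zero_le s) hs (by omega) with h | ⟨p, hp, y, hy⟩
  · exact h
  · have := minDescent_le (x := m * blockTwist (natGen n) 0 w) (i := p)
      ⟨by omega, m * y, by rw [hy, mul_assoc]⟩
    omega

theorem blockTwist_ne_one {o : ℕ} {w : List ℕ} (ho : o + w.sum + w.length ≤ n + 1)
    (hw : w.sum ≠ 0) : len (blockTwist (natGen n) o w) ≠ 0 := by
  induction w generalizing o with
  | nil => simp at hw
  | cons c w ih =>
    simp only [List.sum_cons, List.length_cons] at ho hw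
    rcases c with _ | c
    · rw [blockTwist_cons_zero]
      exact ih (by omega) (by omega)
    · obtain ⟨y, hy⟩ := blockTwist_eq_mul_natGen (n := n) o c w
      rw [hy, len_mul, len_natGen (by omega)]
      omega

theorem exists_eq_mul_chain_of_isDescent {s b : ℕ} {u : List ℕ} {m : PosBraid n}
    (hb : s + b < n) (h : IsDescent (m * blockTwist (natGen n) s (0 :: b :: u)) s) :
    ∃ m', m = m' * chain (natGen n) s (b + 1) := by
  obtain ⟨hs, z, hz⟩ := h
  rw [blockTwist_cons_zero, blockTwist, ← mul_assoc, natGen_of_lt hs] at hz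
  obtain ⟨x, hx⟩ := exists_eq_mul_of_far
    (blockTwist_mem fun i h1 => natGen_mem_closure_far (by simp only; omega)) hz
  rcases b with _ | b
  · refine exists_eq_mul_chain hb (z := x) ?_
    rw [natGen_of_lt hs, ← hx]
    simp [chain, halfTwist]
  · rw [halfTwist_eq_chain_mul (by omega), ← mul_assoc] at hx
    obtain ⟨x', hx'⟩ := exists_eq_mul_of_far
      (halfTwist_mem fun i h1 _ => natGen_mem_closure_far (by simp only; omega)) hx
    exact exists_eq_mul_chain hb (z := x') (by rw [natGen_of_lt hs, ← hx'])

end PosBraid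

namespace BraidComplex

/-- The negatives of the elements of a sequence, in the monoid algebra. -/
noncomputable def algGen (k : Type*) [CommRing k] {H : Type*} [Monoid H] (σ : ℕ → H) (i : ℕ) :
    MonoidAlgebra k H :=
  MonoidAlgebra.single (σ i) (-1)

section

variable {k : Type*} [CommRing k] {H : Type*} [Monoid H] {σ : ℕ → H} {n : ℕ}

theorem isBraidSeq_algGen (hσ : IsBraidSeq n σ) : IsBraidSeq n (algGen k σ) where
  far i j h := by
    simp only [algGen, MonoidAlgebra.single_mul_single, hσ.far i j h]
  adj i h := by
    simp only [algGen, MonoidAlgebra.single_mul_single, hσ.adj i h]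

theorem chain_algGen (s b : ℕ) :
    chain (algGen k σ) s b = MonoidAlgebra.single (chain σ s b) ((-1) ^ b) := by
  induction b with
  | zero => simp [chain, MonoidAlgebra.one_def]
  | succ b ih =>
    rw [chain, ih, algGen, MonoidAlgebra.single_mul_single, chain, pow_succ']

end

section Positive

open PosBraid

variable (k : Type*) [CommRing k] (n : ℕ)

/-- The monoid elements of length less than `L` span this part of the monoid algebra. -/
noncomputable def shorter (L : ℕ) : Submodule k (MonoidAlgebra k (PosBraid n)) :=
  Submodule.span k (MonoidAlgebra.basis (PosBraid n) k '' {m | len m < L})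

variable {k n}

theorem single_mem_shorter {L : ℕ} {m : PosBraid n} (h : len m < L) (r : k) :
    MonoidAlgebra.single m r ∈ shorter k n L := by
  have : MonoidAlgebra.single m r = r • MonoidAlgebra.basis (PosBraid n) k m := by simp
  rw [this]
  exact Submodule.smul_mem _ _ (Submodule.subset_span ⟨m, h, rfl⟩)

theorem shorter_mono {L L' : ℕ} (h : L ≤ L') : shorter k n L ≤ shorter k n L' :=
  Submodule.span_mono (Set.image_mono fun _ hm => lt_of_lt_of_le hm h)

theorem mul_single_mem_shorter {L : ℕ} {x : MonoidAlgebra k (PosBraid n)}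
    (hx : x ∈ shorter k n L) (m : PosBraid n) (r : k) :
    x * MonoidAlgebra.single m r ∈ shorter k n (L + len m) := by
  induction hx using Submodule.span_induction with
  | zero => simp
  | add x y _ _ hx hy => rw [add_mul]; exact add_mem hx hy
  | smul a x _ hx => rw [smul_mul_assoc]; exact Submodule.smul_mem _ _ hx
  | mem x hx =>
    obtain ⟨y, hy, rfl⟩ := hx
    rw [MonoidAlgebra.basis_apply, MonoidAlgebra.single_mul_single]
    refine single_mem_shorter ?_ _
    rw [len_mul]
    exact Nat.add_lt_add_right hy _

/-- The leading term of the sum over all shuffles is the longest shuffle. -/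
theorem shuffle_sub_mem_shorter {o a b : ℕ} (h : o + a + b ≤ n + 1) :
    shuffle (algGen k (natGen n)) o a b -
      MonoidAlgebra.single (swap (natGen n) o a b) ((-1) ^ (a * b)) ∈ shorter k n (a * b) := by
  induction hN : a + b generalizing a b with
  | zero =>
    obtain rfl : a = 0 := by omega
    simp [shuffle_zero_left, swap, MonoidAlgebra.one_def]
  | succ N ih =>
    rcases a with _ | a
    · simp [shuffle_zero_left, swap, MonoidAlgebra.one_def]
    rcases b with _ | b
    · simp [shuffle_zero_right, swap_zero_right, MonoidAlgebra.one_def]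
    have h1 := ih (a := a + 1) (b := b) (by omega) (by omega)
    have h2 := mul_single_mem_shorter (ih (a := a) (b := b + 1) (by omega) (by omega))
      (chain (natGen n) (o + a) (b + 1)) ((-1) ^ (b + 1))
    rw [len_chain (by omega), sub_mul, MonoidAlgebra.single_mul_single, ← chain_algGen,
      ← swap.eq_2, ← pow_add, show a * (b + 1) + (b + 1) = (a + 1) * (b + 1) by ring] at h2
    have h3 : shuffle (algGen k (natGen n)) o (a + 1) b ∈ shorter k n ((a + 1) * (b + 1)) := by
      have := add_mem (shorter_mono (show (a + 1) * b ≤ (a + 1) * (b + 1) by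
        exact Nat.mul_le_mul_left _ (by omega)) h1)
        (single_mem_shorter (k := k) (m := swap (natGen n) o (a + 1) b)
          (L := (a + 1) * (b + 1)) ?_ ((-1) ^ ((a + 1) * b)))
      · simpa using this
      · rw [len_swap (by omega)]
        exact Nat.mul_lt_mul_of_pos_left (by omega) (by omega)
    rw [shuffle_succ_succ, add_sub_assoc]
    exact add_mem h3 h2

variable (k n) in
/-- The basis of the complex of lists of blocks over the algebra of positive braids. -/
noncomputable def cellBasis :
    Module.Basis (Σ _ : List ℕ, PosBraid n) k (List ℕ →₀ MonoidAlgebra k (PosBraid n)) :=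
  Finsupp.basis fun _ => MonoidAlgebra.basis (PosBraid n) k

theorem cellBasis_apply (x : Σ _ : List ℕ, PosBraid n) :
    cellBasis k n x = Finsupp.single x.1 (MonoidAlgebra.single x.2 1) := by
  rw [cellBasis, Finsupp.coe_basis]
  simp

/-- The weight of a cell: the braid of which it is a factor. -/
noncomputable def weight (o : ℕ) (x : Σ _ : List ℕ, PosBraid n) : PosBraid n :=
  x.2 * blockTwist (natGen n) o x.1

/-- The cells of the right degree occurring in lower filtration in the boundary of `w`. -/
def lowCells (n o : ℕ) (w : List ℕ) : Set (Σ _ : List ℕ, PosBraid n) :=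
  {x | x.1.sum + 1 = w.sum ∧ x.1.length = w.length + 1 ∧
    len (weight o x) < len (blockTwist (natGen n) o w)}

/-- The cells of the right degree that have the same weight as `w`. -/
def topCells (n o : ℕ) (w : List ℕ) : Set (Σ _ : List ℕ, PosBraid n) :=
  {x | x.1.sum + 1 = w.sum ∧ x.1.length = w.length + 1 ∧
    weight o x = blockTwist (natGen n) o w ∧
    ∀ y : PosBraid n, (∀ i, o ≤ i → Commute y (natGen n i)) → Commute y x.2}

theorem mem_span_of_map {V W B C : Type*} [AddCommGroup V] [Module k V] [AddCommGroup W]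
    [Module k W] {b : B → V} {c : C → W} {s : Set B} {t : Set C} (f : V →ₗ[k] W) (φ : B → C)
    (h : ∀ x ∈ s, φ x ∈ t) (hf : ∀ x ∈ s, f (b x) = c (φ x)) {v : V}
    (hv : v ∈ Submodule.span k (b '' s)) : f v ∈ Submodule.span k (c '' t) := by
  induction hv using Submodule.span_induction with
  | zero => simp
  | add x y _ _ hx hy => rw [map_add]; exact add_mem hx hy
  | smul a x _ hx => rw [map_smul]; exact Submodule.smul_mem _ _ hx
  | mem x hx =>
    obtain ⟨y, hy, rfl⟩ := hx
    rw [hf y hy]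
    exact Submodule.subset_span ⟨φ y, h y hy, rfl⟩

theorem swap_mem_topCells {o c : ℕ} {w : List ℕ} (h : o + c + 1 + w.sum + w.length ≤ n + 1)
    {p : ℕ × ℕ} (hp : p ∈ cuts c) :
    (⟨p.1 :: p.2 :: w, swap (natGen n) o (p.1 + 1) (p.2 + 1)⟩ : Σ _ : List ℕ, PosBraid n) ∈
      topCells n o (c :: w) := by
  rw [mem_cuts] at hp
  refine ⟨by simp; omega, by simp, ?_, fun y hy => commute_swap fun i hi _ => hy i hi⟩
  simp only [weight, blockTwist]
  rw [← mul_assoc, ← mul_assoc, swap_mul_halfTwist (isBraidSeq_natGen n) (by omega), hp,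
    show o + p.1 + 1 + p.2 + 1 = o + c + 1 by omega]

theorem single_shuffle_sub_mem {o c : ℕ} {w : List ℕ} (h : o + c + 1 + w.sum + w.length ≤ n + 1)
    {p : ℕ × ℕ} (hp : p ∈ cuts c) :
    (Finsupp.single (p.1 :: p.2 :: w) (shuffle (algGen k (natGen n)) o (p.1 + 1) (p.2 + 1)) -
      (-1 : k) ^ ((p.1 + 1) * (p.2 + 1)) •
        cellBasis k n ⟨p.1 :: p.2 :: w, swap (natGen n) o (p.1 + 1) (p.2 + 1)⟩) ∈
      Submodule.span k (cellBasis k n '' lowCells n o (c :: w)) := by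
  obtain ⟨hs, hl, hw, _⟩ := swap_mem_topCells h hp
  rw [mem_cuts] at hp
  have hsh := shuffle_sub_mem_shorter (k := k) (n := n) (o := o) (a := p.1 + 1) (b := p.2 + 1)
    (by omega)
  have := mem_span_of_map (c := cellBasis k n) (t := lowCells n o (c :: w))
    (Finsupp.lsingle (p.1 :: p.2 :: w)) (fun m => ⟨p.1 :: p.2 :: w, m⟩) ?_ ?_ hsh
  · rw [map_sub] at this
    rw [cellBasis_apply, Finsupp.smul_single, MonoidAlgebra.smul_single, smul_eq_mul, mul_one]
    exact this
  · intro m hm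
    refine ⟨hs, hl, ?_⟩
    rw [← hw]
    simp only [weight, len_mul]
    rw [len_swap (by omega)]
    exact Nat.add_lt_add_right hm _
  · intro m hm
    rw [cellBasis_apply]
    simp

theorem consMap_mem {o c : ℕ} {w : List ℕ}
    {v : List ℕ →₀ MonoidAlgebra k (PosBraid n)}
    (hv : v ∈ Submodule.span k
      (cellBasis k n '' (lowCells n (o + c + 1) w ∪ topCells n (o + c + 1) w))) :
    consMap _ c v ∈ Submodule.span k (cellBasis k n '' (lowCells n o (c :: w) ∪
      (topCells n o (c :: w) ∩ {x | x.1.head? = some c}))) := by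
  refine mem_span_of_map ((consMap (MonoidAlgebra k (PosBraid n)) c).restrictScalars k)
    (fun x => ⟨c :: x.1, x.2⟩) ?_ ?_ hv
  · rintro ⟨w', m⟩ (⟨h1, h2, h3⟩ | ⟨h1, h2, h3, h4⟩)
    · refine Or.inl ⟨by simp at h1 ⊢; omega, by simp at h2 ⊢; omega, ?_⟩
      simp only [weight, blockTwist, len_mul] at h3 ⊢
      omega
    · refine Or.inr ⟨⟨by simp at h1 ⊢; omega, by simp at h2 ⊢; omega, ?_, ?_⟩, by simp⟩
      · have hc : Commute (halfTwist (natGen n) o c) m := h4 _ fun i _ =>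
          (commute_halfTwist fun j _ _ => (isBraidSeq_natGen n).commute (by omega)).symm
        simp only [weight, blockTwist] at h3 ⊢
        rw [← mul_assoc, ← hc.eq, mul_assoc, h3]
      · exact fun y hy => h4 y fun i hi => hy i (by omega)
  · rintro ⟨w', m⟩ _
    rw [cellBasis_apply, cellBasis_apply]
    exact consMap_single c w' _

theorem bd_mem {o : ℕ} {w : List ℕ} (h : o + w.sum + w.length ≤ n + 1) :
    bd (algGen k (natGen n)) o w ∈
      Submodule.span k (cellBasis k n '' (lowCells n o w ∪ topCells n o w)) := by
  induction w generalizing o with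
  | nil => exact zero_mem _
  | cons c w ih =>
    simp only [List.sum_cons, List.length_cons] at h
    rw [bd, cutHead]
    refine sub_mem (Submodule.sum_mem _ fun p hp => ?_) ?_
    · have h1 := single_shuffle_sub_mem (k := k) (n := n) (o := o) (c := c) (w := w) (by omega) hp
      have h2 := swap_mem_topCells (n := n) (o := o) (c := c) (w := w) (by omega) hp
      have h1' := Submodule.span_mono (R := k) (Set.image_mono (f := cellBasis k n)
        (Set.subset_union_left (t := topCells n o (c :: w)))) h1
      have h3 := Submodule.subset_span (R := k) (Set.mem_image_of_mem (cellBasis k n)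
        (Set.mem_union_right (lowCells n o (c :: w)) h2))
      have h4 := add_mem h1' (Submodule.smul_mem _ ((-1) ^ ((p.1 + 1) * (p.2 + 1))) h3)
      rwa [sub_add_cancel] at h4
    · refine Submodule.span_mono (Set.image_mono ?_) (consMap_mem (ih (by omega)))
      exact Set.union_subset_union_right _ Set.inter_subset_left

/-- The boundary of a cell whose first block is nontrivial: the leading term splits off the first
strand, all the other terms of the same weight have a nontrivial first block. -/
theorem bd_cons_sub_mem {o c : ℕ} {w : List ℕ} (h : o + c + 2 + w.sum + w.length ≤ n + 1) :
    bd (algGen k (natGen n)) o ((c + 1) :: w) -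
      (-1 : k) ^ (c + 1) • cellBasis k n ⟨0 :: c :: w, chain (natGen n) o (c + 1)⟩ ∈
      Submodule.span k (cellBasis k n '' (lowCells n o ((c + 1) :: w) ∪
        (topCells n o ((c + 1) :: w) ∩ {x | x.1.head? ≠ some 0}))) := by
  have hmem : ((0, c) : ℕ × ℕ) ∈ cuts (c + 1) := by rw [mem_cuts]; omega
  rw [bd, cutHead, ← Finset.add_sum_erase _ _ hmem, sub_right_comm, add_sub_right_comm]
  refine sub_mem (add_mem ?_ (Submodule.sum_mem _ fun p hp => ?_)) ?_
  · have h1 := single_shuffle_sub_mem (k := k) (n := n) (o := o) (c := c + 1) (w := w)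
      (by omega) hmem
    have h1' := Submodule.span_mono (R := k) (Set.image_mono (f := cellBasis k n)
        (Set.subset_union_left
          (t := topCells n o ((c + 1) :: w) ∩ {x | x.1.head? ≠ some 0}))) h1
    simpa [swap] using h1'
  · rw [Finset.mem_erase] at hp
    have h1 := single_shuffle_sub_mem (k := k) (n := n) (o := o) (c := c + 1) (w := w)
      (by omega) hp.2
    have h2 := swap_mem_topCells (n := n) (o := o) (c := c + 1) (w := w) (by omega) hp.2
    have h3 : p.1 ≠ 0 := by
      intro h0
      have := mem_cuts.mp hp.2
      exact hp.1 (Prod.ext h0 (by simp only; omega))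
    have h1' := Submodule.span_mono (R := k) (Set.image_mono (f := cellBasis k n)
        (Set.subset_union_left
          (t := topCells n o ((c + 1) :: w) ∩ {x | x.1.head? ≠ some 0}))) h1
    have h4 := Submodule.subset_span (R := k) (Set.mem_image_of_mem (cellBasis k n)
      (Set.mem_union_right (lowCells n o ((c + 1) :: w))
        (Set.mem_inter h2 (b := {x | x.1.head? ≠ some 0}) (by simpa using h3))))
    have h5 := add_mem h1' (Submodule.smul_mem _ ((-1) ^ ((p.1 + 1) * (p.2 + 1))) h4)
    rwa [sub_add_cancel] at h5
  · refine Submodule.span_mono (Set.image_mono ?_)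
      (consMap_mem (bd_mem (by omega)))
    refine Set.union_subset_union_right _ (Set.inter_subset_inter_right _ ?_)
    intro x hx
    simp only [Set.mem_ofPred_eq] at hx ⊢
    simp [hx]

end Positive

end BraidComplex

namespace BraidComplex

open PosBraid

variable {k : Type*} [CommRing k] {n : ℕ}

/-- The cells of degree `j`. -/
def cells (n j : ℕ) : Set (Σ _ : List ℕ, PosBraid n) :=
  {x | x.1.sum = j ∧ x.1.length + j = n + 1}

/-- Adding `s` trivial blocks in front of a list of blocks. -/
noncomputable def padMap (A : Type*) [Ring A] (s : ℕ) : (List ℕ →₀ A) →ₗ[A] (List ℕ →₀ A) :=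
  Finsupp.lmapDomain A A (List.replicate s 0 ++ ·)

theorem padMap_single {A : Type*} [Ring A] (s : ℕ) (w : List ℕ) (r : A) :
    padMap A s (Finsupp.single w r) = Finsupp.single (List.replicate s 0 ++ w) r :=
  Finsupp.mapDomain_single

theorem padMap_succ {A : Type*} [Ring A] (s : ℕ) (v : List ℕ →₀ A) :
    padMap A (s + 1) v = consMap A 0 (padMap A s v) := by
  induction v using Finsupp.induction_linear with
  | zero => simp
  | add f g hf hg => rw [map_add, map_add, map_add, hf, hg]
  | single w r => simp [padMap_single, consMap_single, List.replicate_succ]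

theorem bd_replicate {A : Type*} [Ring A] (τ : ℕ → A) (o s : ℕ) (w : List ℕ) :
    bd τ o (List.replicate s 0 ++ w) = (-1 : A) ^ s • padMap A s (bd τ (o + s) w) := by
  induction s generalizing o with
  | zero =>
    have : padMap A 0 = LinearMap.id := by
      refine Finsupp.lhom_ext fun w r => ?_
      simp [padMap_single]
    simp [this]
  | succ s ih =>
    rw [List.replicate_succ, List.cons_append, bd, ih, cutHead, cuts, Finset.sum_empty, zero_sub,
      padMap_succ, show o + 0 + 1 + s = o + (s + 1) by omega, map_smul, pow_succ', neg_one_mul,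
      neg_smul]

theorem boundary_cellBasis (x : Σ _ : List ℕ, PosBraid n) :
    boundary (algGen k (natGen n)) 0 (cellBasis k n x) =
      (MonoidAlgebra.single x.2 1 : MonoidAlgebra k (PosBraid n)) •
        bd (algGen k (natGen n)) 0 x.1 := by
  rw [cellBasis_apply, boundary_single]

theorem boundary_cellBasis_mem {j : ℕ} {x : Σ _ : List ℕ, PosBraid n} (hx : x ∈ cells n j) :
    boundary (algGen k (natGen n)) 0 (cellBasis k n x) ∈
      Submodule.span k (cellBasis k n '' {y | len (weight 0 y) ≤ len (weight 0 x)}) := by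
  rw [boundary_cellBasis]
  refine mem_span_of_map (Algebra.lsmul k k (List ℕ →₀ MonoidAlgebra k (PosBraid n))
    (MonoidAlgebra.single x.2 1)) (fun y => ⟨y.1, x.2 * y.2⟩) ?_ ?_
    (bd_mem (w := x.1) (o := 0) (by obtain ⟨h1, h2⟩ := hx; omega))
  · rintro ⟨w, m⟩ (⟨-, -, h⟩ | ⟨-, -, h, -⟩)
    · simp only [weight, len_mul, Set.mem_ofPred_eq] at h ⊢
      omega
    · have := congrArg len h
      simp only [weight, len_mul, Set.mem_ofPred_eq] at this ⊢
      omega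
  · rintro ⟨w, m⟩ _
    rw [cellBasis_apply, cellBasis_apply]
    simp [MonoidAlgebra.single_mul_single]

theorem weight_split {s c : ℕ} {u : List ℕ} (h : s + c + 2 + u.sum + u.length = n + 1)
    (m : PosBraid n) :
    weight 0 ⟨List.replicate s 0 ++ 0 :: c :: u, m * chain (natGen n) s (c + 1)⟩ =
      weight 0 ⟨List.replicate s 0 ++ (c + 1) :: u, m⟩ := by
  simp only [weight]
  rw [blockTwist_replicate, blockTwist_replicate, blockTwist_cons_zero, zero_add, blockTwist,
    blockTwist, halfTwist_eq_chain_mul (by omega), show s + 1 + c + 1 = s + (c + 1) + 1 by omega]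
  simp only [mul_assoc]

theorem boundary_cellBasis_sub_mem {s c : ℕ} {u : List ℕ}
    (h : s + c + 2 + u.sum + u.length = n + 1) (m : PosBraid n) :
    ∃ ε : kˣ, boundary (algGen k (natGen n)) 0
        (cellBasis k n ⟨List.replicate s 0 ++ (c + 1) :: u, m⟩) -
      ε • cellBasis k n ⟨List.replicate s 0 ++ 0 :: c :: u, m * chain (natGen n) s (c + 1)⟩ ∈
      Submodule.span k (cellBasis k n '' {v | v.1.sum = c + u.sum ∧
        v.1.length = s + u.length + 2 ∧
        (len (weight 0 v) < len (weight 0 ⟨List.replicate s 0 ++ (c + 1) :: u, m⟩) ∨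
          (weight 0 v = weight 0 ⟨List.replicate s 0 ++ (c + 1) :: u, m⟩ ∧
            ∃ a u', v.1 = List.replicate s 0 ++ (a + 1) :: u'))}) := by
  refine ⟨(-1) ^ s * (-1) ^ (c + 1), ?_⟩
  have hw : weight 0 (⟨List.replicate s 0 ++ (c + 1) :: u, m⟩ : Σ _ : List ℕ, PosBraid n) =
      m * blockTwist (natGen n) s ((c + 1) :: u) := by
    simp only [weight]
    rw [blockTwist_replicate, zero_add]
  have key := mem_span_of_map (k := k) (c := cellBasis k n) (t := {v | v.1.sum = c + u.sum ∧
        v.1.length = s + u.length + 2 ∧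
        (len (weight 0 v) < len (weight 0 ⟨List.replicate s 0 ++ (c + 1) :: u, m⟩) ∨
          (weight 0 v = weight 0 ⟨List.replicate s 0 ++ (c + 1) :: u, m⟩ ∧
            ∃ a u', v.1 = List.replicate s 0 ++ (a + 1) :: u'))})
    (Algebra.lsmul k k (List ℕ →₀ MonoidAlgebra k (PosBraid n))
        (MonoidAlgebra.single m (1 : k)) ∘ₗ
      (padMap (MonoidAlgebra k (PosBraid n)) s).restrictScalars k)
    (fun y => ⟨List.replicate s 0 ++ y.1, m * y.2⟩) ?_ ?_
    (bd_cons_sub_mem (k := k) (n := n) (o := s) (c := c) (w := u) (by omega))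
  · have := Submodule.smul_mem _ ((-1 : k) ^ s) key
    convert this using 1
    rw [boundary_cellBasis, bd_replicate, zero_add, map_sub, smul_sub, map_smul]
    congr 1
    · simp only [LinearMap.comp_apply, LinearMap.restrictScalars_apply, Algebra.lsmul_coe]
      have : ((-1 : MonoidAlgebra k (PosBraid n)) ^ s) = algebraMap k _ ((-1) ^ s) := by
        rw [map_pow, map_neg, map_one]
      rw [this, algebraMap_smul, smul_comm]
    · simp only [LinearMap.comp_apply, LinearMap.restrictScalars_apply, Algebra.lsmul_coe]
      rw [cellBasis_apply, cellBasis_apply, padMap_single, Units.smul_def, smul_smul]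
      simp [MonoidAlgebra.single_mul_single]
  · rintro ⟨w, m'⟩ hwm
    have hdeg : w.sum + 1 = ((c + 1) :: u).sum ∧ w.length = ((c + 1) :: u).length + 1 := by
      rcases hwm with ⟨h1, h2, _⟩ | ⟨⟨h1, h2, _⟩, _⟩
      · exact ⟨h1, h2⟩
      · exact ⟨h1, h2⟩
    simp only [List.sum_cons, List.length_cons] at hdeg
    refine ⟨by simp; omega, by simp; omega, ?_⟩
    rw [hw]
    have hw' : weight 0 (⟨List.replicate s 0 ++ w, m * m'⟩ : Σ _ : List ℕ, PosBraid n) =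
        m * (m' * blockTwist (natGen n) s w) := by
      simp only [weight]
      rw [blockTwist_replicate, zero_add, mul_assoc]
    rw [hw']
    rcases hwm with ⟨-, -, h3⟩ | ⟨⟨-, -, h3, -⟩, h4⟩
    · left
      simp only [weight, len_mul] at h3 ⊢
      omega
    · right
      simp only [weight] at h3
      refine ⟨by rw [h3], ?_⟩
      rcases w with _ | ⟨_ | a, u'⟩
      · simp at hdeg
      · simp at h4
      · exact ⟨a, u', rfl⟩
  · rintro ⟨w, m'⟩ _
    simp only [LinearMap.comp_apply, LinearMap.restrictScalars_apply, Algebra.lsmul_coe]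
    rw [cellBasis_apply, cellBasis_apply, padMap_single]
    simp [MonoidAlgebra.single_mul_single]

/-- The cells in which the strand at the smallest descent of the weight forms a block. -/
def splitCells (n : ℕ) : Set (Σ _ : List ℕ, PosBraid n) :=
  {x | ∃ u, x.1 = List.replicate (minDescent (weight 0 x)) 0 ++ 0 :: u}

/-- The matching of cells: split off the strand at the smallest descent of the weight. -/
noncomputable def splitCell (x : Σ _ : List ℕ, PosBraid n) : Σ _ : List ℕ, PosBraid n :=
  let s := minDescent (weight 0 x)
  ⟨List.replicate s 0 ++ 0 :: ((x.1.drop s).headI - 1) :: (x.1.drop s).tail,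
    x.2 * chain (natGen n) s (x.1.drop s).headI⟩

theorem splitCell_eq {s c : ℕ} {u : List ℕ} {m : PosBraid n}
    (hs : minDescent (weight 0 ⟨List.replicate s 0 ++ (c + 1) :: u, m⟩) = s) :
    splitCell ⟨List.replicate s 0 ++ (c + 1) :: u, m⟩ =
      ⟨List.replicate s 0 ++ 0 :: c :: u, m * chain (natGen n) s (c + 1)⟩ := by
  simp [splitCell, hs]

theorem isDescent_of_mem_cells {j : ℕ} {x : Σ _ : List ℕ, PosBraid n} (hx : x ∈ cells n (j + 1)) :
    IsDescent (weight 0 x) (minDescent (weight 0 x)) := by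
  obtain ⟨h1, h2⟩ := hx
  refine isDescent_minDescent fun h => ?_
  have := congrArg len h
  simp only [weight, len_mul, len_one] at this
  exact blockTwist_ne_one (n := n) (o := 0) (w := x.1) (by omega) (by omega) (by omega)

theorem exists_eq_of_notMem_splitCells {j : ℕ} {x : Σ _ : List ℕ, PosBraid n}
    (hx : x ∈ cells n (j + 1)) (hI : x ∉ splitCells n) :
    ∃ s c u m, x = ⟨List.replicate s 0 ++ (c + 1) :: u, m⟩ ∧ minDescent (weight 0 x) = s ∧
      s + c + 2 + u.sum + u.length = n + 1 ∧ c + u.sum = j ∧ s + u.length + 2 + j = n + 1 := by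
  have hd := isDescent_of_mem_cells hx
  obtain ⟨w, m⟩ := x
  obtain ⟨h1, h2⟩ := hx
  obtain ⟨v, hv⟩ := exists_eq_replicate_append (m := m) (w := w) hd.1 (by simp at h1 h2; omega) rfl
  have hs : minDescent (weight 0 ⟨w, m⟩) < n := hd.1
  generalize hse : minDescent (weight 0 ⟨w, m⟩) = s at hv hs
  rcases v with _ | ⟨_ | c, u⟩
  · subst hv
    simp at h1 h2
  · exact absurd ⟨u, by rw [hse]; exact hv⟩ hI
  · subst hv
    refine ⟨s, c, u, m, rfl, rfl, ?_⟩
    simp at h1 h2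
    omega

theorem exists_eq_of_mem_splitCells {j : ℕ} {x : Σ _ : List ℕ, PosBraid n}
    (hx : x ∈ cells n (j + 1)) (hI : x ∈ splitCells n) :
    ∃ s c u m, x = ⟨List.replicate s 0 ++ 0 :: c :: u, m * chain (natGen n) s (c + 1)⟩ ∧
      minDescent (weight 0 x) = s ∧ s + c + 2 + u.sum + u.length = n + 1 ∧
      c + u.sum = j + 1 ∧ s + u.length + 1 + (j + 2) = n + 1 := by
  have hd := isDescent_of_mem_cells hx
  obtain ⟨w, m⟩ := x
  obtain ⟨h1, h2⟩ := hx
  obtain ⟨v, hv⟩ := hI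
  have hs : minDescent (weight 0 ⟨w, m⟩) < n := hd.1
  generalize hse : minDescent (weight 0 ⟨w, m⟩) = s at hv hs hd
  simp only at hv h1 h2
  subst hv
  rcases v with _ | ⟨c, u⟩
  · simp at h1 h2
  · simp at h1 h2
    have : weight 0 (⟨List.replicate s 0 ++ 0 :: c :: u, m⟩ : Σ _ : List ℕ, PosBraid n) =
        m * blockTwist (natGen n) s (0 :: c :: u) := by
      simp only [weight]
      rw [blockTwist_replicate, zero_add]
    rw [this] at hd
    obtain ⟨m', rfl⟩ := exists_eq_mul_chain_of_isDescent (by omega) hd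
    exact ⟨s, c, u, m', rfl, rfl, by omega, by omega, by omega⟩

/-- The complex of lists of blocks over the algebra of positive braids is exact in positive
degrees. -/
theorem exists_boundary_eq {j : ℕ} {z : List ℕ →₀ MonoidAlgebra k (PosBraid n)}
    (hz : z ∈ Submodule.span k (cellBasis k n '' cells n (j + 1)))
    (hdz : boundary (algGen k (natGen n)) 0 z = 0) :
    ∃ y ∈ Submodule.span k (cellBasis k n '' cells n (j + 2)),
      boundary (algGen k (natGen n)) 0 y = z := by
  refine exists_map_eq_of_matching (cellBasis k n)
    ((boundary (algGen k (natGen n)) 0).restrictScalars k) (fun x => len (weight 0 x)) (cells n)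
    (splitCells n) splitCell ?_ (fun j x hx => boundary_cellBasis_mem hx) ?_ ?_ ?_ ?_ j z hz hdz
  · intro j x hx
    obtain ⟨h1, h2⟩ := hx
    rw [LinearMap.restrictScalars_apply, LinearMap.restrictScalars_apply, boundary_cellBasis,
      map_smul, boundary_bd (isBraidSeq_algGen (isBraidSeq_natGen n)) (by omega), smul_zero]
  · intro j x hx hI
    obtain ⟨s, c, u, m, rfl, hs, hsz, -⟩ := exists_eq_of_notMem_splitCells hx hI
    have hwt := weight_split hsz m
    rw [splitCell_eq hs]
    refine ⟨⟨c :: u, ?_⟩, ?_⟩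
    · rw [hwt, hs]
    · rw [hwt]
  · intro j x hx hI
    obtain ⟨s, c, u, m, rfl, hs, hsz, hsum, hlen⟩ := exists_eq_of_notMem_splitCells hx hI
    obtain ⟨ε, hε⟩ := boundary_cellBasis_sub_mem (k := k) hsz m
    rw [splitCell_eq hs]
    refine ⟨ε, Submodule.span_mono (Set.image_mono ?_) hε⟩
    rintro v ⟨h1, h2, h3⟩
    refine ⟨⟨by omega, by omega⟩, ?_⟩
    rcases h3 with h3 | ⟨h3, a, u', hv⟩
    · exact Or.inl h3
    · refine Or.inr ⟨by rw [h3], ?_⟩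
      rintro ⟨u'', hu''⟩
      rw [h3, hs, hv] at hu''
      simp at hu''
  · intro j x hx y hy hxI hyI hxy
    obtain ⟨s, c, u, m, rfl, hs, hsz, -⟩ := exists_eq_of_notMem_splitCells hx hxI
    obtain ⟨s', c', u', m', rfl, hs', hsz', -⟩ := exists_eq_of_notMem_splitCells hy hyI
    rw [splitCell_eq hs, splitCell_eq hs'] at hxy
    have hss : s = s' := by
      rw [← hs, ← hs', ← weight_split hsz m, ← weight_split hsz' m', hxy]
    subst hss
    rw [Sigma.mk.injEq, heq_eq_eq, List.append_cancel_left_eq, List.cons.injEq,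
      List.cons.injEq] at hxy
    obtain ⟨⟨-, rfl, rfl⟩, hm⟩ := hxy
    rw [mul_right_cancel hm]
  · intro j x hx hI
    obtain ⟨s, c, u, m, rfl, hs, hsz, hsum, hlen⟩ := exists_eq_of_mem_splitCells hx hI
    rw [weight_split hsz] at hs
    refine ⟨⟨List.replicate s 0 ++ (c + 1) :: u, m⟩, ⟨by simp; omega, by simp; omega⟩, ?_,
      splitCell_eq hs⟩
    rintro ⟨u', hu'⟩
    rw [hs] at hu'
    simp at hu'

end BraidComplex

/-- A right cancellative monoid embeds into a monoid in which a given central element is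
invertible. -/
theorem exists_injective_isUnit_of_central {M : Type} [Monoid M] [IsRightCancelMul M] (z : M)
    (hz : ∀ m, Commute z m) :
    ∃ (L : Type) (_ : Monoid L) (f : M →* L), Function.Injective f ∧ IsUnit (f z) := by
  have hS : ∀ (s : Submonoid.powers z) (m : M), Commute (s : M) m := by
    rintro ⟨_, k, rfl⟩ m
    exact (hz m).pow_left k
  let i : OreLocalization.OreSet (Submonoid.powers z) :=
    { ore_right_cancel := fun r₁ r₂ s h => ⟨s, by rw [(hS s r₁).eq, (hS s r₂).eq, h]⟩
      oreNum := fun r _ => r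
      oreDenom := fun _ s => s
      ore_eq := fun r s => (hS s r).eq }
  refine ⟨OreLocalization (Submonoid.powers z) M, inferInstance, OreLocalization.numeratorHom,
    fun a b h => ?_, OreLocalization.numerator_isUnit ⟨z, Submonoid.mem_powers z⟩⟩
  rw [OreLocalization.numeratorHom_apply, OreLocalization.numeratorHom_apply,
    OreLocalization.oreDiv_eq_iff] at h
  obtain ⟨u, v, h1, h2⟩ := h
  simp only [Submonoid.coe_one, mul_one] at h2
  rw [Submonoid.smul_def, smul_eq_mul, smul_eq_mul, ← h2, (hS u a).eq, (hS u b).eq] at h1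
  exact (mul_right_cancel h1).symm

namespace PosBraid

open BraidComplex

variable {n : ℕ}

/-- The Coxeter element of the braid monoid. -/
def coxeterElement (n : ℕ) : PosBraid n := chain (natGen n) 0 n

theorem coxeterElement_mul_natGen {j : ℕ} (h : j + 1 < n) :
    coxeterElement n * natGen n (j + 1) = natGen n j * coxeterElement n :=
  chain_mul_gen (isBraidSeq_natGen n) (by omega) (by omega) (by omega)

theorem coxeterElement_pow_mul_natGen {j : ℕ} (i : ℕ) (h : j + i < n) :
    coxeterElement n ^ i * natGen n (j + i) = natGen n j * coxeterElement n ^ i := by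
  induction i with
  | zero => simp
  | succ i ih =>
    rw [pow_succ, mul_assoc, ← add_assoc, coxeterElement_mul_natGen (by omega), ← mul_assoc,
      ih (by omega), mul_assoc]

theorem coxeterElement_eq_natGen_mul :
    coxeterElement (n + 1) = natGen (n + 1) n * chain (natGen (n + 1)) 0 n := by
  rw [coxeterElement, chain, zero_add]

theorem coxeterElement_sq_mul_natGen :
    coxeterElement (n + 1) ^ 2 * natGen (n + 1) 0 = natGen (n + 1) n * coxeterElement (n + 1) ^ 2 := by
  have h1 : coxeterElement (n + 1) = chain (natGen (n + 1)) 1 n * natGen (n + 1) 0 := by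
    rw [coxeterElement, add_comm n 1, chain_add]
    simp [chain]
  have h2 : coxeterElement (n + 1) * chain (natGen (n + 1)) 1 n =
      chain (natGen (n + 1)) 0 n * coxeterElement (n + 1) :=
    chain_mul_chain (isBraidSeq_natGen _) (by omega) (by omega) (by omega)
  have h3 : coxeterElement (n + 1) * coxeterElement (n + 1) =
      chain (natGen (n + 1)) 0 n * (coxeterElement (n + 1) * natGen (n + 1) 0) := by
    conv_lhs => rw [h1]
    rw [← h1, ← mul_assoc, ← h2, mul_assoc, ← h1]
  rw [sq]
  conv_rhs => rw [h3]
  rw [← mul_assoc, ← coxeterElement_eq_natGen_mul, mul_assoc]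

/-- The full twist. -/
def fullTwist (n : ℕ) : PosBraid n := coxeterElement n ^ (n + 1)

theorem fullTwist_commute_natGen {j : ℕ} (h : j < n) :
    Commute (fullTwist n) (natGen n j) := by
  obtain ⟨m, rfl⟩ : ∃ m, n = m + 1 := ⟨n - 1, by omega⟩
  have h1 := coxeterElement_pow_mul_natGen (n := m + 1) (j := 0) j (by omega)
  have h2 := coxeterElement_pow_mul_natGen (n := m + 1) (j := j) (m - j) (by omega)
  rw [zero_add] at h1
  rw [show j + (m - j) = m by omega] at h2
  rw [Commute, SemiconjBy, fullTwist]
  calc coxeterElement (m + 1) ^ (m + 1 + 1) * natGen (m + 1) j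
      = coxeterElement (m + 1) ^ (m - j) * (coxeterElement (m + 1) ^ 2 *
          (coxeterElement (m + 1) ^ j * natGen (m + 1) j)) := by
        rw [← mul_assoc, ← mul_assoc, ← pow_add, ← pow_add]
        congr 2
        omega
    _ = natGen (m + 1) j * (coxeterElement (m + 1) ^ (m - j) * (coxeterElement (m + 1) ^ 2 *
          coxeterElement (m + 1) ^ j)) := by
        rw [h1, ← mul_assoc (_ ^ 2), coxeterElement_sq_mul_natGen, mul_assoc, ← mul_assoc, h2,
          mul_assoc]
    _ = _ := by
        rw [← pow_add, ← pow_add]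
        congr 2
        omega

/-- Induction on positive braids by multiplying by generators on the left. -/
theorem gen_induction {p : PosBraid n → Prop} (one : p 1) (mul : ∀ i x, p x → p (gen i * x))
    (x : PosBraid n) : p x := by
  obtain ⟨w, rfl⟩ := ofWord_surjective x
  induction w with
  | nil => exact one
  | cons i w ih => exact mul i _ ih

theorem fullTwist_commute (x : PosBraid n) : Commute (fullTwist n) x := by
  induction x using gen_induction with
  | one => exact Commute.one_right _
  | mul i x ih =>
    have := fullTwist_commute_natGen i.2
    rw [natGen_of_lt i.2] at this
    exact this.mul_right ih

theorem exists_gen_mul_eq_fullTwist (i : Fin n) : ∃ x, gen i * x = fullTwist n := by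
  obtain ⟨i, hi⟩ := i
  obtain ⟨m, rfl⟩ : ∃ m, n = m + 1 := ⟨n - 1, by omega⟩
  have h2 := coxeterElement_pow_mul_natGen (n := m + 1) (j := i) (m - i) (by omega)
  rw [show i + (m - i) = m by omega] at h2
  refine ⟨coxeterElement (m + 1) ^ (m - i) * (chain (natGen (m + 1)) 0 m *
    coxeterElement (m + 1) ^ (i + 1)), ?_⟩
  rw [← natGen_of_lt hi, ← mul_assoc, ← h2, mul_assoc, ← mul_assoc (natGen _ m),
    ← coxeterElement_eq_natGen_mul, ← pow_succ', ← pow_add, fullTwist]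
  congr 1
  omega

end PosBraid

theorem braidWord_two {B : Type*} (s t : B) :
    braidWord s t 2 = FreeGroup.of s * FreeGroup.of t := by
  simp [braidWord, List.range_succ]

theorem braidWord_three {B : Type*} (s t : B) :
    braidWord s t 3 = FreeGroup.of s * FreeGroup.of t * FreeGroup.of s := by
  simp [braidWord, List.range_succ, mul_assoc]

/-- The universal property of an Artin group. -/
def ArtinGroup.lift {B : Type*} (M : CoxeterMatrix B) {H : Type*} [Group H] (f : B → H)
    (hf : ∀ r ∈ artinRels M, FreeGroup.lift f r = 1) : ArtinGroup M →* H :=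
  PresentedGroup.toGroup hf

theorem ArtinGroup.lift_artinGen {B : Type*} (M : CoxeterMatrix B) {H : Type*} [Group H]
    (f : B → H) (hf : ∀ r ∈ artinRels M, FreeGroup.lift f r = 1) (s : B) :
    ArtinGroup.lift M f hf (artinGen M s) = f s :=
  PresentedGroup.toGroup.of hf

theorem ArtinGroup.braidWord_eq {B : Type*} (M : CoxeterMatrix B) {s t : B} (h : s ≠ t)
    (h0 : M s t ≠ 0) :
    FreeGroup.lift (artinGen M) (braidWord s t (M s t)) =
      FreeGroup.lift (artinGen M) (braidWord t s (M s t)) := by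
  have key : ∀ x : FreeGroup B, FreeGroup.lift (artinGen M) x = PresentedGroup.mk (artinRels M) x := by
    intro x
    have : FreeGroup.lift (artinGen M) = PresentedGroup.mk (artinRels M) := by
      ext b
      simp [artinGen, PresentedGroup.of]
      rfl
    rw [this]
    rfl
  rw [key, key]
  have : PresentedGroup.mk (artinRels M) (braidWord s t (M s t) * (braidWord t s (M s t))⁻¹) = 1 :=
    PresentedGroup.one_of_mem ⟨s, t, h, h0, rfl⟩
  rwa [map_mul, map_inv, mul_inv_eq_one] at this

theorem ArtinGroup.closure_range_artinGen {B : Type*} (M : CoxeterMatrix B) :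
    Subgroup.closure (Set.range (artinGen M)) = ⊤ :=
  PresentedGroup.closure_range_of _

theorem braidGen_far {n : ℕ} {i j : Fin n} (h : FarIndex i j) :
    braidGen (n + 1) i * braidGen (n + 1) j = braidGen (n + 1) j * braidGen (n + 1) i := by
  have hne : i ≠ j := by rintro rfl; rcases h with h | h <;> omega
  have hM : CoxeterMatrix.A n i j = 2 := by
    change (if i = j then 1 else (if (j : ℕ) + 1 = i ∨ (i : ℕ) + 1 = j then 3 else 2)) = 2
    rw [if_neg hne, if_neg (by rcases h with h | h <;> omega)]
  have := ArtinGroup.braidWord_eq (CoxeterMatrix.A n) hne (by rw [hM]; norm_num)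
  rw [hM, braidWord_two, braidWord_two, map_mul, map_mul, FreeGroup.lift_apply_of,
    FreeGroup.lift_apply_of] at this
  exact this

theorem braidGen_adj {n : ℕ} {i j : Fin n} (h : AdjIndex i j) :
    braidGen (n + 1) i * braidGen (n + 1) j * braidGen (n + 1) i =
      braidGen (n + 1) j * braidGen (n + 1) i * braidGen (n + 1) j := by
  have hne : i ≠ j := by rintro rfl; rcases h with h | h <;> omega
  have hM : CoxeterMatrix.A n i j = 3 := by
    change (if i = j then 1 else (if (j : ℕ) + 1 = i ∨ (i : ℕ) + 1 = j then 3 else 2)) = 3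
    rw [if_neg hne, if_pos (by rcases h with h | h <;> omega)]
  have := ArtinGroup.braidWord_eq (CoxeterMatrix.A n) hne (by rw [hM]; norm_num)
  rw [hM, braidWord_three, braidWord_three] at this
  simp only [map_mul, FreeGroup.lift_apply_of] at this
  exact this

namespace BraidGroup

open PosBraid

variable {n : ℕ}

/-- A group homomorphism out of the braid group. -/
theorem exists_hom {H : Type*} [Group H] (f : Fin n → H)
    (hfar : ∀ i j, FarIndex i j → f i * f j = f j * f i)
    (hadj : ∀ i j, AdjIndex i j → f i * f j * f i = f j * f i * f j) :
    ∃ φ : BraidGroup (n + 1) →* H, ∀ i : Fin n, φ (braidGen (n + 1) i) = f i := by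
  refine ⟨ArtinGroup.lift (CoxeterMatrix.A n) f ?_, ArtinGroup.lift_artinGen _ _ _⟩
  rintro r ⟨s, t, hst, -, rfl⟩
  have hM : CoxeterMatrix.A n s t =
      if s = t then 1 else (if (t : ℕ) + 1 = s ∨ (s : ℕ) + 1 = t then 3 else 2) := rfl
  rw [if_neg hst] at hM
  rw [map_mul, map_inv, mul_inv_eq_one, hM]
  have hst' : s.1 ≠ t.1 := fun h => hst (Fin.ext h)
  split_ifs with h
  · simp only [braidWord_three, map_mul, FreeGroup.lift_apply_of]
    exact hadj s t h.symm
  · simp only [braidWord_two, map_mul, FreeGroup.lift_apply_of]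
    exact hfar s t (by unfold FarIndex; omega)

theorem closure_range_braidGen :
    Subgroup.closure (Set.range fun i : Fin n => braidGen (n + 1) i) = ⊤ :=
  ArtinGroup.closure_range_artinGen (CoxeterMatrix.A n)

variable (n) in
/-- The map from positive braids to braids. -/
def ofPos : PosBraid n →* BraidGroup (n + 1) :=
  PosBraid.lift (fun i : Fin n => braidGen (n + 1) i) (fun _ _ h => braidGen_far h)
    (fun _ _ h => braidGen_adj h)

theorem ofPos_gen (i : Fin n) : ofPos n (gen i) = braidGen (n + 1) i :=
  PosBraid.lift_gen ..

theorem ofPos_injective : Function.Injective (ofPos n) := by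
  obtain ⟨L, _, f, hf, hu⟩ := exists_injective_isUnit_of_central (fullTwist n) fullTwist_commute
  have hgen : ∀ i : Fin n, IsUnit (f (gen i)) := by
    intro i
    obtain ⟨x, hx⟩ := exists_gen_mul_eq_fullTwist i
    have hx' : x * gen i = fullTwist n := by
      refine mul_right_cancel (b := x) ?_
      rw [mul_assoc, hx, (fullTwist_commute x).eq]
    obtain ⟨u, hu⟩ := hu
    have h1 : f (gen i) * (f x * ↑u⁻¹) = 1 := by
      rw [← mul_assoc, ← map_mul, hx, ← hu, Units.mul_inv]
    have h2 : (↑u⁻¹ * f x) * f (gen i) = 1 := by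
      rw [mul_assoc, ← map_mul, hx', ← hu, Units.inv_mul]
    exact isUnit_iff_exists_and_exists.mpr ⟨⟨_, h1⟩, ⟨_, h2⟩⟩
  choose g hg using hgen
  obtain ⟨φ, hφ⟩ := exists_hom (n := n) g
    (fun i j h => Units.ext (by
      simp only [Units.val_mul, hg, ← map_mul, gen_far h]))
    (fun i j h => Units.ext (by
      simp only [Units.val_mul, hg, ← map_mul, gen_adj h]))
  have key : ∀ x, ((φ (ofPos n x) : Lˣ) : L) = f x := by
    intro x
    induction x using gen_induction with
    | one => simp
    | mul i x ih => rw [map_mul, map_mul, Units.val_mul, ih, ofPos_gen, hφ, hg, map_mul]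
  intro x y h
  exact hf (by rw [← key, ← key, h])

theorem exists_ofPos_eq (g : BraidGroup (n + 1)) :
    ∃ k x, ofPos n (fullTwist n) ^ k * g = ofPos n x := by
  have hg : g ∈ Subgroup.closure (Set.range fun i : Fin n => braidGen (n + 1) i) := by
    rw [closure_range_braidGen]
    exact Subgroup.mem_top g
  have hcomm : ∀ x k, ofPos n x * ofPos n (fullTwist n) ^ k =
      ofPos n (fullTwist n) ^ k * ofPos n x := by
    intro x k
    rw [← map_pow, ← map_mul, ← map_mul, ((fullTwist_commute x).pow_left k).eq]
  induction hg using Subgroup.closure_induction_left with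
  | one => exact ⟨0, 1, by simp⟩
  | mul_left x hx y hy ih =>
    obtain ⟨i, rfl⟩ := hx
    obtain ⟨k, x, hx⟩ := ih
    refine ⟨k, gen i * x, ?_⟩
    rw [map_mul, ← hx, ofPos_gen, ← mul_assoc, ← mul_assoc, ← ofPos_gen, hcomm, ofPos_gen]
  | inv_mul_cancel x hx y hy ih =>
    obtain ⟨i, rfl⟩ := hx
    obtain ⟨k, x, hx⟩ := ih
    obtain ⟨z, hz⟩ := exists_gen_mul_eq_fullTwist i
    refine ⟨k + 1, z * x, ?_⟩
    have h2 : ofPos n (fullTwist n) = braidGen (n + 1) i * ofPos n z := by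
      rw [← hz, map_mul, ofPos_gen]
    have h3 : ofPos n (fullTwist n) * (braidGen (n + 1) i)⁻¹ = ofPos n z := by
      have := hcomm (gen i) 1
      rw [pow_one, ofPos_gen] at this
      rw [mul_inv_eq_iff_eq_mul, ← mul_left_cancel_iff (a := braidGen (n + 1) i), this, h2]
      group
    rw [map_mul, ← hx, ← h3, pow_succ, mul_assoc, ← mul_assoc _ _ y, h3, ← mul_assoc, ← mul_assoc,
      hcomm]

end BraidGroup

namespace BraidComplex

open PosBraid BraidGroup

section Naturality

variable {A B : Type*} [Ring A] [Ring B] (φ : A →+* B) (τ : ℕ → A)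

theorem map_chain {H K : Type*} [Monoid H] [Monoid K] (f : H →* K) (σ : ℕ → H) (s b : ℕ) :
    chain (f ∘ σ) s b = f (chain σ s b) := by
  induction b with
  | zero => simp [chain]
  | succ b ih => rw [chain, ih, chain, map_mul, Function.comp_apply]

theorem map_shuffle (o a b : ℕ) : shuffle (φ ∘ τ) o a b = φ (shuffle τ o a b) := by
  induction hN : a + b generalizing a b with
  | zero =>
    obtain rfl : a = 0 := by omega
    rw [shuffle_zero_left, shuffle_zero_left, map_one]
  | succ N ih =>
    rcases a with _ | a
    · rw [shuffle_zero_left, shuffle_zero_left, map_one]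
    rcases b with _ | b
    · rw [shuffle_zero_right, shuffle_zero_right, map_one]
    rw [shuffle_succ_succ, shuffle_succ_succ, map_add, map_mul, ih _ _ (by omega),
      ih _ _ (by omega)]
    congr 2
    exact map_chain (φ : A →* B) τ _ _

/-- Change of coefficients. -/
noncomputable def mapCoeff : (List ℕ →₀ A) →+ (List ℕ →₀ B) :=
  Finsupp.mapRange.addMonoidHom φ.toAddMonoidHom

theorem mapCoeff_apply (v : List ℕ →₀ A) (w : List ℕ) : mapCoeff φ v w = φ (v w) := rfl

theorem mapCoeff_single (w : List ℕ) (r : A) :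
    mapCoeff φ (Finsupp.single w r) = Finsupp.single w (φ r) := by
  simp [mapCoeff]

theorem mapCoeff_smul (r : A) (v : List ℕ →₀ A) : mapCoeff φ (r • v) = φ r • mapCoeff φ v := by
  ext w
  simp [mapCoeff_apply]

theorem mapCoeff_consMap (c : ℕ) (v : List ℕ →₀ A) :
    mapCoeff φ (consMap A c v) = consMap B c (mapCoeff φ v) := by
  induction v using Finsupp.induction_linear with
  | zero => simp
  | add f g hf hg => simp only [map_add, hf, hg]
  | single w r => simp only [consMap_single, mapCoeff_single]

theorem mapCoeff_bd (o : ℕ) (w : List ℕ) : bd (φ ∘ τ) o w = mapCoeff φ (bd τ o w) := by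
  induction w generalizing o with
  | nil => simp [bd]
  | cons c w ih =>
    rw [bd, bd, map_sub, ih, mapCoeff_consMap, cutHead, cutHead, map_sum]
    congr 1
    exact Finset.sum_congr rfl fun p _ => by rw [mapCoeff_single, map_shuffle]

theorem mapCoeff_boundary (o : ℕ) (v : List ℕ →₀ A) :
    boundary (φ ∘ τ) o (mapCoeff φ v) = mapCoeff φ (boundary τ o v) := by
  induction v using Finsupp.induction_linear with
  | zero => simp
  | add f g hf hg => simp only [map_add, hf, hg]
  | single w r => rw [mapCoeff_single, boundary_single, boundary_single, mapCoeff_bd,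
      mapCoeff_smul]

end Naturality

/-- The lists of blocks of degree `j`. -/
def blocks (n j : ℕ) : Set (List ℕ) := {w | w.sum = j ∧ w.length + j = n + 1}

theorem bd_mem_supported {A : Type*} [Ring A] (τ : ℕ → A) (o : ℕ) (w : List ℕ) :
    bd τ o w ∈ Finsupp.supported A A
      {v : List ℕ | v.sum + 1 = w.sum ∧ v.length = w.length + 1} := by
  induction w generalizing o with
  | nil => exact zero_mem _
  | cons c w ih =>
    rw [bd, cutHead]
    refine sub_mem (Submodule.sum_mem _ fun p hp => ?_) ?_
    · refine Finsupp.single_mem_supported _ _ ?_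
      rw [mem_cuts] at hp
      simp
      omega
    · intro v hv
      obtain ⟨u, hu, rfl⟩ := Finset.mem_image.mp
        (Finsupp.mapDomain_support (Finset.mem_coe.mp hv))
      have := ih _ (Finset.mem_coe.mpr hu)
      simp only [Set.mem_ofPred_eq] at this
      simp
      omega

theorem boundary_mem_supported {A : Type*} [Ring A] (τ : ℕ → A) (o : ℕ) {n j : ℕ}
    {v : List ℕ →₀ A} (hv : v ∈ Finsupp.supported A A (blocks n (j + 1))) :
    boundary τ o v ∈ Finsupp.supported A A (blocks n j) := by
  rw [boundary, Finsupp.linearCombination_apply]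
  refine Submodule.finsuppSum_mem _ _ _ _ fun w hw => Submodule.smul_mem _ _ ?_
  have hw' := hv (Finset.mem_coe.mpr (Finsupp.mem_support_iff.mpr hw))
  refine Finsupp.supported_mono ?_ (bd_mem_supported τ o w)
  rintro u ⟨h1, h2⟩
  obtain ⟨h3, h4⟩ := hw'
  exact ⟨by omega, by omega⟩

section Positive

variable {k : Type*} [CommRing k] {n : ℕ}

theorem span_cells_eq (j : ℕ) (v : List ℕ →₀ MonoidAlgebra k (PosBraid n)) :
    v ∈ Submodule.span k (cellBasis k n '' cells n j) ↔
      v ∈ Finsupp.supported (MonoidAlgebra k (PosBraid n)) (MonoidAlgebra k (PosBraid n))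
        (blocks n j) := by
  constructor
  · intro hv
    induction hv using Submodule.span_induction with
    | zero => exact zero_mem _
    | add x y _ _ hx hy => exact add_mem hx hy
    | smul a x _ hx =>
      rw [← algebraMap_smul (MonoidAlgebra k (PosBraid n)) a x]
      exact Submodule.smul_mem _ _ hx
    | mem x hx =>
      obtain ⟨y, hy, rfl⟩ := hx
      rw [cellBasis_apply]
      exact Finsupp.single_mem_supported _ _ hy
  · intro hv
    rw [← Finsupp.sum_single v]
    refine Submodule.sum_mem _ fun w hw => ?_
    generalize v w = r
    induction r using MonoidAlgebra.induction_linear with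
    | zero => simp
    | add f g hf hg => rw [Finsupp.single_add]; exact add_mem hf hg
    | single m a =>
      have : Finsupp.single w (MonoidAlgebra.single m a) = a • cellBasis k n ⟨w, m⟩ := by
        rw [cellBasis_apply]
        simp
      rw [this]
      exact Submodule.smul_mem _ _ (Submodule.subset_span ⟨_, hv hw, rfl⟩)

end Positive

section Group

variable (k : Type*) [CommRing k] (n : ℕ)

/-- The standard generators of the braid group, indexed by natural numbers. -/
def braidSeq : ℕ → BraidGroup (n + 1) := ofPos n ∘ natGen n

theorem isBraidSeq_braidSeq : IsBraidSeq n (braidSeq n) where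
  far i j h := by
    simp only [braidSeq, Function.comp_apply, ← map_mul, (isBraidSeq_natGen n).far i j h]
  adj i h := by
    simp only [braidSeq, Function.comp_apply, ← map_mul, (isBraidSeq_natGen n).adj i h]

theorem braidSeq_of_lt {i : ℕ} (h : i < n) : braidSeq n i = braidGen (n + 1) ⟨i, h⟩ := by
  rw [braidSeq, Function.comp_apply, natGen_of_lt h, ofPos_gen]

/-- The map from the algebra of positive braids to the group algebra. -/
noncomputable def posAlgHom : MonoidAlgebra k (PosBraid n) →+* MonoidAlgebra k (BraidGroup (n + 1)) :=
  MonoidAlgebra.mapDomainRingHom k (ofPos n)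

variable {k n}

theorem posAlgHom_single (m : PosBraid n) (r : k) :
    posAlgHom k n (MonoidAlgebra.single m r) = MonoidAlgebra.single (ofPos n m) r := by
  simp [posAlgHom]

theorem posAlgHom_injective : Function.Injective (posAlgHom k n) :=
  MonoidAlgebra.mapDomain_injective ofPos_injective

theorem posAlgHom_comp_algGen :
    posAlgHom k n ∘ algGen k (natGen n) = algGen k (braidSeq n) := by
  ext1 i
  rw [Function.comp_apply, algGen, posAlgHom_single]
  rfl

theorem exists_posAlgHom_eq (r : MonoidAlgebra k (BraidGroup (n + 1))) :
    ∃ K, ∀ K' ≥ K, ∃ r', MonoidAlgebra.single (ofPos n (fullTwist n) ^ K') 1 * r =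
      posAlgHom k n r' := by
  induction r using MonoidAlgebra.induction_linear with
  | zero => exact ⟨0, fun _ _ => ⟨0, by simp⟩⟩
  | add f g hf hg =>
    obtain ⟨K, hK⟩ := hf
    obtain ⟨L, hL⟩ := hg
    refine ⟨max K L, fun K' hK' => ?_⟩
    obtain ⟨r, hr⟩ := hK K' (le_trans (le_max_left _ _) hK')
    obtain ⟨s, hs⟩ := hL K' (le_trans (le_max_right _ _) hK')
    exact ⟨r + s, by rw [mul_add, hr, hs, map_add]⟩
  | single g a =>
    obtain ⟨K, x, hx⟩ := exists_ofPos_eq g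
    refine ⟨K, fun K' hK' => ⟨MonoidAlgebra.single (fullTwist n ^ (K' - K) * x) a, ?_⟩⟩
    rw [MonoidAlgebra.single_mul_single, posAlgHom_single, map_mul, ← hx, map_pow, ← mul_assoc,
      ← pow_add, Nat.sub_add_cancel hK', one_mul]

theorem exists_mapCoeff_eq (v : List ℕ →₀ MonoidAlgebra k (BraidGroup (n + 1))) :
    ∃ K, ∀ K' ≥ K, ∃ v', (MonoidAlgebra.single (ofPos n (fullTwist n) ^ K') 1 :
      MonoidAlgebra k (BraidGroup (n + 1))) • v = mapCoeff (posAlgHom k n) v' := by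
  induction v using Finsupp.induction_linear with
  | zero => exact ⟨0, fun _ _ => ⟨0, by simp⟩⟩
  | add f g hf hg =>
    obtain ⟨K, hK⟩ := hf
    obtain ⟨L, hL⟩ := hg
    refine ⟨max K L, fun K' hK' => ?_⟩
    obtain ⟨r, hr⟩ := hK K' (le_trans (le_max_left _ _) hK')
    obtain ⟨s, hs⟩ := hL K' (le_trans (le_max_right _ _) hK')
    exact ⟨r + s, by rw [smul_add, hr, hs, map_add]⟩
  | single w r =>
    obtain ⟨K, hK⟩ := exists_posAlgHom_eq r
    refine ⟨K, fun K' hK' => ?_⟩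
    obtain ⟨r', hr'⟩ := hK K' hK'
    exact ⟨Finsupp.single w r', by rw [mapCoeff_single, ← hr', Finsupp.smul_single, smul_eq_mul]⟩

/-- The complex of lists of blocks over the group algebra is exact in positive degrees. -/
theorem exists_boundary_eq_of_group {j : ℕ} {z : List ℕ →₀ MonoidAlgebra k (BraidGroup (n + 1))}
    (hz : z ∈ Finsupp.supported (MonoidAlgebra k (BraidGroup (n + 1)))
      (MonoidAlgebra k (BraidGroup (n + 1))) (blocks n (j + 1)))
    (hdz : boundary (algGen k (braidSeq n)) 0 z = 0) :
    ∃ y ∈ Finsupp.supported (MonoidAlgebra k (BraidGroup (n + 1)))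
      (MonoidAlgebra k (BraidGroup (n + 1))) (blocks n (j + 2)),
      boundary (algGen k (braidSeq n)) 0 y = z := by
  obtain ⟨K, hK⟩ := exists_mapCoeff_eq z
  obtain ⟨z', hz'⟩ := hK K le_rfl
  have hsupp : z' ∈ Finsupp.supported (MonoidAlgebra k (PosBraid n)) (MonoidAlgebra k (PosBraid n))
      (blocks n (j + 1)) := by
    intro w hw
    by_contra hw'
    have h0 : z w = 0 := by
      by_contra h
      exact hw' (hz (Finsupp.mem_support_iff.mpr h))
    have := DFunLike.congr_fun hz' w
    rw [Finsupp.smul_apply, h0, smul_zero, mapCoeff_apply] at this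
    exact Finsupp.mem_support_iff.mp hw ((map_eq_zero_iff _ posAlgHom_injective).mp this.symm)
  have hdz' : boundary (algGen k (natGen n)) 0 z' = 0 := by
    have h1 := mapCoeff_boundary (posAlgHom k n) (algGen k (natGen n)) 0 z'
    rw [← hz', posAlgHom_comp_algGen, map_smul, hdz, smul_zero] at h1
    ext1 w
    refine posAlgHom_injective ?_
    rw [← mapCoeff_apply, ← h1]
    simp
  obtain ⟨y, hy, hyz⟩ := exists_boundary_eq ((span_cells_eq _ _).mpr hsupp) hdz'
  rw [span_cells_eq] at hy
  refine ⟨(MonoidAlgebra.single (ofPos n (fullTwist n) ^ K)⁻¹ 1 :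
      MonoidAlgebra k (BraidGroup (n + 1))) • mapCoeff (posAlgHom k n) y,
    Submodule.smul_mem _ _ ?_, ?_⟩
  · intro w hw
    refine hy (Finsupp.mem_support_iff.mpr fun h => Finsupp.mem_support_iff.mp hw ?_)
    rw [mapCoeff_apply, h, map_zero]
  · rw [map_smul, ← posAlgHom_comp_algGen, mapCoeff_boundary, hyz, ← hz', smul_smul,
      MonoidAlgebra.single_mul_single, inv_mul_cancel, one_mul, ← MonoidAlgebra.one_def, one_smul]

theorem bd_replicate_zero {A : Type*} [Ring A] (τ : ℕ → A) (o s : ℕ) :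
    bd τ o (List.replicate s 0) = 0 := by
  have := bd_replicate τ o s []
  rwa [List.append_nil, bd, map_zero, smul_zero] at this

theorem mem_blocks_zero {w : List ℕ} : w ∈ blocks n 0 ↔ w = List.replicate (n + 1) 0 := by
  constructor
  · rintro ⟨h1, h2⟩
    rw [List.eq_replicate_iff]
    exact ⟨by omega, fun b hb => List.sum_eq_zero_iff.mp h1 b hb⟩
  · rintro rfl
    simp [blocks]

theorem bd_single_one {A : Type*} [Ring A] (τ : ℕ → A) (s t : ℕ) :
    bd τ 0 (List.replicate s 0 ++ 1 :: List.replicate t 0) =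
      (-1 : A) ^ s • Finsupp.single (List.replicate (s + t + 2) 0) (1 + τ s) := by
  rw [bd_replicate, bd, bd_replicate_zero, map_zero, sub_zero, zero_add, cutHead,
    show cuts 1 = {(0, 0)} from rfl, Finset.sum_singleton, padMap_single]
  congr 2
  · rw [← List.replicate_succ, ← List.replicate_succ, List.replicate_append_replicate,
      show s + (t + 1 + 1) = s + t + 2 by omega]
  · rw [shuffle_succ_succ, shuffle_zero_left, shuffle_zero_right]
    simp [chain]

/-- The complex of lists of blocks over the group algebra is exact in degree zero. -/
theorem exists_boundary_eq_single {e : MonoidAlgebra k (BraidGroup (n + 1)) →ₗ[k] k}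
    (he : ∀ g a, e (MonoidAlgebra.single g a) = a) {r : MonoidAlgebra k (BraidGroup (n + 1))}
    (hr : e r = 0) :
    ∃ y ∈ Finsupp.supported (MonoidAlgebra k (BraidGroup (n + 1)))
      (MonoidAlgebra k (BraidGroup (n + 1))) (blocks n 1),
      boundary (algGen k (braidSeq n)) 0 y = Finsupp.single (List.replicate (n + 1) 0) r := by
  let I : Submodule (MonoidAlgebra k (BraidGroup (n + 1))) (MonoidAlgebra k (BraidGroup (n + 1))) :=
    ((Finsupp.supported (MonoidAlgebra k (BraidGroup (n + 1)))
      (MonoidAlgebra k (BraidGroup (n + 1))) (blocks n 1)).map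
        (boundary (algGen k (braidSeq n)) 0)).comap (Finsupp.lsingle (List.replicate (n + 1) 0))
  suffices h : r ∈ I from h
  let H : Subgroup (BraidGroup (n + 1)) :=
    { carrier := {g | (MonoidAlgebra.single g 1 - 1 : MonoidAlgebra k (BraidGroup (n + 1))) ∈ I}
      one_mem' := by
        change _ ∈ I
        rw [← MonoidAlgebra.one_def, sub_self]
        exact zero_mem I
      mul_mem' := by
        intro g h hg hh
        change _ ∈ I
        have := add_mem (I.smul_mem (MonoidAlgebra.single g 1) hh) hg
        rw [smul_sub, smul_eq_mul, smul_eq_mul, MonoidAlgebra.single_mul_single, mul_one,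
          mul_one] at this
        rwa [sub_add_sub_cancel] at this
      inv_mem' := by
        intro g hg
        change _ ∈ I
        have := neg_mem (I.smul_mem (MonoidAlgebra.single g⁻¹ 1) hg)
        rw [smul_sub, smul_eq_mul, smul_eq_mul, MonoidAlgebra.single_mul_single, inv_mul_cancel,
          mul_one, mul_one, ← MonoidAlgebra.one_def, neg_sub] at this
        exact this }
  have hH : H = ⊤ := by
    rw [eq_top_iff, ← closure_range_braidGen, Subgroup.closure_le]
    rintro _ ⟨s, rfl⟩
    change _ ∈ I
    refine ⟨Finsupp.single (List.replicate s.1 0 ++ 1 :: List.replicate (n - 1 - s.1) 0)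
      (-(-1) ^ s.1), Finsupp.single_mem_supported _ _ ?_, ?_⟩
    · have := s.2
      exact ⟨by simp, by simp; omega⟩
    · have hs := s.2
      rw [boundary_single, bd_single_one, smul_smul, neg_mul, ← pow_add, ← two_mul, pow_mul,
        neg_one_sq, one_pow, show s.1 + (n - 1 - s.1) + 2 = n + 1 by omega, algGen,
        braidSeq_of_lt n hs, neg_one_smul, Finsupp.lsingle_apply, ← Finsupp.single_neg]
      congr 1
      rw [MonoidAlgebra.single_neg]
      abel
  have key : ∀ r, r - algebraMap k _ (e r) ∈ I := by
    intro r
    induction r using MonoidAlgebra.induction_linear with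
    | zero => simp
    | add f g hf hg =>
      have := add_mem hf hg
      rwa [sub_add_sub_comm, ← map_add, ← map_add] at this
    | single g a =>
      have hg : g ∈ H := by rw [hH]; exact Subgroup.mem_top g
      have := I.smul_mem (algebraMap k _ a) hg
      rw [smul_sub, smul_eq_mul, smul_eq_mul, mul_one] at this
      rw [he]
      convert this using 2
      simp [MonoidAlgebra.single_mul_single]
  have := key r
  rwa [hr, map_zero, sub_zero] at this

end Group

end BraidComplex

section Resolution

open CategoryTheory

universe u

variable {k G : Type u} [CommRing k] [Group G]

namespace Rep

/-- A projective resolution of the trivial representation from an exact augmented complex. -/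
noncomputable def resolutionOfExact (C : ChainComplex (Rep.{u} k G) ℕ)
    (ε : C.X 0 ⟶ trivial k G k) (hC : ∀ j, Projective (C.X j))
    (hε : C.d 1 0 ≫ ε = 0) (hsurj : ∀ a, ∃ x, ε.hom x = a)
    (h0 : ∀ x, ε.hom x = 0 → ∃ y, (C.d 1 0).hom y = x)
    (hs : ∀ j x, (C.d (j + 1) j).hom x = 0 → ∃ y, (C.d (j + 2) (j + 1)).hom y = x) :
    ProjectiveResolution (trivial k G k) where
  complex := C
  projective := hC
  π := (C.toSingle₀Equiv _).symm ⟨ε, hε⟩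
  quasiIso :=
    { quasiIsoAt := by
        intro m
        cases m with
        | zero =>
          have hf := ChainComplex.toSingle₀Equiv_symm_apply_f_zero ε hε
          rw [ChainComplex.quasiIsoAt₀_iff, ShortComplex.quasiIso_iff_of_zeros' _
            (C.shape 0 0 (by simp)) rfl rfl]
          constructor
          · apply (forget₂ _ (ModuleCat k)).reflects_exact_of_faithful
            rw [ShortComplex.moduleCat_exact_iff]
            exact fun x hx => h0 x (by rw [← hf]; exact hx)
          · rw [Rep.epi_iff_surjective]
            intro x
            obtain ⟨y, hy⟩ := hsurj x
            refine ⟨y, ?_⟩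
            rw [← hy]
            conv_rhs => rw [← hf]
            rfl
        | succ m =>
          rw [quasiIsoAt_iff_exactAt' (hL := ChainComplex.exactAt_succ_single_obj ..),
            HomologicalComplex.exactAt_iff' _ (m + 2) (m + 1) m (by simp) (by simp)]
          apply (forget₂ _ (ModuleCat k)).reflects_exact_of_faithful
          rw [ShortComplex.moduleCat_exact_iff]
          exact hs m }

end Rep

/-- The homology of a complex of modules, computed by a linear map that detects boundaries. -/
theorem HomologicalComplex.nonempty_homology_equiv {ι : Type*} {c : ComplexShape ι}
    (K : HomologicalComplex (ModuleCat.{u} k) c) {j j' : ι} (hj' : c.next j = j') {M : Type u}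
    [AddCommGroup M] [Module k M]
    (Θ : K.X j →ₗ[k] M) (h1 : ∀ x, (K.d j j').hom x = 0 →
      (Θ x = 0 ↔ ∃ y, (K.d (c.prev j) j).hom y = x))
    (h2 : ∀ m, ∃ x, (K.d j j').hom x = 0 ∧ Θ x = m) :
    Nonempty (K.homology j ≃ₗ[k] M) := by
  subst hj'
  let e := (K.sc j).moduleCatHomologyIso.toLinearEquiv
  let L : LinearMap.ker (K.sc j).g.hom →ₗ[k] M := Θ ∘ₗ Submodule.subtype _
  suffices h : Nonempty ((LinearMap.ker (K.sc j).g.hom ⧸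
      LinearMap.range (K.sc j).moduleCatToCycles) ≃ₗ[k] M) from h.map fun f => e.trans f
  have hL : LinearMap.range (K.sc j).moduleCatToCycles = LinearMap.ker L := by
    ext x
    rw [LinearMap.mem_ker]
    change _ ↔ Θ x.1 = 0
    rw [h1 x.1 x.2]
    constructor
    · rintro ⟨y, rfl⟩
      exact ⟨y, rfl⟩
    · rintro ⟨y, hy⟩
      exact ⟨y, Subtype.ext hy⟩
  refine ⟨(Submodule.quotEquivOfEq _ _ hL).trans (L.quotKerEquivOfSurjective ?_)⟩
  intro m
  obtain ⟨x, hx, rfl⟩ := h2 m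
  exact ⟨⟨x, hx⟩, rfl⟩

end Resolution

namespace BraidComplex

open PosBraid BraidGroup CategoryTheory

section Resolution

universe u

variable {k G : Type u} [CommRing k] [Group G]

theorem free_apply_eq_smul {α : Type*} (g : G) (v : α →₀ MonoidAlgebra k G) :
    Representation.free k G α g v = (MonoidAlgebra.single g 1 : MonoidAlgebra k G) • v := by
  induction v using Finsupp.induction_linear with
  | zero => simp
  | add f h hf hh => rw [map_add, hf, hh, smul_add]
  | single w r =>
    induction r using MonoidAlgebra.induction_linear with
    | zero => simp
    | add f h hf hh => rw [Finsupp.single_add, map_add, hf, hh, smul_add]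
    | single h a =>
      rw [Representation.free_single_single, Finsupp.smul_single, smul_eq_mul,
        MonoidAlgebra.single_mul_single, one_mul]

/-- The morphism of free representations attached to a linear map over the group algebra. -/
noncomputable def freeHom {α β : Type u}
    (D : (α →₀ MonoidAlgebra k G) →ₗ[MonoidAlgebra k G] (β →₀ MonoidAlgebra k G)) :
    Rep.free k G α ⟶ Rep.free k G β :=
  Rep.ofHom
    { D.restrictScalars k with
      isIntertwining' g := by
        refine LinearMap.ext fun v => ?_
        change D _ = Representation.free k G β g (D v)
        rw [free_apply_eq_smul, map_smul, ← free_apply_eq_smul] }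

/-- The inclusion of the free module on a set of lists. -/
noncomputable def incl {A : Type*} [Ring A] (s : Set (List ℕ)) : (s →₀ A) →ₗ[A] (List ℕ →₀ A) :=
  (Finsupp.supported A A s).subtype ∘ₗ (Finsupp.supportedEquivFinsupp s).symm.toLinearMap

theorem incl_injective {A : Type*} [Ring A] (s : Set (List ℕ)) :
    Function.Injective (incl (A := A) s) := by
  rw [incl, LinearMap.coe_comp]
  exact Subtype.val_injective.comp (LinearEquiv.injective _)

theorem incl_mem {A : Type*} [Ring A] {s : Set (List ℕ)} (v : s →₀ A) :
    incl s v ∈ Finsupp.supported A A s :=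
  Subtype.prop _

theorem exists_incl_eq {A : Type*} [Ring A] {s : Set (List ℕ)} {v : List ℕ →₀ A}
    (hv : v ∈ Finsupp.supported A A s) : ∃ u, incl s u = v :=
  ⟨Finsupp.supportedEquivFinsupp s ⟨v, hv⟩, by simp [incl]⟩

theorem incl_single {A : Type*} [Ring A] {s : Set (List ℕ)} (w : s) (r : A) :
    incl s (Finsupp.single w r) = Finsupp.single w.1 r := by
  simp [incl]

/-- The boundary map between lists of blocks of degree `j + 1` and `j`. -/
noncomputable def degBoundary {A : Type*} [Ring A] (τ : ℕ → A) (n j : ℕ) :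
    (blocks n (j + 1) →₀ A) →ₗ[A] (blocks n j →₀ A) :=
  (Finsupp.supportedEquivFinsupp _).toLinearMap ∘ₗ
    (LinearMap.restrict (boundary τ 0) fun _ hv => boundary_mem_supported τ 0 hv) ∘ₗ
    (Finsupp.supportedEquivFinsupp _).symm.toLinearMap

theorem incl_degBoundary {A : Type*} [Ring A] (τ : ℕ → A) (n j : ℕ) (v : blocks n (j + 1) →₀ A) :
    incl _ (degBoundary τ n j v) = boundary τ 0 (incl _ v) := by
  simp [incl, degBoundary]

theorem boundary_boundary {A : Type*} [Ring A] {τ : ℕ → A} {n : ℕ} (hτ : IsBraidSeq n τ) {j : ℕ}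
    {v : List ℕ →₀ A} (hv : v ∈ Finsupp.supported A A (blocks n j)) :
    boundary τ 0 (boundary τ 0 v) = 0 := by
  have h : boundary τ 0 v = v.sum fun w r => r • bd τ 0 w := rfl
  rw [h, map_finsuppSum]
  refine Finset.sum_eq_zero fun w hw => ?_
  obtain ⟨h1, h2⟩ := hv (Finset.mem_coe.mpr hw)
  beta_reduce
  rw [LinearMap.map_smul, boundary_bd hτ (by omega), smul_zero]

end Resolution

section Braid

variable (k : Type) [CommRing k] (n : ℕ)

/-- The complex of free representations of the braid group on lists of blocks. -/
noncomputable def repComplex : ChainComplex (Rep.{0} k (BraidGroup (n + 1))) ℕ :=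
  ChainComplex.of (fun j => Rep.free k (BraidGroup (n + 1)) (blocks n j))
    (fun j => freeHom (degBoundary (algGen k (braidSeq n)) n j)) fun j => by
      apply Rep.hom_ext
      refine Representation.IntertwiningMap.ext (LinearMap.ext fun v => ?_)
      change degBoundary _ _ _ (degBoundary _ _ _ v) = 0
      apply incl_injective
      rw [incl_degBoundary, incl_degBoundary, map_zero]
      exact boundary_boundary (isBraidSeq_algGen (isBraidSeq_braidSeq n)) (incl_mem v)

variable {k n}

theorem repComplex_d (j : ℕ) : (repComplex k n).d (j + 1) j =
    freeHom (degBoundary (algGen k (braidSeq n)) n j) :=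
  ChainComplex.of_d (fun j => Rep.free k (BraidGroup (n + 1)) (blocks n j))
    (fun j => freeHom (degBoundary (algGen k (braidSeq n)) n j)) j

/-- The augmentation of the complex of lists of blocks. -/
noncomputable def augmentation : (repComplex k n).X 0 ⟶ Rep.trivial k (BraidGroup (n + 1)) k :=
  Rep.freeLift k _ _ fun _ => (1 : k)

theorem augmentation_single (w : blocks n 0) (g : BraidGroup (n + 1)) (r : k) :
    (augmentation (k := k) (n := n)).hom
      (Finsupp.single w (MonoidAlgebra.single g r)) = r := by
  refine (Representation.freeLift_single_single _ w g r _).trans ?_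
  simp

theorem exists_eq_of_sum_eq_one {w : List ℕ} (hw : w.sum = 1) :
    ∃ s t, w = List.replicate s 0 ++ 1 :: List.replicate t 0 := by
  induction w with
  | nil => simp at hw
  | cons c w ih =>
    rw [List.sum_cons] at hw
    rcases c with _ | c
    · obtain ⟨s, t, rfl⟩ := ih (by omega)
      exact ⟨s + 1, t, rfl⟩
    · obtain rfl : c = 0 := by omega
      refine ⟨0, w.length, ?_⟩
      rw [List.replicate_zero, List.nil_append, zero_add, List.cons_inj_right,
        List.eq_replicate_iff]
      exact ⟨rfl, fun b hb => List.sum_eq_zero_iff.mp (by omega) b hb⟩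

/-- The augmentation of the group algebra. -/
noncomputable def augAlgHom (k G : Type*) [CommRing k] [Group G] : MonoidAlgebra k G →ₐ[k] k :=
  MonoidAlgebra.lift k k G 1

theorem augAlgHom_single {k G : Type*} [CommRing k] [Group G] (g : G) (a : k) :
    augAlgHom k G (MonoidAlgebra.single g a) = a := by
  simp [augAlgHom]

theorem augmentation_apply (v : blocks n 0 →₀ MonoidAlgebra k (BraidGroup (n + 1))) :
    (augmentation (k := k) (n := n)).hom v =
      augAlgHom k _ (incl _ v (List.replicate (n + 1) 0)) := by
  induction v using Finsupp.induction_linear with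
  | zero => rw [map_zero, Finsupp.zero_apply, map_zero]; exact map_zero _
  | add f h hf hh => rw [map_add, Finsupp.add_apply, map_add, ← hf, ← hh]; exact map_add _ _ _
  | single w r =>
    induction r using MonoidAlgebra.induction_linear with
    | zero =>
      rw [Finsupp.single_zero, map_zero, Finsupp.zero_apply, map_zero]; exact map_zero _
    | add f h hf hh =>
      rw [Finsupp.single_add, map_add, Finsupp.add_apply, map_add, ← hf, ← hh]
      exact map_add _ _ _
    | single g a =>
      rw [augmentation_single, incl_single, mem_blocks_zero.mp w.2, Finsupp.single_eq_same,
        augAlgHom_single]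

theorem augmentation_boundary :
    (repComplex k n).d 1 0 ≫ augmentation = 0 := by
  rw [repComplex_d]
  refine Rep.free_ext k _ _ _ _ fun w => ?_
  change augmentation.hom (degBoundary (algGen k (braidSeq n)) n 0
    (Finsupp.single w (MonoidAlgebra.single 1 1))) = (0 : k)
  rw [augmentation_apply, incl_degBoundary, incl_single, boundary_single]
  obtain ⟨w, h1, h2⟩ := w
  obtain ⟨s, t, rfl⟩ := exists_eq_of_sum_eq_one h1
  rw [bd_single_one, Finsupp.smul_apply, Finsupp.smul_apply, smul_eq_mul, smul_eq_mul, map_mul,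
    map_mul]
  rw [show s + t + 2 = n + 1 by simp at h2; omega, Finsupp.single_eq_same, map_add, algGen,
    augAlgHom_single, augAlgHom_single, map_one, add_neg_cancel, mul_zero, mul_zero]

theorem exists_of_augmentation_eq_zero (x : (repComplex k n).X 0)
    (hx : augmentation.hom x = 0) : ∃ y, ((repComplex k n).d 1 0).hom y = x := by
  rw [repComplex_d]
  change blocks n 0 →₀ MonoidAlgebra k (BraidGroup (n + 1)) at x
  have hx' := augmentation_apply x
  obtain ⟨y, hy, hyx⟩ := exists_boundary_eq_single
    (e := (augAlgHom k (BraidGroup (n + 1))).toLinearMap) augAlgHom_single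
    (hx'.symm.trans hx)
  obtain ⟨u, rfl⟩ := exists_incl_eq hy
  refine ⟨u, incl_injective _ ?_⟩
  refine (incl_degBoundary _ _ _ _).trans (hyx.trans ?_)
  ext1 w
  by_cases hw : w = List.replicate (n + 1) 0
  · rw [hw, Finsupp.single_eq_same]
  · rw [Finsupp.single_eq_of_ne hw]
    by_contra h
    exact hw (mem_blocks_zero.mp (incl_mem x (Finsupp.mem_support_iff.mpr (Ne.symm h))))

theorem exists_of_repComplex_d_eq_zero (j : ℕ) (x : (repComplex k n).X (j + 1))
    (hx : ((repComplex k n).d (j + 1) j).hom x = 0) :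
    ∃ y, ((repComplex k n).d (j + 2) (j + 1)).hom y = x := by
  rw [repComplex_d] at hx ⊢
  change blocks n (j + 1) →₀ MonoidAlgebra k (BraidGroup (n + 1)) at x
  have hx' : degBoundary (algGen k (braidSeq n)) n j x = 0 := hx
  have h0 : boundary (algGen k (braidSeq n)) 0 (incl _ x) = 0 := by
    rw [← incl_degBoundary, hx', map_zero]
  obtain ⟨y, hy, hyx⟩ := exists_boundary_eq_of_group (incl_mem x) h0
  obtain ⟨u, rfl⟩ := exists_incl_eq hy
  refine ⟨u, incl_injective _ ?_⟩
  rw [← hyx]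
  exact incl_degBoundary _ _ _ _

variable (k n) in
/-- The projective resolution of the trivial representation of the braid group. -/
noncomputable def repResolution :
    ProjectiveResolution (Rep.trivial k (BraidGroup (n + 1)) k) :=
  Rep.resolutionOfExact (repComplex k n) augmentation
    (fun j => inferInstanceAs (Projective (Rep.free k (BraidGroup (n + 1)) (blocks n j))))
    augmentation_boundary
    (fun a => ⟨Finsupp.single ⟨_, mem_blocks_zero.mpr rfl⟩ (MonoidAlgebra.single 1 a),
      augmentation_single _ _ _⟩)
    exists_of_augmentation_eq_zero exists_of_repComplex_d_eq_zero

end Braid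
end BraidComplex

namespace BraidComplex

open PosBraid BraidGroup CategoryTheory

section Constant

variable {A : Type*} [Ring A]

theorem chain_congr {H : Type*} [Monoid H] {τ τ' : ℕ → H} {s b : ℕ}
    (h : ∀ i, i < s + b → τ i = τ' i) : chain τ s b = chain τ' s b := by
  induction b with
  | zero => rfl
  | succ b ih => rw [chain, chain, ih fun i hi => h i (by omega), h _ (by omega)]

theorem shuffle_congr {τ τ' : ℕ → A} {o a b N : ℕ} (hN : o + a + b ≤ N + 1)
    (h : ∀ i, i < N → τ i = τ' i) : shuffle τ o a b = shuffle τ' o a b := by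
  induction hM : a + b generalizing a b with
  | zero =>
    obtain rfl : a = 0 := by omega
    rw [shuffle_zero_left, shuffle_zero_left]
  | succ M ih =>
    rcases a with _ | a
    · rw [shuffle_zero_left, shuffle_zero_left]
    rcases b with _ | b
    · rw [shuffle_zero_right, shuffle_zero_right]
    rw [shuffle_succ_succ, shuffle_succ_succ, ih (by omega) (by omega), ih (by omega) (by omega),
      chain_congr fun i hi => h i (by omega)]

theorem bd_congr {τ τ' : ℕ → A} {o N : ℕ} {w : List ℕ} (hN : o + w.sum + w.length ≤ N + 1)
    (h : ∀ i, i < N → τ i = τ' i) : bd τ o w = bd τ' o w := by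
  induction w generalizing o with
  | nil => rfl
  | cons c w ih =>
    rw [List.sum_cons, List.length_cons] at hN
    rw [bd, bd, ih (by omega), cutHead, cutHead]
    congr 1
    refine Finset.sum_congr rfl fun p hp => ?_
    rw [mem_cuts] at hp
    rw [shuffle_congr (by omega) h]

end Constant

section Commutative

variable {R : Type*} [CommRing R]

/-- The Gaussian binomial coefficient `(a + b choose a)` at `q`. -/
def gauss (q : R) : ℕ → ℕ → R
  | 0, _ => 1
  | _ + 1, 0 => 1
  | a + 1, b + 1 => gauss q (a + 1) b + gauss q a (b + 1) * q ^ (b + 1)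

theorem shuffle_const (q : R) (o a b : ℕ) : shuffle (fun _ => q) o a b = gauss q a b := by
  have hc : ∀ s b, chain (fun _ => q) s b = q ^ b := by
    intro s b
    induction b with
    | zero => simp [chain]
    | succ b ih => rw [chain, ih, pow_succ']
  induction hM : a + b generalizing a b with
  | zero =>
    obtain rfl : a = 0 := by omega
    rw [shuffle_zero_left, gauss]
  | succ M ih =>
    rcases a with _ | a
    · rw [shuffle_zero_left, gauss]
    rcases b with _ | b
    · rw [shuffle_zero_right, gauss]
    rw [shuffle_succ_succ, gauss, hc, ih _ _ (by omega), ih _ _ (by omega)]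

/-- The coboundary of a function on lists of blocks. -/
def cobd (q : R) : (List ℕ → R) → List ℕ → R
  | _, [] => 0
  | f, c :: w => ∑ p ∈ cuts c, gauss q (p.1 + 1) (p.2 + 1) * f (p.1 :: p.2 :: w) -
      cobd q (fun u => f (c :: u)) w

theorem linearCombination_bd (q : R) (f : List ℕ → R) (o : ℕ) (w : List ℕ) :
    Finsupp.linearCombination R f (bd (fun _ => q) o w) = cobd q f w := by
  induction w generalizing f o with
  | nil => simp [bd, cobd]
  | cons c w ih =>
    have : Finsupp.linearCombination R f ∘ₗ consMap R c =
        Finsupp.linearCombination R fun u => f (c :: u) := by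
      ext u
      simp [consMap_single]
    rw [bd, map_sub, ← LinearMap.comp_apply, this, ih, cobd, cutHead, map_sum]
    congr 1
    refine Finset.sum_congr rfl fun p _ => ?_
    rw [Finsupp.linearCombination_single, shuffle_const, smul_eq_mul]

theorem cobd_eq_zero_of_notMem {q : R} {f : List ℕ → R} {n j : ℕ}
    (hf : ∀ w, w ∉ blocks n j → f w = 0) {w : List ℕ} (hw : w ∉ blocks n (j + 1)) :
    cobd q f w = 0 := by
  rw [← linearCombination_bd q f 0, Finsupp.linearCombination_apply]
  refine Finset.sum_eq_zero fun u hu => ?_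
  obtain ⟨h1, h2⟩ := bd_mem_supported (fun _ => q) 0 w (Finset.mem_coe.mpr hu)
  beta_reduce
  rw [hf, smul_zero]
  rintro ⟨h3, h4⟩
  exact hw ⟨by omega, by omega⟩

end Commutative

section Cohomology

variable {k : Type} [CommRing k] {n : ℕ} {ρ : Representation k (BraidGroup (n + 1)) k}

/-- The character of the group algebra attached to a representation on the base ring. -/
noncomputable def character {G : Type*} [Group G] (ρ : Representation k G k) :
    MonoidAlgebra k G →ₐ[k] k :=
  MonoidAlgebra.lift k k G
    { toFun g := ρ g 1
      map_one' := by simp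
      map_mul' g h := by
        rw [map_mul, Module.End.mul_apply, ← mul_one (ρ h 1), ← smul_eq_mul, map_smul, smul_eq_mul,
          smul_eq_mul, mul_one, mul_comm] }

theorem character_single {G : Type*} [Group G] (ρ : Representation k G k) (g : G) (a : k) :
    character ρ (MonoidAlgebra.single g a) = ρ g a := by
  simp only [character, MonoidAlgebra.lift_single]
  change a • ρ g 1 = _
  rw [← map_smul, smul_eq_mul, mul_one]

/-- Extension by zero of a function on lists of blocks. -/
noncomputable def extendBlocks (n j : ℕ) : (blocks n j → k) →ₗ[k] (List ℕ → k) :=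
  Function.ExtendByZero.linearMap k Subtype.val

theorem extendBlocks_apply {j : ℕ} (f : blocks n j → k) (w : blocks n j) :
    extendBlocks n j f w = f w :=
  Subtype.val_injective.extend_apply _ _ _

theorem extendBlocks_of_notMem {j : ℕ} (f : blocks n j → k) {w : List ℕ} (hw : w ∉ blocks n j) :
    extendBlocks n j f w = 0 :=
  Function.extend_apply' _ _ _ (by rintro ⟨u, rfl⟩; exact hw u.2)

theorem hom_apply {j : ℕ} (f : Rep.free k (BraidGroup (n + 1)) (blocks n j) ⟶ Rep.of ρ)
    (v : blocks n j →₀ MonoidAlgebra k (BraidGroup (n + 1))) :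
    f.hom v = Finsupp.linearCombination k (extendBlocks n j (Rep.freeLiftLEquiv k _ _ _ f))
      (mapCoeff (character ρ).toRingHom (incl _ v)) := by
  obtain ⟨φ, rfl⟩ := (Rep.freeLiftLEquiv k _ _ _).symm.surjective f
  rw [LinearEquiv.apply_symm_apply]
  induction v using Finsupp.induction_linear with
  | zero => simp only [map_zero]
  | add f h hf hh => simp only [map_add, hf, hh]
  | single w r =>
    induction r using MonoidAlgebra.induction_linear with
    | zero => simp only [Finsupp.single_zero, map_zero]
    | add f h hf hh => simp only [Finsupp.single_add, map_add, hf, hh]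
    | single g a =>
      rw [incl_single, mapCoeff_single, Finsupp.linearCombination_single, extendBlocks_apply]
      refine (Representation.freeLift_single_single _ w g a _).trans ?_
      change a • ρ g (φ w) = character ρ (MonoidAlgebra.single g a) • φ w
      rw [character_single, ← map_smul, smul_eq_mul, smul_eq_mul]
      conv_lhs => rw [mul_comm, ← smul_eq_mul, map_smul, smul_eq_mul, mul_comm]

theorem comp_hom_single {q : k} (hρ : ∀ (s : Fin n) (x : k), ρ (braidGen (n + 1) s) x = -q * x)
    {j : ℕ} (f : Rep.free k (BraidGroup (n + 1)) (blocks n j) ⟶ Rep.of ρ) (w : blocks n (j + 1)) :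
    Rep.freeLiftLEquiv k _ _ _
      (freeHom (degBoundary (algGen k (braidSeq n)) n j) ≫ f) w =
      cobd q (extendBlocks n j (Rep.freeLiftLEquiv k _ _ _ f)) w := by
  change f.hom (degBoundary (algGen k (braidSeq n)) n j
    (Finsupp.single w (MonoidAlgebra.single 1 1))) = _
  obtain ⟨h1, h2⟩ := w.2
  rw [hom_apply, incl_degBoundary, incl_single, boundary_single, ← MonoidAlgebra.one_def, one_smul,
    ← mapCoeff_bd, bd_congr (τ' := fun _ => q) (N := n) (by omega), linearCombination_bd]
  intro i hi
  rw [Function.comp_apply, algGen, braidSeq_of_lt n hi]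
  refine (character_single ρ _ _).trans ?_
  rw [hρ, neg_mul_neg, mul_one]

end Cohomology

end BraidComplex

namespace BraidComplex

open PosBraid BraidGroup CategoryTheory

theorem cobd_congr {R : Type*} [CommRing R] {q : R} {f g : List ℕ → R} {w : List ℕ}
    (h : ∀ u : List ℕ, u.sum + 1 = w.sum → u.length = w.length + 1 → f u = g u) :
    cobd q f w = cobd q g w := by
  rw [← linearCombination_bd q f 0, ← linearCombination_bd q g 0,
    Finsupp.linearCombination_apply, Finsupp.linearCombination_apply]
  refine Finset.sum_congr rfl fun u hu => ?_
  obtain ⟨h1, h2⟩ := bd_mem_supported (fun _ => q) 0 w (Finset.mem_coe.mpr hu)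
  beta_reduce
  rw [h u h1 h2]

section Cohomology

variable {k : Type} [CommRing k] {n : ℕ} {ρ : Representation k (BraidGroup (n + 1)) k}

theorem exists_eq_freeLiftLEquiv {j : ℕ} {f : List ℕ → k} (hf : ∀ w, w ∉ blocks n j → f w = 0) :
    ∃ x : Rep.free k (BraidGroup (n + 1)) (blocks n j) ⟶ Rep.of ρ,
      extendBlocks n j (Rep.freeLiftLEquiv k _ _ _ x) = f := by
  obtain ⟨x, hx⟩ := (Rep.freeLiftLEquiv k (BraidGroup (n + 1)) (blocks n j) (Rep.of ρ)).surjective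
    (fun w => f w)
  refine ⟨x, funext fun w => ?_⟩
  rw [hx]
  by_cases hw : w ∈ blocks n j
  · exact extendBlocks_apply _ ⟨w, hw⟩
  · rw [extendBlocks_of_notMem _ hw, hf w hw]

theorem extendBlocks_injective (j : ℕ) : Function.Injective (extendBlocks (k := k) n j) := by
  intro f g h
  ext w
  rw [← extendBlocks_apply f w, h, extendBlocks_apply]

theorem extendBlocks_comp {q : k} (hρ : ∀ (s : Fin n) (x : k), ρ (braidGen (n + 1) s) x = -q * x)
    {j : ℕ} (f : Rep.free k (BraidGroup (n + 1)) (blocks n j) ⟶ Rep.of ρ) :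
    extendBlocks n (j + 1) (Rep.freeLiftLEquiv k _ _ _
      (freeHom (degBoundary (algGen k (braidSeq n)) n j) ≫ f)) =
      cobd q (extendBlocks n j (Rep.freeLiftLEquiv k _ _ _ f)) := by
  ext w
  by_cases hw : w ∈ blocks n (j + 1)
  · exact (extendBlocks_apply _ ⟨w, hw⟩).trans (comp_hom_single hρ f ⟨w, hw⟩)
  · rw [extendBlocks_of_notMem _ hw, cobd_eq_zero_of_notMem _ hw]
    exact fun u hu => extendBlocks_of_notMem _ hu

/-- The cohomology of the braid group, computed by a linear map on functions on lists of blocks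
that detects coboundaries. -/
theorem nonempty_groupCohomology_equiv {q : k}
    (hρ : ∀ (s : Fin n) (x : k), ρ (braidGen (n + 1) s) x = -q * x) (j : ℕ) {M : Type}
    [AddCommGroup M] [Module k M] (Θ : (List ℕ → k) →ₗ[k] M)
    (h1 : ∀ f, (∀ w, w ∉ blocks n j → f w = 0) → cobd q f = 0 →
      (Θ f = 0 ↔ ∃ g, ∀ w ∈ blocks n j, cobd q g w = f w))
    (h2 : ∀ m, ∃ f, (∀ w, w ∉ blocks n j → f w = 0) ∧ cobd q f = 0 ∧ Θ f = m) :
    Nonempty (groupCohomology (Rep.of ρ) j ≃ₗ[k] M) := by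
  let K := (repComplex k n).linearYonedaObj k (Rep.of ρ)
  obtain ⟨E, hE, hE', hsurj, hd⟩ : ∃ E : ∀ j, K.X j →ₗ[k] (List ℕ → k),
      (∀ j, Function.Injective (E j)) ∧ (∀ j x w, w ∉ blocks n j → E j x w = 0) ∧
      (∀ j f, (∀ w, w ∉ blocks n j → f w = 0) → ∃ x, E j x = f) ∧
      ∀ j x, E (j + 1) ((K.d j (j + 1)).hom x) = cobd q (E j x) := by
    refine ⟨fun j => extendBlocks n j ∘ₗ (Rep.freeLiftLEquiv k _ _ (Rep.of ρ)).toLinearMap,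
      fun j => (extendBlocks_injective j).comp (LinearEquiv.injective _),
      fun j x w hw => extendBlocks_of_notMem _ hw, fun j f hf => exists_eq_freeLiftLEquiv hf,
      fun j x => ?_⟩
    refine Eq.trans ?_ (extendBlocks_comp hρ x)
    rw [← repComplex_d]
    rfl
  have hK := K.nonempty_homology_equiv (j := j) (j' := j + 1) (by simp) (Θ ∘ₗ E j) ?_ ?_
  · obtain ⟨e⟩ := hK
    exact ⟨(groupCohomologyIso (Rep.of ρ) j (repResolution k n)).toLinearEquiv.trans e⟩
  · intro x hx
    have hx' : cobd q (E j x) = 0 := by rw [← hd, hx, map_zero]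
    refine (h1 (E j x) (hE' j x) hx').trans ?_
    rcases j with _ | j
    · rw [show (ComplexShape.up ℕ).prev 0 = 0 by simp, K.shape 0 0 (by simp)]
      constructor
      · rintro ⟨g, hg⟩
        refine ⟨0, (hE 0 ?_).symm⟩
        rw [map_zero, map_zero]
        ext w
        by_cases hw : w ∈ blocks n 0
        · rw [← hg w hw, ← linearCombination_bd q g 0, mem_blocks_zero.mp hw, bd_replicate_zero,
            map_zero]
          rfl
        · exact hE' 0 _ w hw
      · rintro ⟨y, hy⟩
        obtain rfl : x = 0 := hy.symm
        refine ⟨0, fun w hw => ?_⟩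
        rw [← linearCombination_bd q 0 0, mem_blocks_zero.mp hw, bd_replicate_zero, map_zero,
          map_zero]
        rfl
    · rw [show (ComplexShape.up ℕ).prev (j + 1) = j by simp]
      constructor
      · rintro ⟨g, hg⟩
        obtain ⟨y, hy⟩ := hsurj j (extendBlocks n j fun w => g w)
          fun w hw => extendBlocks_of_notMem _ hw
        refine ⟨y, hE (j + 1) ?_⟩
        rw [hd]
        ext w
        by_cases hw : w ∈ blocks n (j + 1)
        · rw [← hg w hw, hy]
          obtain ⟨h3, h4⟩ := hw
          exact cobd_congr fun u h5 h6 => extendBlocks_apply _ ⟨u, by omega, by omega⟩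
        · rw [hE' _ _ w hw, cobd_eq_zero_of_notMem (hE' j y) hw]
      · rintro ⟨y, rfl⟩
        exact ⟨E j y, fun w _ => by rw [hd]⟩
  · intro m
    obtain ⟨f, hf, hf0, rfl⟩ := h2 m
    obtain ⟨x, rfl⟩ := hsurj j f hf
    exact ⟨x, hE (j + 1) (by rw [hd, hf0, map_zero]), rfl⟩

end Cohomology

end BraidComplex

namespace BraidComplex

section Gauss

variable {R : Type*} [CommRing R] (q : R)

theorem gauss_zero_left (b : ℕ) : gauss q 0 b = 1 := by rw [gauss]

theorem gauss_zero_right (a : ℕ) : gauss q a 0 = 1 := by cases a <;> rw [gauss]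

theorem gauss_assoc (a b c : ℕ) :
    gauss q (a + b) c * gauss q a b = gauss q a (b + c) * gauss q b c := by
  have hq : IsBraidSeq (a + b + c) fun _ : ℕ => q :=
    ⟨fun _ _ _ => rfl, fun _ _ => rfl⟩
  simpa only [shuffle_const] using shuffle_assoc hq (o := 0) (a := a) (b := b) (c := c) (by omega)

theorem gauss_one_succ (b : ℕ) : gauss q 1 (b + 1) = gauss q 1 b + q ^ (b + 1) := by
  rw [gauss, gauss, one_mul]

theorem gauss_one_right (a : ℕ) : gauss q a 1 = gauss q 1 a := by
  have h : ∀ b, gauss q 1 (b + 1) = 1 + gauss q 1 b * q := by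
    intro b
    induction b with
    | zero => rw [gauss_one_succ, gauss_zero_right, pow_one, one_mul]
    | succ b ih =>
      rw [gauss_one_succ, gauss_one_succ q b, add_mul, ← add_assoc, ← pow_succ, ← gauss_one_succ, ih]
  induction a with
  | zero => rw [gauss_zero_left, gauss_zero_right]
  | succ a ih => rw [gauss, gauss_zero_right, zero_add, pow_one, ih, h]

theorem gauss_succ_mul (a b : ℕ) :
    gauss q (a + 1) b * gauss q 1 a = gauss q 1 (a + b) * gauss q a b := by
  rw [← gauss_assoc, add_comm 1 a]

theorem map_gauss {S : Type*} [CommRing S] (φ : R →+* S) (a b : ℕ) :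
    φ (gauss q a b) = gauss (φ q) a b := by
  induction hN : a + b generalizing a b with
  | zero =>
    obtain rfl : a = 0 := by omega
    rw [gauss_zero_left, gauss_zero_left, map_one]
  | succ N ih =>
    rcases a with _ | a
    · rw [gauss_zero_left, gauss_zero_left, map_one]
    rcases b with _ | b
    · rw [gauss_zero_right, gauss_zero_right, map_one]
    rw [gauss, gauss, map_add, map_mul, map_pow, ih _ _ (by omega), ih _ _ (by omega)]

end Gauss

section Cobd

variable {R : Type*} [CommRing R] {q : R}

theorem cobd_nil (f : List ℕ → R) : cobd q f [] = 0 := by rw [cobd]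

theorem cobd_cons (f : List ℕ → R) (c : ℕ) (w : List ℕ) :
    cobd q f (c :: w) = ∑ p ∈ cuts c, gauss q (p.1 + 1) (p.2 + 1) * f (p.1 :: p.2 :: w) -
      cobd q (fun u => f (c :: u)) w := by rw [cobd]

variable (q) in
/-- The coboundary as a linear map. -/
def cobdHom : (List ℕ → R) →ₗ[R] (List ℕ → R) where
  toFun := cobd q
  map_add' f g := by
    ext w
    induction w generalizing f g with
    | nil => simp [cobd_nil]
    | cons c w ih =>
      have h := ih (fun u => f (c :: u)) (fun u => g (c :: u))
      simp only [Pi.add_apply, cobd_cons, mul_add, Finset.sum_add_distrib] at h ⊢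
      rw [← sub_eq_zero, ← sub_eq_zero.mpr h.symm]
      simp only [Pi.add_def]
      ring
  map_smul' r f := by
    ext w
    induction w generalizing f with
    | nil => simp [cobd_nil]
    | cons c w ih =>
      have h := ih (fun u => f (c :: u))
      simp only [Pi.smul_apply, smul_eq_mul, cobd_cons, RingHom.id_apply, mul_left_comm _ r,
        ← Finset.mul_sum, mul_sub] at h ⊢
      rw [← h]
      rfl

theorem cobdHom_apply (f : List ℕ → R) : cobdHom q f = cobd q f := rfl

theorem cobd_zero : cobd q (0 : List ℕ → R) = 0 := (cobdHom q).map_zero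

theorem cobd_add (f g : List ℕ → R) : cobd q (f + g) = cobd q f + cobd q g :=
  (cobdHom q).map_add f g

theorem cobd_sub (f g : List ℕ → R) : cobd q (f - g) = cobd q f - cobd q g :=
  (cobdHom q).map_sub f g

theorem cobd_smul (r : R) (f : List ℕ → R) : cobd q (r • f) = r • cobd q f :=
  (cobdHom q).map_smul r f

theorem cobd_congr_length {f g : List ℕ → R} {w : List ℕ}
    (h : ∀ u : List ℕ, u.length = w.length + 1 → f u = g u) : cobd q f w = cobd q g w :=
  cobd_congr fun u _ hu => h u hu

theorem cobd_eq_zero_of_length {f : List ℕ → R} {w : List ℕ}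
    (h : ∀ u : List ℕ, u.length = w.length + 1 → f u = 0) : cobd q f w = 0 := by
  rw [cobd_congr_length (g := 0) h, cobd_zero]
  rfl

theorem map_cobd {S : Type*} [CommRing S] (φ : R →+* S) (f : List ℕ → R) (w : List ℕ) :
    φ (cobd q f w) = cobd (φ q) (fun u => φ (f u)) w := by
  induction w generalizing f with
  | nil => rw [cobd_nil, cobd_nil, map_zero]
  | cons c w ih =>
    rw [cobd_cons, cobd_cons, map_sub, map_sum, ih]
    simp only [map_mul, map_gauss]

end Cobd

section Window

variable {R : Type*} [CommRing R] (q : R)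

/-- The coboundary on functions on pairs consisting of a block of size `m`, possibly empty, and a
list of blocks. -/
def winCobd (F : ℕ → List ℕ → R) (m : ℕ) (w : List ℕ) : R :=
  ∑ p ∈ cuts m, gauss q p.1 (p.2 + 1) * F p.1 (p.2 :: w) - cobd q (F m) w

/-- The function on pairs given by a function on lists of blocks. -/
def unfoldHead (f : List ℕ → R) : ℕ → List ℕ → R
  | 0, _ => 0
  | m + 1, w => f (m :: w)

variable {q}

theorem winCobd_congr {F G : ℕ → List ℕ → R} {m : ℕ} (h : ∀ p ≤ m, F p = G p) :
    winCobd q F m = winCobd q G m := by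
  ext w
  rw [winCobd, winCobd, h m le_rfl]
  congr 1
  refine Finset.sum_congr rfl fun p hp => ?_
  rw [mem_cuts] at hp
  rw [h _ (by omega)]

theorem winCobd_eq_zero {F : ℕ → List ℕ → R} {m : ℕ} (h : ∀ p ≤ m, F p = 0) :
    winCobd q F m = 0 := by
  rw [winCobd_congr (G := 0) h]
  ext w
  simp [winCobd, cobd_zero]

theorem winCobd_sub (F G : ℕ → List ℕ → R) (m : ℕ) :
    winCobd q (F - G) m = winCobd q F m - winCobd q G m := by
  ext w
  simp only [winCobd, Pi.sub_apply, mul_sub, Finset.sum_sub_distrib, cobd_sub]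
  ring

theorem sum_cuts_succ {V : Type*} [AddCommMonoid V] (m : ℕ) (f : ℕ → ℕ → V) :
    ∑ p ∈ cuts (m + 1), f p.1 p.2 = f 0 m + ∑ p ∈ cuts m, f (p.1 + 1) p.2 := by
  rcases m with _ | m
  · simp [cuts]
  · rw [cuts, cuts, Finset.Nat.sum_antidiagonal_succ]

theorem sum_cuts_succ' {V : Type*} [AddCommMonoid V] (m : ℕ) (f : ℕ → ℕ → V) :
    ∑ p ∈ cuts (m + 1), f p.1 p.2 = ∑ p ∈ cuts m, f p.1 (p.2 + 1) + f m 0 := by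
  rcases m with _ | m
  · simp [cuts]
  · rw [cuts, cuts, Finset.Nat.sum_antidiagonal_succ', add_comm]

theorem winCobd_succ (F : ℕ → List ℕ → R) (m : ℕ) (w : List ℕ) :
    winCobd q F (m + 1) w = F 0 (m :: w) +
      ∑ p ∈ cuts m, gauss q (p.1 + 1) (p.2 + 1) * F (p.1 + 1) (p.2 :: w) -
      cobd q (F (m + 1)) w := by
  rw [winCobd, sum_cuts_succ m fun a b => gauss q a (b + 1) * F a (b :: w), gauss_zero_left, one_mul]

theorem winCobd_zero (F : ℕ → List ℕ → R) (w : List ℕ) :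
    winCobd q F 0 w = - cobd q (F 0) w := by
  simp [winCobd, cuts]

theorem winCobd_unfoldHead_succ (f : List ℕ → R) (m : ℕ) (w : List ℕ) :
    winCobd q (unfoldHead f) (m + 1) w = cobd q f (m :: w) := by
  rw [winCobd_succ, cobd_cons, unfoldHead, zero_add]
  rfl

theorem winCobd_unfoldHead_zero (f : List ℕ → R) : winCobd q (unfoldHead f) 0 = 0 :=
  winCobd_eq_zero fun p hp => by
    obtain rfl : p = 0 := by omega
    rfl

theorem winCobd_winCobd_of_cobd {F : ℕ → List ℕ → R} {m : ℕ} {w : List ℕ}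
    (h : cobd q (cobd q (F m)) w = 0) : winCobd q (winCobd q F) m w = 0 := by
  have h1 : cobd q (winCobd q F m) w =
      ∑ p ∈ cuts m, gauss q p.1 (p.2 + 1) * cobd q (fun u => F p.1 (p.2 :: u)) w := by
    have : winCobd q F m = ∑ p ∈ cuts m, gauss q p.1 (p.2 + 1) • (fun u => F p.1 (p.2 :: u)) -
        cobd q (F m) := by
      ext u
      simp [winCobd]
    rw [this, cobd_sub, Pi.sub_apply, h, sub_zero, ← cobdHom_apply, map_sum]
    simp [cobdHom_apply]
  have h2 : ∑ p ∈ cuts m, ∑ r ∈ cuts p.1,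
        gauss q p.1 (p.2 + 1) * (gauss q r.1 (r.2 + 1) * F r.1 (r.2 :: p.2 :: w)) =
      ∑ p ∈ cuts m, ∑ r ∈ cuts p.2,
        gauss q p.1 (p.2 + 1) * (gauss q (r.1 + 1) (r.2 + 1) * F p.1 (r.1 :: r.2 :: w)) := by
    have h3 := sum_cuts_assoc m fun a b c =>
      gauss q (a + (b + 1)) (c + 1) * gauss q a (b + 1) * F a (b :: c :: w)
    refine Eq.trans (Finset.sum_congr rfl fun p hp => Finset.sum_congr rfl fun r hr => ?_)
      (h3.trans (Finset.sum_congr rfl fun p hp => Finset.sum_congr rfl fun r hr => ?_))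
    · rw [mem_cuts] at hr
      rw [← hr, add_assoc r.1, mul_assoc]
    · rw [mem_cuts] at hr
      rw [gauss_assoc, ← mul_assoc, ← hr]
      congr 3
      omega
  rw [winCobd, h1, sub_eq_zero]
  calc _ = ∑ p ∈ cuts m, ∑ r ∈ cuts p.1,
        gauss q p.1 (p.2 + 1) * (gauss q r.1 (r.2 + 1) * F r.1 (r.2 :: p.2 :: w)) -
      (∑ p ∈ cuts m, ∑ r ∈ cuts p.2,
        gauss q p.1 (p.2 + 1) * (gauss q (r.1 + 1) (r.2 + 1) * F p.1 (r.1 :: r.2 :: w)) -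
      ∑ p ∈ cuts m, gauss q p.1 (p.2 + 1) * cobd q (fun u => F p.1 (p.2 :: u)) w) := by
        rw [← Finset.sum_sub_distrib, ← Finset.sum_sub_distrib]
        refine Finset.sum_congr rfl fun p _ => ?_
        rw [winCobd, cobd_cons, mul_sub, mul_sub, Finset.mul_sum, Finset.mul_sum]
    _ = _ := by rw [h2, sub_sub_cancel]

theorem cobd_cobd (f : List ℕ → R) : cobd q (cobd q f) = 0 := by
  ext w
  induction w generalizing f with
  | nil => exact cobd_nil _
  | cons c w ih =>
    have h : unfoldHead (cobd q f) = winCobd q (unfoldHead f) := by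
      ext m u
      rcases m with _ | m
      · rw [winCobd_unfoldHead_zero]
        rfl
      · rw [winCobd_unfoldHead_succ]
        rfl
    rw [← winCobd_unfoldHead_succ, h]
    exact winCobd_winCobd_of_cobd (ih _)

theorem winCobd_winCobd (F : ℕ → List ℕ → R) : winCobd q (winCobd q F) = 0 := by
  ext m w
  exact winCobd_winCobd_of_cobd (congrFun (cobd_cobd _) w)

/-- The complex of all pairs is exact away from the empty list. -/
theorem exists_winCobd_eq {F : ℕ → List ℕ → R} (h : winCobd q F = 0) (h0 : F 0 [] = 0) :
    ∃ G, winCobd q G = F := by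
  let g : List ℕ → R := fun w => List.rec 0 (fun c u _ => F (c + 1) u) w
  let G : ℕ → List ℕ → R := fun m => if m = 0 then g else 0
  refine ⟨G, funext fun m => funext fun w => ?_⟩
  rcases m with _ | m
  · rw [winCobd_zero]
    change - cobd q g w = _
    rcases w with _ | ⟨c, w⟩
    · rw [cobd_nil, h0, neg_zero]
    · have h1 : winCobd q F (c + 1) w = 0 := by rw [h]; rfl
      rw [winCobd_succ] at h1
      rw [cobd_cons]
      change -(∑ p ∈ cuts c, gauss q (p.1 + 1) (p.2 + 1) * F (p.1 + 1) (p.2 :: w) -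
        cobd q (F (c + 1)) w) = _
      linear_combination -h1
  · rw [winCobd_succ]
    change F (m + 1) w + ∑ p ∈ cuts m, gauss q (p.1 + 1) (p.2 + 1) * 0 - cobd q 0 w = _
    simp [cobd_zero]

end Window

end BraidComplex

namespace BraidComplex

section Truncated

variable {R : Type*} [CommRing R] {q : R} {h : ℕ}

theorem winCobd_shift (F : ℕ → List ℕ → R) (m : ℕ) (w : List ℕ) :
    winCobd q (fun m w => if m < h then 0 else gauss q h (m - h) * F (m - h) w) (h + m) w =
      gauss q h m * winCobd q F m w := by
  have h1 : ∑ p ∈ cuts (h + m), gauss q p.1 (p.2 + 1) *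
        (if p.1 < h then 0 else gauss q h (p.1 - h) * F (p.1 - h) (p.2 :: w)) =
      ∑ p ∈ cuts m, gauss q (h + p.1) (p.2 + 1) * (gauss q h p.1 * F p.1 (p.2 :: w)) := by
    symm
    refine Finset.sum_of_injOn (fun p => (h + p.1, p.2)) ?_ ?_ ?_ ?_
    · rintro ⟨a, b⟩ _ ⟨c, d⟩ _ hp
      simpa using hp
    · rintro ⟨a, b⟩ hp
      simp only [Finset.mem_coe, mem_cuts] at hp ⊢
      omega
    · rintro ⟨a, b⟩ hp hp'
      rw [mem_cuts] at hp
      rw [if_pos, mul_zero]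
      by_contra hc
      refine hp' ⟨(a - h, b), ?_, ?_⟩
      · simp only [Finset.mem_coe, mem_cuts] at hp ⊢
        omega
      · simp only [Prod.mk.injEq, and_true]
        omega
    · rintro ⟨a, b⟩ _
      simp
  rw [winCobd, h1, winCobd, mul_sub, Finset.mul_sum]
  congr 1
  · refine Finset.sum_congr rfl fun p hp => ?_
    rw [mem_cuts] at hp
    rw [← mul_assoc, gauss_assoc, mul_assoc, ← add_assoc, hp]
  · have h2 : (fun u => if h + m < h then 0 else gauss q h (h + m - h) * F (h + m - h) u) =
        gauss q h m • F m := by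
      ext u
      simp
    rw [h2, cobd_smul]
    rfl

/-- The subcomplex of pairs with first block of size at least `h`. -/
theorem exists_winCobd_eq_of_le (hu : ∀ m, IsUnit (gauss q h m)) {F : ℕ → List ℕ → R}
    (hF : winCobd q F = 0) (hFh : ∀ m < h, F m = 0) (h0 : F h [] = 0) :
    ∃ G, (∀ m < h, G m = 0) ∧ winCobd q G = F := by
  choose u hu using hu
  let F' : ℕ → List ℕ → R := fun m => (↑(u m)⁻¹ : R) • F (h + m)
  have hF' : F = fun m w => if m < h then 0 else gauss q h (m - h) * F' (m - h) w := by
    ext m w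
    split_ifs with hm
    · rw [hFh m hm]
      rfl
    · change _ = _ * ((↑(u (m - h))⁻¹ : R) * F (h + (m - h)) w)
      rw [← hu, Units.mul_inv_cancel_left, Nat.add_sub_cancel' (by omega)]
  obtain ⟨G, hG⟩ := exists_winCobd_eq (q := q) (F := F') (by
    ext m w
    have h1 := winCobd_shift (q := q) (h := h) F' m w
    rw [← hF', hF, ← hu] at h1
    exact ((u m).isUnit.mul_right_eq_zero.mp h1.symm)) (by
    change _ * F (h + 0) [] = 0
    rw [add_zero, h0, mul_zero])
  refine ⟨fun m w => if m < h then 0 else gauss q h (m - h) * G (m - h) w, ?_, ?_⟩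
  · intro m hm
    ext w
    simp [hm]
  · ext m w
    by_cases hm : m < h
    · rw [winCobd_eq_zero, hFh m hm]
      intro p hp
      ext u
      simp [lt_of_le_of_lt hp hm]
    · obtain ⟨m, rfl⟩ := Nat.exists_eq_add_of_le (not_lt.mp hm)
      rw [winCobd_shift, hG]
      conv_rhs => rw [hF']
      simp

/-- The quotient complex of pairs with first block of size less than `h`. -/
theorem exists_winCobd_eq_of_lt (hu : ∀ m, IsUnit (gauss q h m)) (hh : 0 < h)
    {F : ℕ → List ℕ → R} (hF : ∀ m < h, winCobd q F m = 0) (h0 : F 0 [] = 0)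
    (ho : ∑ p ∈ cuts h, gauss q p.1 (p.2 + 1) * F p.1 [p.2] = 0) :
    ∃ G, ∀ m < h, winCobd q G m = F m := by
  let F' : ℕ → List ℕ → R := fun m => if m < h then F m else 0
  have hF' : ∀ m < h, F' m = F m := fun m hm => if_pos hm
  obtain ⟨G', hG', hG⟩ := exists_winCobd_eq_of_le (q := q) (F := winCobd q F') hu
    (winCobd_winCobd F')
    (fun m hm => by rw [← hF m hm, winCobd_congr fun p hp => hF' p (by omega)]) (by
      rw [winCobd, cobd_nil, sub_zero, ← ho]
      refine Finset.sum_congr rfl fun p hp => ?_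
      rw [mem_cuts] at hp
      rw [hF' _ (by omega)])
  obtain ⟨G, hG⟩ := exists_winCobd_eq (q := q) (F := F' - G')
    (by ext1 m; rw [winCobd_sub, hG, sub_self]; rfl)
    (by rw [Pi.sub_apply, Pi.sub_apply, hF' 0 hh, hG' 0 hh, h0]; simp)
  exact ⟨G, fun m hm => by rw [hG, Pi.sub_apply, hF' m hm, hG' m hm, sub_zero]⟩

/-- A cocycle whose first block has size at least `h` is a coboundary. -/
theorem exists_cobd_eq_of_le {k : ℕ} (hu : ∀ m, IsUnit (gauss q (k + 1) m)) {f : List ℕ → R}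
    (hf : cobd q f = 0) (hfk : ∀ m < k, ∀ w, f (m :: w) = 0) (h0 : f [] = 0) (h1 : f [k] = 0) :
    ∃ g, cobd q g = f := by
  obtain ⟨G, hG0, hG⟩ := exists_winCobd_eq_of_le (q := q) (F := unfoldHead f) hu (by
    ext m w
    rcases m with _ | m
    · rw [winCobd_unfoldHead_zero]
      rfl
    · rw [winCobd_unfoldHead_succ, hf]
      rfl) (by
    rintro (_ | m) hm
    · rfl
    · ext w
      exact hfk m (by omega) w) h1
  let g : List ℕ → R := fun w => List.rec 0 (fun c u _ => G (c + 1) u) w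
  have hg : unfoldHead g = G := by
    ext m w
    rcases m with _ | m
    · rw [hG0 0 (by omega)]
      rfl
    · rfl
  refine ⟨g, funext fun w => ?_⟩
  rcases w with _ | ⟨c, w⟩
  · rw [cobd_nil, h0]
  · rw [← winCobd_unfoldHead_succ, hg, hG]
    rfl

end Truncated

section Contraction

variable {R : Type*} [CommRing R] (q : R) (k : ℕ)

/-- The product of the quantum integers up to `k`. -/
def quantumFact : R := ∏ j ∈ Finset.range k, gauss q 1 j

/-- The product of the quantum integers up to `k`, omitting the one attached to `m`. -/
def quantumCofactor (m : ℕ) : R := ∏ j ∈ (Finset.range k).erase m, gauss q 1 j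

/-- The contraction of the first two blocks, of total size `k + 1`. -/
def contract : (List ℕ → R) →ₗ[R] (List ℕ → R) where
  toFun f w := ∑ p ∈ cuts k, gauss q p.1 (p.2 + 1) * quantumCofactor q k p.1 * f (p.1 :: p.2 :: w)
  map_add' f g := by
    ext w
    simp only [Pi.add_apply, mul_add, Finset.sum_add_distrib]
  map_smul' r f := by
    ext w
    simp only [Pi.smul_apply, smul_eq_mul, mul_left_comm _ r, Finset.mul_sum, RingHom.id_apply]

/-- The value at `[k, 0]` after contracting `i` times. -/
def detect : ℕ → (List ℕ → R) →ₗ[R] R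
  | 0 => LinearMap.proj [k, 0]
  | i + 1 => detect i ∘ₗ contract q k

variable {q k}

theorem contract_apply (f : List ℕ → R) (w : List ℕ) : contract q k f w =
    ∑ p ∈ cuts k, gauss q p.1 (p.2 + 1) * quantumCofactor q k p.1 * f (p.1 :: p.2 :: w) := rfl

theorem quantumCofactor_mul {m : ℕ} (hm : m < k) :
    quantumCofactor q k m * gauss q 1 m = quantumFact q k :=
  Finset.prod_erase_mul _ _ (Finset.mem_range.mpr hm)

theorem gauss_mul_contract (f : List ℕ → R) (w : List ℕ) :
    gauss q 1 k * contract q k f w =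
      quantumFact q k * (cobd q f (k :: w) + cobd q (fun u => f (k :: u)) w) := by
  rw [cobd_cons, sub_add_cancel, contract_apply, Finset.mul_sum, Finset.mul_sum]
  refine Finset.sum_congr rfl fun p hp => ?_
  rw [mem_cuts] at hp
  have h1 := gauss_succ_mul q p.1 (p.2 + 1)
  rw [← add_assoc, hp] at h1
  rw [← quantumCofactor_mul (show p.1 < k by omega)]
  linear_combination -quantumCofactor q k p.1 * f (p.1 :: p.2 :: w) * h1

theorem contract_cobd (hr : ∀ x : R, gauss q 1 k * x = 0 → x = 0) (f : List ℕ → R) :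
    contract q k (cobd q f) = cobd q (contract q k f) := by
  have h1 : (fun u => cobd q f (k :: u)) = cobd q f ∘ (k :: ·) := rfl
  have h2 : gauss q 1 k • contract q k f =
      quantumFact q k • ((cobd q f ∘ (k :: ·)) + cobd q (fun u => f (k :: u))) :=
    funext fun w => gauss_mul_contract f w
  ext w
  rw [← sub_eq_zero]
  refine hr _ ?_
  rw [mul_sub, gauss_mul_contract, cobd_cobd, h1]
  have h3 := congrFun (congrArg (cobd q) h2) w
  rw [cobd_smul, cobd_smul, cobd_add, cobd_cobd] at h3
  simp only [Pi.smul_apply, smul_eq_mul, Pi.add_apply, Pi.zero_apply] at h3 ⊢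
  rw [h3]
  ring

theorem contract_eq_zero_of_length {f : List ℕ → R} {ℓ : ℕ} (hf : ∀ w, w.length ≠ ℓ + 2 → f w = 0)
    {w : List ℕ} (hw : w.length ≠ ℓ) : contract q k f w = 0 := by
  rw [contract_apply]
  refine Finset.sum_eq_zero fun p _ => ?_
  rw [hf, mul_zero]
  simpa using hw

theorem detect_congr {f g : List ℕ → R} {i : ℕ}
    (h : ∀ w : List ℕ, w.length = 2 * (i + 1) →
      w.sum + w.length = (i + 1) * (k + 1) + 1 → f w = g w) :
    detect q k i f = detect q k i g := by
  induction i generalizing f g with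
  | zero => exact h [k, 0] (by simp) (by simp)
  | succ i ih =>
    refine ih fun w h1 h2 => ?_
    rw [contract_apply, contract_apply]
    refine Finset.sum_congr rfl fun p hp => ?_
    rw [mem_cuts] at hp
    rw [h]
    · simp only [List.length_cons]
      omega
    · simp only [List.length_cons, List.sum_cons]
      rw [add_mul (i + 1)]
      omega

theorem map_detect {S : Type*} [CommRing S] (φ : R →+* S) (f : List ℕ → R) (i : ℕ) :
    φ (detect q k i f) = detect (φ q) k i (fun u => φ (f u)) := by
  induction i generalizing f with
  | zero => rfl
  | succ i ih =>
    refine (ih _).trans ?_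
    rw [detect, LinearMap.comp_apply]
    congr 1
    ext w
    simp only [contract_apply, map_sum, map_mul, map_gauss, quantumCofactor, map_prod]

theorem dvd_detect_cobd (hr : ∀ x : R, gauss q 1 k * x = 0 → x = 0) {y : R}
    (hy : y ∣ gauss q 1 k) (hu : ∀ m < k, ∀ x, y ∣ x * gauss q 1 m → y ∣ x)
    (g : List ℕ → R) (i : ℕ) : y ∣ detect q k i (cobd q g) := by
  induction i generalizing g with
  | zero =>
    change _ ∣ cobd q g [k, 0]
    rw [cobd_cons]
    refine dvd_sub (Finset.dvd_sum fun p hp => Dvd.dvd.mul_right ?_ _) ?_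
    · rw [mem_cuts] at hp
      have h1 := gauss_succ_mul q p.1 (p.2 + 1)
      rw [← add_assoc, hp] at h1
      exact hu p.1 (by omega) _ (h1 ▸ hy.mul_right _)
    · rw [cobd_cons, cobd_nil]
      simp [cuts]
  | succ i ih =>
    rw [detect, LinearMap.comp_apply, contract_cobd hr]
    exact ih _

/-- Rescaling the heads turns the coboundary on pairs into that on lists. -/
theorem cobd_scale (G : ℕ → List ℕ → R) (m : ℕ) (w : List ℕ) :
    cobd q (fun u => List.rec 0 (fun c v _ => gauss q 1 c * G c v) u) (m :: w) =
      gauss q 1 m * winCobd q G m w := by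
  rw [cobd_cons, winCobd, mul_sub, Finset.mul_sum]
  congr 1
  · refine Finset.sum_congr rfl fun p hp => ?_
    rw [mem_cuts] at hp
    have h1 := gauss_succ_mul q p.1 (p.2 + 1)
    rw [← add_assoc, hp] at h1
    linear_combination G p.1 (p.2 :: w) * h1
  · exact congrFun (cobd_smul (gauss q 1 m) (G m)) w

end Contraction

end BraidComplex

namespace BraidComplex

section Local

variable {R : Type*} [CommRing R] {q : R} {k : ℕ}

theorem isUnit_quantumFact (hm : ∀ m < k, IsUnit (gauss q 1 m)) : IsUnit (quantumFact q k) :=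
  (IsUnit.prod_iff).mpr fun j hj => hm j (Finset.mem_range.mp hj)

/-- A cocycle whose contraction is a coboundary is a coboundary, provided that the obstruction
vanishes. -/
theorem exists_cobd_eq_of_contract (hk : 0 < k) (hu : ∀ m, IsUnit (gauss q (k + 1) m))
    (hm : ∀ m < k, IsUnit (gauss q 1 m)) {f g : List ℕ → R} (hf : cobd q f = 0) (h0 : f [] = 0)
    (h1 : ∀ c, f [c] = 0) (hg : contract q k f = cobd q g)
    (ho : ∑ p ∈ cuts k, gauss q p.1 (p.2 + 2) * quantumCofactor q k p.1 * f [p.1, p.2 + 1] +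
      gauss q 1 k * g [0] = 0) : ∃ g', cobd q g' = f := by
  let F : ℕ → List ℕ → R := fun m =>
    if m < k then quantumCofactor q k m • fun w => f (m :: w) else g
  have hFk : F k = g := if_neg (lt_irrefl k)
  have hFm : ∀ m < k, F m = quantumCofactor q k m • fun w => f (m :: w) := fun m hm => if_pos hm
  have hex := exists_winCobd_eq_of_lt (q := q) (F := F) hu (Nat.succ_pos k) ?_ ?_ ?_
  · obtain ⟨G, hG⟩ := hex
    let g₁ : List ℕ → R := fun u => List.rec 0 (fun c v _ => gauss q 1 c * G c v) u
    obtain ⟨P, hP⟩ := isUnit_quantumFact hm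
    have hg₁ : ∀ m < k, ∀ w, cobd q g₁ (m :: w) = P * f (m :: w) := by
      intro m hm w
      rw [cobd_scale, hG m (by omega), hFm m hm, hP, ← quantumCofactor_mul hm, Pi.smul_apply,
        smul_eq_mul]
      ring
    let g₂ : List ℕ → R := fun u => if u.length ≤ 2 then 0 else (↑P⁻¹ : R) * g₁ u
    have hg₂ : ∀ w : List ℕ, 1 < w.length → cobd q g₂ w = (↑P⁻¹ : R) * cobd q g₁ w := by
      intro w hw
      rw [cobd_congr_length (g := (↑P⁻¹ : R) • g₁), cobd_smul]
      · rfl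
      · intro u hu
        exact if_neg (by omega)
    have hg₂' : ∀ w : List ℕ, w.length ≤ 1 → cobd q g₂ w = 0 := fun w hw =>
      cobd_eq_zero_of_length fun u hu => if_pos (by omega)
    have hex' := exists_cobd_eq_of_le (q := q) (f := f - cobd q g₂) hu ?_ ?_ ?_ ?_
    · obtain ⟨g₃, hg₃⟩ := hex'
      exact ⟨g₃ + g₂, by rw [cobd_add, hg₃, sub_add_cancel]⟩
    · rw [cobd_sub, cobd_cobd, hf, sub_zero]
    · rintro m hm (_ | ⟨c, w⟩)
      · rw [Pi.sub_apply, h1, hg₂' _ (by simp), sub_zero]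
      · rw [Pi.sub_apply, hg₂ _ (by simp), hg₁ m hm, Units.inv_mul_cancel_left, sub_self]
    · rw [Pi.sub_apply, h0, hg₂' _ (by simp), sub_zero]
    · rw [Pi.sub_apply, h1, hg₂' _ (by simp), sub_zero]
  · intro m hmk
    ext w
    rcases (Nat.lt_succ_iff.mp hmk).lt_or_eq with hmk | rfl
    · refine (hm m hmk).mul_right_eq_zero.mp ?_
      rw [winCobd, hFm m hmk, cobd_smul]
      have h2 : cobd q f (m :: w) = 0 := by rw [hf]; rfl
      rw [cobd_cons] at h2
      have h3 : gauss q 1 m * ∑ p ∈ cuts m, gauss q p.1 (p.2 + 1) * F p.1 (p.2 :: w) =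
          quantumFact q k *
            ∑ p ∈ cuts m, gauss q (p.1 + 1) (p.2 + 1) * f (p.1 :: p.2 :: w) := by
        rw [Finset.mul_sum, Finset.mul_sum]
        refine Finset.sum_congr rfl fun p hp => ?_
        rw [mem_cuts] at hp
        have h4 := gauss_succ_mul q p.1 (p.2 + 1)
        rw [← add_assoc, hp] at h4
        rw [hFm p.1 (by omega), ← quantumCofactor_mul (show p.1 < k by omega), Pi.smul_apply,
          smul_eq_mul]
        linear_combination -quantumCofactor q k p.1 * f (p.1 :: p.2 :: w) * h4
      rw [mul_sub, h3, Pi.smul_apply, smul_eq_mul]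
      have h5 := quantumCofactor_mul (q := q) hmk
      linear_combination quantumFact q k * h2 - cobd q (fun w => f (m :: w)) w * h5
    · rw [winCobd, hFk, ← hg, contract_apply, Pi.zero_apply, sub_eq_zero]
      refine Finset.sum_congr rfl fun p hp => ?_
      rw [mem_cuts] at hp
      rw [hFm p.1 (by omega), Pi.smul_apply, smul_eq_mul, mul_assoc]
  · rw [hFm 0 hk, Pi.smul_apply, h1, smul_zero]
  · rw [sum_cuts_succ' k fun a b => gauss q a (b + 1) * F a [b], ← ho, hFk, zero_add,
      gauss_one_right]
    congr 1
    refine Finset.sum_congr rfl fun p hp => ?_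
    rw [mem_cuts] at hp
    rw [hFm p.1 (by omega), Pi.smul_apply, smul_eq_mul, mul_assoc]

theorem exists_cobd_eq_of_dvd (hk : 0 < k) (hr : ∀ x : R, gauss q 1 k * x = 0 → x = 0)
    (hu : ∀ m, IsUnit (gauss q (k + 1) m)) (hm : ∀ m < k, IsUnit (gauss q 1 m)) {i : ℕ}
    {f : List ℕ → R} (hf : cobd q f = 0) (hl : ∀ w, w.length ≠ 2 * (i + 1) → f w = 0)
    (hd : gauss q 1 k ∣ detect q k i f) : ∃ g, cobd q g = f := by
  induction i generalizing f with
  | zero =>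
    obtain ⟨y, hy⟩ := hd
    change f [k, 0] = _ at hy
    let g : List ℕ → R := fun w => if w = [0] then quantumFact q k * y else 0
    have hg : cobd q g = 0 := by
      ext w
      rcases w with _ | ⟨c, w⟩
      · exact cobd_nil _
      · refine cobd_eq_zero_of_length fun u hu => if_neg ?_
        rintro rfl
        simp at hu
    refine exists_cobd_eq_of_contract (g := g) hk hu hm hf (hl _ (by simp)) (fun c => hl _ (by simp))
      ?_ ?_
    · rw [hg]
      ext w
      rcases w with _ | ⟨c, w⟩
      · refine hr _ ?_
        rw [gauss_mul_contract, hf, cobd_nil]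
        simp
      · exact contract_eq_zero_of_length (ℓ := 0) hl (by simp)
    · have h1 : cobd q f [k + 1] = 0 := by rw [hf]; rfl
      rw [cobd_cons, cobd_nil, sub_zero,
        sum_cuts_succ' k fun a b => gauss q (a + 1) (b + 1) * f [a, b], zero_add, hy] at h1
      have h2 : gauss q (k + 1) 1 * ∑ p ∈ cuts k,
            gauss q p.1 (p.2 + 2) * quantumCofactor q k p.1 * f [p.1, p.2 + 1] =
          quantumFact q k * ∑ p ∈ cuts k, gauss q (p.1 + 1) (p.2 + 1 + 1) * f [p.1, p.2 + 1] := by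
        rw [Finset.mul_sum, Finset.mul_sum]
        refine Finset.sum_congr rfl fun p hp => ?_
        rw [mem_cuts] at hp
        have h4 := gauss_succ_mul q p.1 (p.2 + 2)
        rw [show p.1 + (p.2 + 2) = k + 1 by omega, ← gauss_one_right q (k + 1)] at h4
        rw [← quantumCofactor_mul (show p.1 < k by omega)]
        linear_combination -quantumCofactor q k p.1 * f [p.1, p.2 + 1] * h4
      refine (hu 1).mul_right_eq_zero.mp ?_
      have h3 : g [0] = quantumFact q k * y := if_pos rfl
      rw [mul_add, h2, h3]
      linear_combination quantumFact q k * h1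
  | succ i ih =>
    obtain ⟨g, hg⟩ := ih (f := contract q k f) (by rw [← contract_cobd hr, hf, map_zero])
      (fun w hw => contract_eq_zero_of_length hl hw) hd
    let g' : List ℕ → R := fun w => if w.length = 1 then 0 else g w
    refine exists_cobd_eq_of_contract (g := g') hk hu hm hf (hl _ (by simp))
      (fun c => hl _ (by simp; omega)) ?_ ?_
    · rw [← hg]
      ext w
      rcases w with _ | ⟨c, w⟩
      · rw [cobd_nil, cobd_nil]
      · exact cobd_congr_length fun u hu => (if_neg (by simp [hu])).symm
    · have h3 : g' [0] = 0 := if_pos rfl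
      rw [h3, mul_zero, add_zero]
      refine Finset.sum_eq_zero fun p _ => ?_
      rw [hl _ (by simp), mul_zero]

theorem exists_cocycle_detect (hk : 0 < k) (hr : ∀ x : R, gauss q 1 k * x = 0 → x = 0)
    (hu : ∀ m, IsUnit (gauss q (k + 1) m)) (hm : ∀ m < k, IsUnit (gauss q 1 m)) (i : ℕ) :
    ∃ f : List ℕ → R, cobd q f = 0 ∧ (∀ w, w.length ≠ 2 * (i + 1) → f w = 0) ∧
      ∃ u : R, IsUnit u ∧ gauss q 1 k ∣ detect q k i f - u := by
  induction i with
  | zero =>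
    let f : List ℕ → R := Pi.single [k, 0] 1 - Pi.single [0, k] 1
    have hl : ∀ w : List ℕ, w.length ≠ 2 → f w = 0 := by
      intro w hw
      have h1 : w ≠ [k, 0] := by rintro rfl; simp at hw
      have h2 : w ≠ [0, k] := by rintro rfl; simp at hw
      simp [f, h1, h2]
    refine ⟨f, ?_, by simpa using hl, 1, isUnit_one, ?_⟩
    · ext w
      rcases w with _ | ⟨c, _ | ⟨d, w⟩⟩
      · exact cobd_nil _
      · rw [cobd_cons, cobd_nil, sub_zero]
        have h1 : ∀ x y : ℕ, (∑ p ∈ cuts c, gauss q (p.1 + 1) (p.2 + 1) *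
            (Pi.single [x, y] 1 : List ℕ → R) [p.1, p.2]) =
            if x + y + 1 = c then gauss q (x + 1) (y + 1) else 0 := by
          intro x y
          split_ifs with hc
          · rw [Finset.sum_eq_single_of_mem (x, y) (mem_cuts.mpr hc), Pi.single_eq_same, mul_one]
            rintro ⟨a, b⟩ _ hne
            rw [Pi.single_eq_of_ne, mul_zero]
            intro h
            simp only [List.cons.injEq, and_true] at h
            exact hne (Prod.ext h.1 h.2)
          · refine Finset.sum_eq_zero fun p hp => ?_
            rw [mem_cuts] at hp
            rw [Pi.single_eq_of_ne, mul_zero]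
            intro h
            simp only [List.cons.injEq, and_true] at h
            omega
        simp only [f, Pi.sub_apply, mul_sub, Finset.sum_sub_distrib, h1, zero_add, add_zero,
          Pi.zero_apply, gauss_one_right, sub_self]
      · exact cobd_eq_zero_of_length fun u hu => hl u (by simp [hu])
    · have h2 : ([k, 0] : List ℕ) ≠ [0, k] := by simp; omega
      have h3 : detect q k 0 f = f [k, 0] := rfl
      simp [h3, f, h2]
  | succ i ih =>
    obtain ⟨f', hf', hl, u, hu', hdvd⟩ := ih
    let F : ℕ → List ℕ → R := fun m => if m = k then f' else 0
    have hFk : F k = f' := if_pos rfl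
    have hFm : ∀ m < k, F m = 0 := fun m hm => if_neg hm.ne
    have hex := exists_winCobd_eq_of_lt (q := q) (F := F) hu (Nat.succ_pos k) ?_ ?_ ?_
    rotate_left
    · intro m hmk
      rcases (Nat.lt_succ_iff.mp hmk).lt_or_eq with hmk | rfl
      · exact winCobd_eq_zero fun p hp => hFm p (by omega)
      · ext w
        rw [winCobd, hFk, hf', Finset.sum_eq_zero]
        · simp
        · intro p hp
          rw [mem_cuts] at hp
          rw [hFm p.1 (by omega), Pi.zero_apply, mul_zero]
    · rw [hFm 0 hk, Pi.zero_apply]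
    · refine Finset.sum_eq_zero fun p hp => ?_
      have h1 : F p.1 [p.2] = 0 := by
        by_cases hp : p.1 = k
        · rw [hp, hFk, hl _ (by simp; omega)]
        · exact congrFun (if_neg hp) _
      rw [h1, mul_zero]
    obtain ⟨G₀, hG₀⟩ := hex
    let G : ℕ → List ℕ → R := fun m w => if w.length ≤ 2 then 0 else G₀ m w
    have hG : ∀ m < k + 1, winCobd q G m = F m := by
      intro m hm
      ext w
      by_cases hw : w.length ≤ 1
      · have h1 : F m w = 0 := by
          by_cases hp : m = k
          · rw [hp, hFk, hl _ (by omega)]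
          · exact congrFun (if_neg hp) _
        rw [h1, winCobd, cobd_eq_zero_of_length fun u hu => if_pos (by omega), sub_zero]
        refine Finset.sum_eq_zero fun p _ => ?_
        have h2 : G p.1 (p.2 :: w) = 0 := if_pos (by simp; omega)
        rw [h2, mul_zero]
      · rw [← hG₀ m hm, winCobd, winCobd,
          cobd_congr_length (g := G₀ m) fun u hu => if_neg (by omega)]
        congr 1
        refine Finset.sum_congr rfl fun p _ => ?_
        have h2 : G p.1 (p.2 :: w) = G₀ p.1 (p.2 :: w) := if_neg (by simp; omega)
        rw [h2]
    let g₁ : List ℕ → R := fun u => List.rec 0 (fun c v _ => gauss q 1 c * G c v) u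
    have hex' := exists_winCobd_eq_of_lt (q := q) (F := unfoldHead g₁) hu (Nat.succ_pos k)
      ?_ ?_ ?_
    rotate_left
    · rintro (_ | m) hmk
      · exact winCobd_unfoldHead_zero _
      · ext w
        rw [winCobd_unfoldHead_succ, cobd_scale, hG m (by omega), hFm m (by omega)]
        simp
    · rfl
    · refine Finset.sum_eq_zero fun p _ => ?_
      have h1 : unfoldHead g₁ p.1 [p.2] = 0 := by
        rcases p.1 with _ | m
        · rfl
        · have h2 : G m [p.2] = 0 := if_pos (by simp)
          change gauss q 1 m * G m [p.2] = 0
          rw [h2, mul_zero]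
      rw [h1, mul_zero]
    obtain ⟨H, hH⟩ := hex'
    let h₂ : List ℕ → R := fun u => List.rec 0 (fun c v _ => H (c + 1) v) u
    have hH0 : cobd q (H 0) = 0 := by
      ext w
      have h1 := congrFun (hH 0 (by omega)) w
      rw [winCobd_zero] at h1
      exact neg_eq_zero.mp h1
    have hHm : ∀ m < k, ∀ w, H 0 (m :: w) = g₁ (m :: w) - cobd q h₂ (m :: w) := by
      intro m hm w
      have h1 := congrFun (hH (m + 1) (by omega)) w
      rw [winCobd_succ] at h1
      rw [cobd_cons]
      change _ = g₁ (m :: w) at h1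
      change _ = _ - (∑ p ∈ cuts m, gauss q (p.1 + 1) (p.2 + 1) * H (p.1 + 1) (p.2 :: w) -
        cobd q (H (m + 1)) w)
      linear_combination h1
    have hc1 : contract q k g₁ = quantumFact q k • (f' + cobd q (G k)) := by
      ext w
      rw [← sub_eq_zero]
      refine hr _ ?_
      have h2 : cobd q (fun u => g₁ (k :: u)) w = gauss q 1 k * cobd q (G k) w :=
        congrFun (cobd_smul (gauss q 1 k) (G k)) w
      rw [mul_sub, gauss_mul_contract, cobd_scale, hG k (by omega), hFk, h2]
      simp only [Pi.smul_apply, Pi.add_apply, smul_eq_mul]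
      ring
    have hc2 : contract q k (H 0) =
        quantumFact q k • f' + cobd q (quantumFact q k • G k - contract q k h₂) := by
      have h1 : contract q k (H 0) = contract q k (g₁ - cobd q h₂) := by
        ext w
        rw [contract_apply, contract_apply]
        refine Finset.sum_congr rfl fun p hp => ?_
        rw [mem_cuts] at hp
        rw [hHm p.1 (by omega)]
        rfl
      rw [h1, map_sub, hc1, contract_cobd hr, cobd_sub, cobd_smul, smul_add, add_sub_assoc]
    refine ⟨fun w => if w.length = 2 * (i + 1 + 1) then H 0 w else 0, ?_, fun w hw => if_neg hw,
      quantumFact q k * u, (isUnit_quantumFact hm).mul hu', ?_⟩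
    · ext w
      by_cases hw : w.length + 1 = 2 * (i + 1 + 1)
      · rw [cobd_congr_length (g := H 0) fun v hv => if_pos (by omega), hH0]
      · exact cobd_eq_zero_of_length fun v hv => if_neg (by omega)
    · rw [detect_congr (g := H 0) fun w hw _ => if_pos hw, detect, LinearMap.comp_apply, hc2,
        map_add, map_smul, smul_eq_mul, add_sub_right_comm, ← mul_sub]
      refine dvd_add (hdvd.mul_left _) (dvd_detect_cobd hr dvd_rfl (fun m hmk x hx => ?_) _ _)
      exact (hm m hmk).dvd_mul_right.mp hx

end Local

end BraidComplex

namespace BraidComplex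

section QuantumInt

variable {R : Type*} [CommRing R] (q : R)

theorem gauss_one_mul_sub_one (m : ℕ) : gauss q 1 m * (q - 1) = q ^ (m + 1) - 1 := by
  induction m with
  | zero => rw [gauss_zero_right, one_mul, zero_add, pow_one]
  | succ m ih => rw [gauss_one_succ, add_mul, ih]; ring

theorem gauss_one_add (m k : ℕ) :
    gauss q 1 (m + k + 1) = gauss q 1 m + q ^ (m + 1) * gauss q 1 k := by
  induction k with
  | zero => rw [gauss_zero_right, mul_one, add_zero, gauss_one_succ]
  | succ k ih =>
    rw [gauss_one_succ q k, ← add_assoc, gauss_one_succ, ih]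
    ring

theorem gauss_one_mul_gauss_pow {k m j : ℕ} (h : m + 1 = (k + 1) * (j + 1)) :
    gauss q 1 k * gauss (q ^ (k + 1)) 1 j = gauss q 1 m := by
  induction j generalizing m with
  | zero =>
    obtain rfl : m = k := by omega
    rw [gauss_zero_right, mul_one]
  | succ j ih =>
    rw [mul_add (k + 1) (j + 1), mul_one] at h
    have h0 : 0 < (k + 1) * (j + 1) := Nat.mul_pos k.succ_pos j.succ_pos
    have h1 : m - (k + 1) + 1 = (k + 1) * (j + 1) := by omega
    have h2 : m = m - (k + 1) + k + 1 := by omega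
    rw [h2, gauss_one_add, h1, ← ih h1, gauss_one_succ, pow_mul]
    ring

theorem gauss_one_one (m : ℕ) : gauss (1 : R) 1 m = (m : R) + 1 := by
  induction m with
  | zero => rw [gauss_zero_right, Nat.cast_zero, zero_add]
  | succ m ih => rw [gauss_one_succ, ih, one_pow, Nat.cast_succ]

end QuantumInt

section Prime

variable {R : Type*} [CommRing R] {q : R} {p : Ideal R}

theorem dvd_of_gauss_mem {h : ℕ} (hq : IsPrimitiveRoot (Ideal.Quotient.mk p q) h) (m : ℕ)
    (hm : gauss q 1 m ∈ p) : h ∣ m + 1 ∧ q ^ h - 1 ∈ p := by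
  constructor
  · rw [← hq.pow_eq_one_iff_dvd, ← sub_eq_zero, ← map_pow, ← map_one (Ideal.Quotient.mk p),
      ← map_sub, Ideal.Quotient.eq_zero_iff_mem, ← gauss_one_mul_sub_one]
    exact p.mul_mem_right _ hm
  · rw [← Ideal.Quotient.eq_zero_iff_mem, map_sub, map_pow, hq.pow_eq_one, map_one, sub_self]

variable [CharZero (R ⧸ p)]

theorem exists_isPrimitiveRoot_of_gauss_mem {m : ℕ} (hm : gauss q 1 m ∈ p) :
    ∃ h, 2 ≤ h ∧ IsPrimitiveRoot (Ideal.Quotient.mk p q) h := by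
  have h1 : Ideal.Quotient.mk p q ^ (m + 1) = 1 := by
    rw [← sub_eq_zero, ← map_pow, ← map_one (Ideal.Quotient.mk p),
      ← map_sub, Ideal.Quotient.eq_zero_iff_mem, ← gauss_one_mul_sub_one]
    exact p.mul_mem_right _ hm
  refine ⟨orderOf (Ideal.Quotient.mk p q), ?_, IsPrimitiveRoot.orderOf _⟩
  have h2 : 0 < orderOf (Ideal.Quotient.mk p q) := Nat.pos_of_dvd_of_pos (orderOf_dvd_of_pow_eq_one h1)
    (Nat.succ_pos m)
  by_contra h3
  have h4 : Ideal.Quotient.mk p q = 1 := orderOf_eq_one_iff.mp (by omega)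
  rw [← Ideal.Quotient.eq_zero_iff_mem, map_gauss, h4, gauss_one_one] at hm
  exact Nat.cast_add_one_ne_zero _ hm

variable [IsDomain R] [p.IsPrime] {k : ℕ}

theorem gauss_notMem (h0 : gauss q 1 k ≠ 0)
    (hA : ∀ m, gauss q 1 m ∈ p → k + 1 ∣ m + 1 ∧ q ^ (k + 1) - 1 ∈ p) (m : ℕ) :
    gauss q (k + 1) m ∉ p := by
  have hp : p.IsPrime := inferInstance
  induction m with
  | zero =>
    rw [gauss_zero_right]
    exact (Ideal.ne_top_iff_one p).mp hp.ne_top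
  | succ m ih =>
    have h1 : gauss q 1 (k + 1 + m) * gauss q (k + 1) m = gauss q (k + 1) (m + 1) * gauss q 1 m := by
      rw [← gauss_one_right, ← gauss_one_right q m, gauss_assoc]
    intro h2
    have h3 : gauss q 1 (k + 1 + m) ∈ p :=
      (hp.mem_or_mem (h1 ▸ p.mul_mem_right _ h2)).resolve_right ih
    obtain ⟨⟨j, hj⟩, hq⟩ := hA _ h3
    rcases j with _ | _ | j
    · omega
    · omega
    have h4 : m + 1 = (k + 1) * (j + 1) := by
      rw [mul_add (k + 1) (j + 1)] at hj
      omega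
    rw [← gauss_one_mul_gauss_pow q h4, ← gauss_one_mul_gauss_pow q hj, mul_assoc,
      mul_left_comm _ (gauss q 1 k)] at h1
    have h5 : gauss (q ^ (k + 1)) 1 (j + 1) ∈ p :=
      (hp.mem_or_mem ((mul_left_cancel₀ h0 h1) ▸ p.mul_mem_right _ h2)).resolve_right ih
    rw [← Ideal.Quotient.eq_zero_iff_mem, map_gauss] at h5
    rw [← Ideal.Quotient.eq_zero_iff_mem, map_sub, sub_eq_zero, map_one] at hq
    rw [hq, gauss_one_one] at h5
    exact Nat.cast_add_one_ne_zero _ h5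

end Prime

section Denominators

theorem finite_lists (ℓ j : ℕ) : {w : List ℕ | w.sum = j ∧ w.length = ℓ}.Finite := by
  induction ℓ generalizing j with
  | zero =>
    refine (Set.finite_singleton []).subset ?_
    rintro w ⟨_, hw⟩
    exact List.length_eq_zero_iff.mp hw
  | succ ℓ ih =>
    refine ((Set.finite_le_nat j).biUnion fun c _ => (ih (j - c)).image (c :: ·)).subset ?_
    rintro (_ | ⟨c, w⟩) ⟨h1, h2⟩
    · simp at h2
    · rw [List.sum_cons] at h1
      rw [List.length_cons] at h2
      refine Set.mem_biUnion (show c ∈ {i | i ≤ j} by simp; omega) ⟨w, ⟨?_, ?_⟩, rfl⟩ <;> omega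

variable {R : Type*} [CommRing R] {O : Type*} [CommRing O] [Algebra R O]

theorem exists_clear_denominators (M : Submonoid R) [IsLocalization M O] {B : Set (List ℕ)}
    (hB : B.Finite) (g : List ℕ → O) :
    ∃ s ∈ M, ∃ g' : List ℕ → R, (∀ w ∈ B, algebraMap R O (g' w) = algebraMap R O s * g w) ∧
      ∀ w ∉ B, g' w = 0 := by
  obtain ⟨b, hb⟩ := IsLocalization.exist_integer_multiples M hB.toFinset g
  have h1 : ∀ w, ∃ x : R, (w ∈ B → algebraMap R O x = algebraMap R O b * g w) ∧ (w ∉ B → x = 0) := by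
    intro w
    by_cases hw : w ∈ B
    · obtain ⟨x, hx⟩ := hb w (hB.mem_toFinset.mpr hw)
      exact ⟨x, fun _ => by rw [hx, Algebra.smul_def], fun h => absurd hw h⟩
    · exact ⟨0, fun h => absurd h hw, fun _ => rfl⟩
  choose g' hg' using h1
  exact ⟨b, b.2, g', fun w => (hg' w).1, fun w => (hg' w).2⟩

variable {q : R}

theorem exists_cobd_eq_smul (M : Submonoid R) [IsLocalization M O]
    (hinj : Function.Injective (algebraMap R O)) {ℓ j : ℕ} {f : List ℕ → R}
    (hf : ∀ w : List ℕ, ¬ (w.sum = j ∧ w.length = ℓ) → f w = 0) {g : List ℕ → O}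
    (hg : cobd (algebraMap R O q) g = fun w => algebraMap R O (f w)) :
    ∃ s ∈ M, ∃ g', cobd q g' = s • f := by
  obtain ⟨s, hs, g', h1, h2⟩ := exists_clear_denominators (O := O) M
    (B := {w : List ℕ | w.sum + 1 = j ∧ w.length = ℓ + 1})
    ((finite_lists (ℓ + 1) (j - 1)).subset fun w hw => ⟨by have := hw.1; omega, hw.2⟩) g
  refine ⟨s, hs, g', funext fun w => ?_⟩
  by_cases hw : w.sum = j ∧ w.length = ℓ
  · refine hinj ?_
    rw [map_cobd, cobd_congr (g := algebraMap R O s • g), cobd_smul, hg]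
    · simp
    · intro u h3 h4
      exact h1 u ⟨by omega, by omega⟩
  · rw [Pi.smul_apply, hf w hw, smul_zero, cobd_congr (g := 0), cobd_zero]
    · rfl
    · intro u h3 h4
      refine h2 u ?_
      rintro ⟨h5, h6⟩
      exact hw ⟨by omega, by omega⟩

/-- A cocycle which is locally a coboundary is a coboundary. -/
theorem exists_cobd_eq_of_forall_maximal {f : List ℕ → R}
    (h : ∀ p : Ideal R, p.IsMaximal → ∃ s ∉ p, ∃ g, cobd q g = s • f) : ∃ g, cobd q g = f := by
  let J : Ideal R := (LinearMap.range (cobdHom q)).comap (LinearMap.toSpanSingleton R _ f)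
  have hJ : J = ⊤ := by
    by_contra hJ
    obtain ⟨p, hp, hJp⟩ := Ideal.exists_le_maximal J hJ
    obtain ⟨s, hs, g, hg⟩ := h p hp
    exact hs (hJp ⟨g, hg⟩)
  obtain ⟨g, hg⟩ : (1 : R) ∈ J := hJ ▸ Submodule.mem_top
  exact ⟨g, by simpa [cobdHom_apply] using hg⟩

end Denominators

section AtPrime

variable {R : Type*} [CommRing R] {q : R} {k : ℕ} {p : Ideal R} [p.IsPrime]

theorem isUnit_atPrime {x : R} (hx : x ∉ p) :
    IsUnit (algebraMap R (Localization.AtPrime p) x) :=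
  (IsLocalization.AtPrime.isUnit_to_map_iff _ p x).mpr hx

variable [IsDomain R]

theorem algebraMap_atPrime_injective :
    Function.Injective (algebraMap R (Localization.AtPrime p)) :=
  IsLocalization.injective _ p.primeCompl_le_nonZeroDivisors

variable [CharZero (R ⧸ p)]

/-- The conditions that make the local computation work. -/
theorem localHypotheses (h0 : gauss q 1 k ≠ 0)
    (hA : ∀ m, gauss q 1 m ∈ p → k + 1 ∣ m + 1 ∧ q ^ (k + 1) - 1 ∈ p) :
    (∀ x, gauss (algebraMap R (Localization.AtPrime p) q) 1 k * x = 0 → x = 0) ∧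
    (∀ m, IsUnit (gauss (algebraMap R (Localization.AtPrime p) q) (k + 1) m)) ∧
    ∀ m < k, IsUnit (gauss (algebraMap R (Localization.AtPrime p) q) 1 m) := by
  have := IsLocalization.isDomain_localization p.primeCompl_le_nonZeroDivisors
  refine ⟨fun x hx => ?_, fun m => ?_, fun m hm => ?_⟩
  · rw [← map_gauss] at hx
    refine (mul_eq_zero.mp hx).resolve_left fun h => h0 ?_
    exact algebraMap_atPrime_injective (by rw [h, map_zero])
  · rw [← map_gauss]
    exact isUnit_atPrime (gauss_notMem h0 hA m)
  · rw [← map_gauss]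
    refine isUnit_atPrime fun h => ?_
    have := Nat.le_of_dvd (Nat.succ_pos m) (hA m h).1
    omega

theorem exists_smul_eq_cobd_atPrime (hk : 0 < k) (h0 : gauss q 1 k ≠ 0)
    (hA : ∀ m, gauss q 1 m ∈ p → k + 1 ∣ m + 1 ∧ q ^ (k + 1) - 1 ∈ p) {i j : ℕ} {f : List ℕ → R}
    (hf : ∀ w : List ℕ, ¬ (w.sum = j ∧ w.length = 2 * (i + 1)) → f w = 0) (hc : cobd q f = 0)
    {s : R} (hs : s ∉ p) (hd : gauss q 1 k ∣ s * detect q k i f) :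
    ∃ s ∉ p, ∃ g, cobd q g = s • f := by
  obtain ⟨hr, hu, hm⟩ := localHypotheses h0 hA
  obtain ⟨g, hg⟩ := exists_cobd_eq_of_dvd (i := i) (f := fun w => algebraMap R _ (f w)) hk hr hu hm
    (by ext w; rw [← map_cobd, hc]; simp) (fun w hw => by rw [hf w fun h => hw h.2, map_zero]) (by
      rw [← map_detect, ← map_gauss, ← (isUnit_atPrime hs).dvd_mul_left, ← map_mul]
      exact map_dvd _ hd)
  exact exists_cobd_eq_smul p.primeCompl algebraMap_atPrime_injective hf hg

theorem exists_cocycle_detect_notMem (hk : 0 < k) (h0 : gauss q 1 k ≠ 0)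
    (hA : ∀ m, gauss q 1 m ∈ p → k + 1 ∣ m + 1 ∧ q ^ (k + 1) - 1 ∈ p) (hp : gauss q 1 k ∈ p)
    {i j : ℕ} (hj : j + 2 * (i + 1) = (i + 1) * (k + 1) + 1) :
    ∃ f : List ℕ → R, cobd q f = 0 ∧
      (∀ w : List ℕ, ¬ (w.sum = j ∧ w.length = 2 * (i + 1)) → f w = 0) ∧ detect q k i f ∉ p := by
  obtain ⟨hr, hu, hm⟩ := localHypotheses h0 hA
  obtain ⟨f, hf, hl, u, hu', hd⟩ := exists_cocycle_detect hk hr hu hm i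
  obtain ⟨s, hs, f', h1, h2⟩ := exists_clear_denominators (O := Localization.AtPrime p) p.primeCompl
    (finite_lists (2 * (i + 1)) j) f
  refine ⟨f', funext fun w => ?_, h2, fun hmem => ?_⟩
  · by_cases hw : w.sum = j + 1 ∧ w.length + 1 = 2 * (i + 1)
    · refine algebraMap_atPrime_injective (p := p) ?_
      rw [map_cobd, cobd_congr (g := algebraMap R (Localization.AtPrime p) s • f), cobd_smul, hf]
      · simp
      · intro v h3 h4
        exact h1 v ⟨by omega, by omega⟩
    · rw [cobd_congr (g := 0), cobd_zero]
      intro v h3 h4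
      refine h2 v ?_
      rintro ⟨h5, h6⟩
      exact hw ⟨by omega, by omega⟩
  · have hmax : ∀ x ∈ p, algebraMap R (Localization.AtPrime p) x ∈
        IsLocalRing.maximalIdeal (Localization.AtPrime p) := fun x hx =>
      (IsLocalization.AtPrime.to_map_mem_maximal_iff _ p x).mpr hx
    have h3 := hmax _ hmem
    rw [map_detect, detect_congr (g := algebraMap R (Localization.AtPrime p) s • f), map_smul,
      smul_eq_mul] at h3
    · have h4 := (IsLocalRing.maximalIdeal.isMaximal _).isPrime.mem_or_mem h3
      have h5 := h4.resolve_left fun h => h (isUnit_atPrime hs)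
      have h6 := Ideal.mem_of_dvd _ hd (map_gauss q (algebraMap R (Localization.AtPrime p)) 1 k ▸ hmax _ hp)
      have h7 := sub_mem h5 h6
      rw [sub_sub_cancel] at h7
      exact h7 hu'
    · intro w h4 h5
      exact h1 w ⟨by omega, h4⟩

end AtPrime

end BraidComplex

namespace BraidComplex

section Laurent

open LaurentPolynomial

theorem charZero_quotient (p : Ideal ℚ[T;T⁻¹]) [p.IsPrime] : CharZero (ℚ[T;T⁻¹] ⧸ p) :=
  algebraRat.charZero _

theorem mk_toLaurent (p : Ideal ℚ[T;T⁻¹]) (P : ℚ[X]) :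
    Ideal.Quotient.mk p (toLaurent P) = aeval (Ideal.Quotient.mk p (T 1)) P := by
  have h : (Ideal.Quotient.mkₐ ℚ p).comp toLaurentAlg = aeval (Ideal.Quotient.mk p (T 1)) := by
    ext
    simp
  rw [← h]
  rfl

theorem cyclotomic_mem_iff (p : Ideal ℚ[T;T⁻¹]) [p.IsPrime] {h : ℕ} (hh : 0 < h) :
    toLaurent (cyclotomic h ℚ) ∈ p ↔ IsPrimitiveRoot (Ideal.Quotient.mk p (T 1)) h := by
  have := charZero_quotient p
  have : NeZero (h : ℚ[T;T⁻¹] ⧸ p) := ⟨Nat.cast_ne_zero.mpr hh.ne'⟩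
  rw [← isRoot_cyclotomic_iff, ← Ideal.Quotient.eq_zero_iff_mem, mk_toLaurent, aeval_def,
    eval₂_eq_eval_map, map_cyclotomic, IsRoot.def]

theorem gauss_T_one (k : ℕ) :
    gauss (T 1 : ℚ[T;T⁻¹]) 1 k = toLaurent (∑ j ∈ Finset.range (k + 1), (X : ℚ[X]) ^ j) := by
  induction k with
  | zero => simp [gauss_zero_right]
  | succ k ih => rw [gauss_one_succ, ih, Finset.sum_range_succ _ (k + 1), map_add, map_pow, toLaurent_X]

theorem gauss_T_one_ne_zero (k : ℕ) : gauss (T 1 : ℚ[T;T⁻¹]) 1 k ≠ 0 := by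
  rw [gauss_T_one, Ne, toLaurent_eq_zero]
  intro h
  have h1 := congrArg (eval 1) h
  rw [eval_finsetSum] at h1
  simp only [eval_pow, eval_X, one_pow, Finset.sum_const, Finset.card_range, nsmul_eq_mul, mul_one,
    eval_zero] at h1
  exact Nat.cast_ne_zero.mpr k.succ_ne_zero h1

/-- The factor of the quantum integer `[h]` complementary to `φ_h`. -/
noncomputable def cyclotomicCofactor (h : ℕ) : ℚ[T;T⁻¹] :=
  toLaurent (∏ d ∈ (h.divisors.erase 1).erase h, cyclotomic d ℚ)

theorem cyclotomic_mul_cofactor {h k : ℕ} (hh : 2 ≤ h) (hk : k + 1 = h) :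
    toLaurent (cyclotomic h ℚ) * cyclotomicCofactor h = gauss (T 1) 1 k := by
  rw [gauss_T_one, hk, cyclotomicCofactor, ← map_mul, Finset.mul_prod_erase _ (cyclotomic · ℚ),
    prod_cyclotomic_eq_geom_sum (by omega)]
  simp only [Finset.mem_erase, Nat.mem_divisors, dvd_refl, true_and]
  omega

theorem cyclotomicCofactor_notMem {p : Ideal ℚ[T;T⁻¹]} [hp : p.IsPrime] {h : ℕ}
    (hq : IsPrimitiveRoot (Ideal.Quotient.mk p (T 1)) h) : cyclotomicCofactor h ∉ p := by
  rw [cyclotomicCofactor, map_prod, hp.prod_mem_iff]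
  rintro ⟨d, hd, hmem⟩
  simp only [Finset.mem_erase, Nat.mem_divisors] at hd
  refine hd.1 (IsPrimitiveRoot.unique ((cyclotomic_mem_iff p ?_).mp hmem) hq)
  exact Nat.pos_of_dvd_of_pos hd.2.2.1 (Nat.pos_of_ne_zero hd.2.2.2)

theorem detect_eq_zero {R : Type*} [CommRing R] {q : R} {f : List ℕ → R} {i j k : ℕ}
    (hf : ∀ w : List ℕ, ¬ (w.sum = j ∧ w.length = 2 * (i + 1)) → f w = 0)
    (h : j + 2 * (i + 1) ≠ (i + 1) * (k + 1) + 1) : detect q k i f = 0 := by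
  rw [detect_congr (g := 0), map_zero]
  intro w h1 h2
  refine hf w fun h3 => h ?_
  rw [← h2, h3.1, h3.2]

theorem exists_cobd_eq_of_cyclotomic_dvd {i j : ℕ} {f : List ℕ → ℚ[T;T⁻¹]}
    (hf : ∀ w : List ℕ, ¬ (w.sum = j ∧ w.length = 2 * (i + 1)) → f w = 0)
    (hc : cobd (T 1) f = 0)
    (hd : ∀ k, 0 < k → j + 2 * (i + 1) = (i + 1) * (k + 1) + 1 →
      toLaurent (cyclotomic (k + 1) ℚ) ∣ detect (T 1) k i f) :
    ∃ g, cobd (T 1) g = f := by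
  refine exists_cobd_eq_of_forall_maximal fun p hmax => ?_
  have hp := hmax.isPrime
  have := charZero_quotient p
  by_cases hprim : ∃ h, 2 ≤ h ∧ IsPrimitiveRoot (Ideal.Quotient.mk p (T 1)) h
  · obtain ⟨h, hh, hq⟩ := hprim
    obtain ⟨k, rfl⟩ : ∃ k, h = k + 1 := ⟨h - 1, by omega⟩
    refine exists_smul_eq_cobd_atPrime (k := k) (by omega) (gauss_T_one_ne_zero k)
      (dvd_of_gauss_mem hq) hf hc (cyclotomicCofactor_notMem hq) ?_
    by_cases hj : j + 2 * (i + 1) = (i + 1) * (k + 1) + 1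
    · rw [← cyclotomic_mul_cofactor hh rfl, mul_comm]
      exact mul_dvd_mul_left _ (hd k (by omega) hj)
    · rw [detect_eq_zero hf hj, mul_zero]
      exact dvd_zero _
  · have hmem : ∀ m, gauss (T 1) 1 m ∉ p := fun m hm =>
      hprim (exists_isPrimitiveRoot_of_gauss_mem hm)
    refine exists_smul_eq_cobd_atPrime (k := j + 2 * (i + 1) + 1) (by omega)
      (gauss_T_one_ne_zero _) (fun m hm => absurd hm (hmem m)) hf hc (s := 1)
      ((Ideal.ne_top_iff_one p).mp hp.ne_top) ?_
    rw [detect_eq_zero hf, mul_zero]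
    · exact dvd_zero _
    · have := Nat.le_mul_of_pos_left (j + 2 * (i + 1) + 1 + 1) (show 0 < i + 1 by omega)
      omega

theorem exists_mul_sub_one_mem {h : ℕ} (hh : 0 < h) {x : ℚ[T;T⁻¹]}
    (hx : x ∉ Ideal.span {toLaurent (cyclotomic h ℚ)}) :
    ∃ y, x * y - 1 ∈ Ideal.span {toLaurent (cyclotomic h ℚ)} := by
  obtain ⟨m, P, hP⟩ := x.exists_T_pow
  have hcop : IsCoprime (cyclotomic h ℚ) P := by
    refine ((cyclotomic.irreducible_rat hh).coprime_iff_not_dvd).mpr fun hdvd => hx ?_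
    rw [Ideal.mem_span_singleton]
    have h1 := map_dvd toLaurent hdvd
    rwa [hP, (isUnit_T _).dvd_mul_right] at h1
  obtain ⟨a, b, hab⟩ := hcop
  have h1 := congrArg toLaurent hab
  rw [map_add, map_mul, map_mul, map_one, hP] at h1
  refine ⟨T m * toLaurent b, Ideal.mem_span_singleton.mpr ⟨-toLaurent a, ?_⟩⟩
  linear_combination h1

theorem one_notMem_span_cyclotomic {h : ℕ} (hh : 2 ≤ h) :
    (1 : ℚ[T;T⁻¹]) ∉ Ideal.span {toLaurent (cyclotomic h ℚ)} := by
  rw [Ideal.mem_span_singleton]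
  rintro ⟨y, hy⟩
  obtain ⟨m, P, hP⟩ := y.exists_T_pow
  have h1 : X ^ m = cyclotomic h ℚ * P := by
    refine toLaurent_injective ?_
    rw [map_mul, hP, ← mul_assoc, ← hy, one_mul, map_pow, toLaurent_X, T_pow, mul_one]
  have hirr := cyclotomic.irreducible_rat (show 0 < h by omega)
  have h2 := (hirr.associated_of_dvd irreducible_X
    (hirr.prime.dvd_of_dvd_pow (Dvd.intro P h1.symm))).symm.dvd
  rw [X_dvd_iff, cyclotomic_coeff_zero ℚ (by omega)] at h2
  exact one_ne_zero h2

theorem isPrime_span_cyclotomic {h : ℕ} (hh : 2 ≤ h) :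
    (Ideal.span {toLaurent (cyclotomic h ℚ)} : Ideal ℚ[T;T⁻¹]).IsPrime := by
  refine Ideal.IsMaximal.isPrime (Ideal.isMaximal_iff.mpr
    ⟨one_notMem_span_cyclotomic hh, fun J x hJ hx hxJ => ?_⟩)
  obtain ⟨y, hy⟩ := exists_mul_sub_one_mem (by omega) hx
  simpa using sub_mem (J.mul_mem_right y hxJ) (hJ hy)

end Laurent

section Main

open LaurentPolynomial

variable {n i : ℕ} {ρ : Representation ℚ[T;T⁻¹] (BraidGroup (n + 1)) ℚ[T;T⁻¹]}

theorem mem_blocks_iff {j : ℕ} (hj : j + 2 * (i + 1) = n + 1) (w : List ℕ) :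
    w ∈ blocks n j ↔ w.sum = j ∧ w.length = 2 * (i + 1) := by
  change w.sum = j ∧ w.length + j = n + 1 ↔ _
  omega

theorem subsingleton_groupCohomology
    (hρ : ∀ (s : Fin n) (x : ℚ[T;T⁻¹]), ρ (braidGen (n + 1) s) x = -T 1 * x) {j : ℕ}
    (hj : j + 2 * (i + 1) = n + 1) (hn : ¬ ∃ h, 2 ≤ h ∧ n = (i + 1) * h) :
    Subsingleton (groupCohomology (Rep.of ρ) j) := by
  have hex := nonempty_groupCohomology_equiv hρ j (M := PUnit) 0 ?_ ?_
  · obtain ⟨e⟩ := hex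
    exact e.toEquiv.subsingleton
  · intro f hf hc
    refine ⟨fun _ => ?_, fun _ => rfl⟩
    obtain ⟨g, hg⟩ := exists_cobd_eq_of_cyclotomic_dvd (i := i) (j := j)
      (fun w hw => hf w ((mem_blocks_iff hj w).not.mpr hw)) hc
      fun k hk h => absurd ⟨k + 1, by omega, by omega⟩ hn
    exact ⟨g, fun w _ => congrFun hg w⟩
  · exact fun m => ⟨0, fun _ _ => rfl, cobd_zero, rfl⟩

theorem nonempty_groupCohomology_equiv_cyclotomic
    (hρ : ∀ (s : Fin n) (x : ℚ[T;T⁻¹]), ρ (braidGen (n + 1) s) x = -T 1 * x) {j h : ℕ}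
    (hj : j + 2 * (i + 1) = n + 1) (hh : 2 ≤ h) (hn : n = (i + 1) * h) :
    Nonempty (groupCohomology (Rep.of ρ) j ≃ₗ[ℚ[T;T⁻¹]]
      (ℚ[T;T⁻¹] ⧸ Ideal.span {toLaurent (cyclotomic h ℚ)})) := by
  obtain ⟨k, rfl⟩ : ∃ k, h = k + 1 := ⟨h - 1, by omega⟩
  set p : Ideal ℚ[T;T⁻¹] := Ideal.span {toLaurent (cyclotomic (k + 1) ℚ)} with hpdef
  have hp : p.IsPrime := isPrime_span_cyclotomic hh
  have := charZero_quotient p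
  have hmem {x : ℚ[T;T⁻¹]} : x ∈ p ↔ toLaurent (cyclotomic (k + 1) ℚ) ∣ x :=
    Ideal.mem_span_singleton
  have hq := (cyclotomic_mem_iff p (by omega)).mp (Ideal.mem_span_singleton_self _)
  have hdvd : toLaurent (cyclotomic (k + 1) ℚ) ∣ gauss (T 1) 1 k :=
    Dvd.intro _ (cyclotomic_mul_cofactor hh rfl)
  refine nonempty_groupCohomology_equiv hρ j ((Submodule.mkQ p).comp (detect (T 1) k i)) ?_ ?_
  · intro f hf hc
    rw [LinearMap.comp_apply, Submodule.mkQ_apply, Submodule.Quotient.mk_eq_zero, hmem]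
    constructor
    · intro hd
      obtain ⟨g, hg⟩ := exists_cobd_eq_of_cyclotomic_dvd (i := i) (j := j)
        (fun w hw => hf w ((mem_blocks_iff hj w).not.mpr hw)) hc (by
          intro m _ h
          obtain rfl : m = k := by
            have h1 := Nat.eq_of_mul_eq_mul_left i.succ_pos
              (show (i + 1) * (m + 1) = (i + 1) * (k + 1) by omega)
            omega
          exact hd)
      exact ⟨g, fun w _ => congrFun hg w⟩
    · rintro ⟨g, hg⟩
      rw [← detect_congr (f := cobd (T 1) g)]
      · refine dvd_detect_cobd
          (fun x hx => (mul_eq_zero.mp hx).resolve_left (gauss_T_one_ne_zero k)) hdvd ?_ g i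
        intro m hm x hx
        rw [← hmem] at hx ⊢
        refine (hp.mem_or_mem hx).resolve_right fun h => ?_
        have := Nat.le_of_dvd m.succ_pos (dvd_of_gauss_mem hq m h).1
        omega
      · intro w h1 h2
        exact hg w ((mem_blocks_iff hj w).mpr ⟨by omega, h1⟩)
  · obtain ⟨f, hc, hf, hd⟩ := exists_cocycle_detect_notMem (p := p) (by omega)
      (gauss_T_one_ne_zero k) (dvd_of_gauss_mem hq) (hmem.mpr hdvd) (i := i) (j := j) (by omega)
    obtain ⟨y, hy⟩ := exists_mul_sub_one_mem (by omega) hd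
    intro m
    obtain ⟨x, rfl⟩ := Submodule.mkQ_surjective p m
    refine ⟨(x * y) • f, fun w hw => ?_, by rw [cobd_smul, hc, smul_zero], ?_⟩
    · rw [Pi.smul_apply, hf w ((mem_blocks_iff hj w).not.mp hw), smul_zero]
    · rw [LinearMap.comp_apply, map_smul, Submodule.mkQ_apply, Submodule.mkQ_apply,
        Submodule.Quotient.eq, smul_eq_mul]
      have h1 := p.mul_mem_left x hy
      convert h1 using 1
      ring

end Main

end BraidComplex

theorem braid_cohomology_odd_complementary_degree
    (n i : ℕ) (hn : 2 ≤ n) (hi : 1 ≤ i) (hd : 2 * i ≤ n + 1)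
    (ρ : Representation (LaurentPolynomial ℚ) (BraidGroup (n + 1)) (LaurentPolynomial ℚ))
    (hρ : ∀ (s : Fin n) (x : LaurentPolynomial ℚ),
      (ρ (braidGen (n + 1) s)) x = -(LaurentPolynomial.T 1) * x) :
    (∀ h : ℕ, 2 ≤ h → n = i * h →
      Nonempty ((groupCohomology (Rep.of ρ) (n + 1 - 2 * i)) ≃ₗ[LaurentPolynomial ℚ]
        (LaurentPolynomial ℚ ⧸
          Ideal.span {((cyclotomic h ℚ).toLaurent : LaurentPolynomial ℚ)}))) ∧
    ((¬ ∃ h : ℕ, 2 ≤ h ∧ n = i * h) →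
      Subsingleton (groupCohomology (Rep.of ρ) (n + 1 - 2 * i))) := by
  obtain ⟨i, rfl⟩ : ∃ i', i = i' + 1 := ⟨i - 1, by omega⟩
  have hj : n + 1 - 2 * (i + 1) + 2 * (i + 1) = n + 1 := by omega
  exact ⟨fun h hh hnh => BraidComplex.nonempty_groupCohomology_equiv_cyclotomic hρ hj hh hnh,
    fun h => BraidComplex.subsingleton_groupCohomology hρ hj h⟩
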